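/- Let g = sl(2,ℂ) with standard basis e, h, f, g̃ the affine Lie algebra of type A₁⁽¹⁾, and k a positive integer. The monomial vectors x(π)v_{kΛ₀} = ··· f(−j)^{c_j} h(−j)^{b_j} e(−j)^{a_j} ··· f(−1)^{c_1} h(−1)^{b_1} e(−1)^{a_1} f(0)^{c_0} v_{kΛ₀} satisfying the difference conditions c_{j+1}+b_{j+1}+c_j ≤ k, b_{j+1}+a_{j+1}+c_j ≤ k, a_{j+1}+c_j+b_j ≤ k, a_{j+1}+b_j+a_j ≤ k for all j ≥ 0, and the initial conditions a₁ ≤ k and c₀ = 0, are linearly independent in the vacuum standard module L(kΛ₀); hence (combined with spanning) they form a basis of L(kΛ₀). -/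

import Mathlib

/-!
STATEMENT 16 (Primc, Section 9: linear independence of the monomial bases of
the vacuum standard `A₁⁽¹⁾`-modules of Meurman–Primc and
Feigin–Kedem–Loktev–Miwa–Mukhin).

Let `g = sl(2,ℂ)` with standard basis `e, h, f`, let `g̃` be the affine Lie
algebra of type `A₁⁽¹⁾`, and let `k` be a positive integer.  The monomial
vectors
`x(π)v_{kΛ₀} = ⋯ f(−j)^{c_j} h(−j)^{b_j} e(−j)^{a_j} ⋯ f(−1)^{c_1} h(−1)^{b_1}
e(−1)^{a_1} f(0)^{c_0} v_{kΛ₀}`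
satisfying the difference conditions `c_{j+1}+b_{j+1}+c_j ≤ k`,
`b_{j+1}+a_{j+1}+c_j ≤ k`, `a_{j+1}+c_j+b_j ≤ k`, `a_{j+1}+b_j+a_j ≤ k`
for all `j ≥ 0`, and the initial conditions `a₁ ≤ k` and `c₀ = 0`, are
linearly independent in the vacuum standard module `L(kΛ₀)`; hence (combined
with spanning) they form a basis of `L(kΛ₀)`.

The vacuum module `L(kΛ₀)` is axiomatized by the structure `SL2VacuumModule`.
-/

open scoped BigOperators

/-- Axiomatization of the vacuum level `k` standard module `L(kΛ₀)` of the
affine Lie algebra `g̃ = sl(2,ℂ) ⊗ ℂ[t,t⁻¹] + ℂc + ℂd` of type `A₁⁽¹⁾`: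
the operators `e(n), h(n), f(n)`, the degree operator `d`, the affine
commutation relations at level `k` (with the normalized form `⟨h,h⟩ = 2`,
`⟨e,f⟩ = 1`), a highest weight vector of weight `kΛ₀`, truncation and
irreducibility. -/
structure SL2VacuumModule (k : ℕ) where
  V : Type
  [addCommGroup : AddCommGroup V]
  [module : Module ℂ V]
  /-- the action of `e(n) = e ⊗ tⁿ` -/
  E : ℤ → Module.End ℂ V
  /-- the action of `h(n) = h ⊗ tⁿ` -/
  Hh : ℤ → Module.End ℂ V
  /-- the action of `f(n) = f ⊗ tⁿ` -/
  F : ℤ → Module.End ℂ V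
  /-- the degree operator `d` -/
  D : Module.End ℂ V
  EE : ∀ m n, Commute (E m) (E n)
  FF : ∀ m n, Commute (F m) (F n)
  HE : ∀ m n, Hh m * E n - E n * Hh m = (2 : ℂ) • E (m + n)
  HF : ∀ m n, Hh m * F n - F n * Hh m = (-2 : ℂ) • F (m + n)
  EF : ∀ m n, E m * F n - F n * E m
    = Hh (m + n) + (if m + n = 0 then ((m * k : ℤ) : ℂ) else 0) • (1 : Module.End ℂ V)
  HH : ∀ m n, Hh m * Hh n - Hh n * Hh m
    = (if m + n = 0 then ((2 * m * k : ℤ) : ℂ) else 0) • (1 : Module.End ℂ V)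
  DE : ∀ n, D * E n - E n * D = (n : ℂ) • E n
  DH : ∀ n, D * Hh n - Hh n * D = (n : ℂ) • Hh n
  DF : ∀ n, D * F n - F n * D = (n : ℂ) • F n
  /-- the highest weight vector `v_{kΛ₀}` -/
  hwv : V
  hwv_ne : hwv ≠ 0
  /-- `e(n)v = h(n)v = f(n)v = 0` for `n ≥ 0` (the weight `kΛ₀` restricts to
  `0` on the Cartan subalgebra of `sl₂`, and `⟨kΛ₀, α₁^∨⟩ = 0`) -/
  hwv_hw : ∀ n : ℤ, 0 ≤ n → E n hwv = 0 ∧ Hh n hwv = 0 ∧ F n hwv = 0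
  hwv_deg : D hwv = 0
  /-- every vector is annihilated by all operators of sufficiently large mode -/
  trunc : ∀ w : V, ∃ N : ℤ, ∀ n, N ≤ n → E n w = 0 ∧ Hh n w = 0 ∧ F n w = 0
  /-- irreducibility -/
  irred : ∀ U : Submodule ℂ V,
    (∀ n, ∀ u ∈ U, E n u ∈ U ∧ Hh n u ∈ U ∧ F n u ∈ U) → U = ⊥ ∨ U = ⊤

attribute [instance] SL2VacuumModule.addCommGroup SL2VacuumModule.module

/-- A colored partition for `A₁⁽¹⁾`-monomials: exponents
`a_j = π(e(−j))`, `b_j = π(h(−j))` for `j ≥ 1` and `c_j = π(f(−j))` for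
`j ≥ 0`, finitely many nonzero. -/
structure SL2CPart : Type where
  a : ℕ →₀ ℕ
  b : ℕ →₀ ℕ
  c : ℕ →₀ ℕ
  a_zero : a 0 = 0
  b_zero : b 0 = 0

namespace SL2CPart

/-- a bound for the parts occurring in `π` -/
def bound (π : SL2CPart) : ℕ :=
  ((π.a.support ∪ π.b.support ∪ π.c.support).sup id) + 1

/-- the monomial
`x(π) = ⋯ f(−j)^{c_j} h(−j)^{b_j} e(−j)^{a_j} ⋯ f(−1)^{c_1} h(−1)^{b_1} e(−1)^{a_1} f(0)^{c_0}` -/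
noncomputable def toEnd {k : ℕ} (π : SL2CPart) (S : SL2VacuumModule k) :
    Module.End ℂ S.V :=
  (((List.range (π.bound + 1)).reverse).map fun (j : ℕ) =>
    (S.F (-(j : ℤ))) ^ (π.c j) * (S.Hh (-(j : ℤ))) ^ (π.b j) *
      (S.E (-(j : ℤ))) ^ (π.a j)).prod

/-- the difference conditions at level `k`, for all `j ≥ 0` -/
def DC (π : SL2CPart) (k : ℕ) : Prop :=
  ∀ j : ℕ,
    π.c (j + 1) + π.b (j + 1) + π.c j ≤ k ∧
    π.b (j + 1) + π.a (j + 1) + π.c j ≤ k ∧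
    π.a (j + 1) + π.c j + π.b j ≤ k ∧
    π.a (j + 1) + π.b j + π.a j ≤ k

/-- the initial conditions for `Λ = kΛ₀`: `a₁ ≤ k` and `c₀ = 0` -/
def IC (π : SL2CPart) (k : ℕ) : Prop :=
  π.a 1 ≤ k ∧ π.c 0 = 0

end SL2CPart

namespace SL2Vac

/-- Structure constant: `[x_p, x_q]` has coefficient `sc p q` at `x_{p+q-1}`. -/
def sc (p q : ℤ) : ℝ :=
  if p % 3 = 0 then (if q % 3 = 0 then 0 else if q % 3 = 1 then -2 else 1)
  else if p % 3 = 1 then (if q % 3 = 0 then 2 else if q % 3 = 1 then 0 else -2)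
  else (if q % 3 = 0 then -1 else if q % 3 = 1 then 2 else 0)

/-- Structure constant of the central term at level one. -/
def sd (p q : ℤ) : ℝ :=
  if p / 3 + q / 3 = 0 then
    (if p % 3 + q % 3 = 2 then (-(p / 3 : ℤ) : ℝ) * (if p % 3 = 1 then 2 else 1) else 0)
  else 0

/-- A vacuum representation of level `κ`: the letter `p` stands for the operator of mode
`-(p / 3)` attached to `e`, `h` or `f` according to `p % 3`. -/
structure VRep (κ : ℝ) (V : Type*) [AddCommGroup V] [Module ℝ V] where
  X : ℤ → Module.End ℝ V
  v : V
  comm : ∀ p q, X p * X q - X q * X p = sc p q • X (p + q - 1) + (κ * sd p q) • 1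
  vac : ∀ p, p < 3 → X p v = 0

/-- total degree of a word -/
def degL (u : List ℤ) : ℤ := (u.map fun p => p / 3).sum

/-- total degree of a multiset of letters -/
def degM (σ : Multiset ℤ) : ℤ := (σ.map fun p => p / 3).sum

/-- total color of a multiset of letters -/
def colM (σ : Multiset ℤ) : ℤ := (σ.map fun p => p % 3).sum

/-- quadratic weight of a letter -/
def om (p : ℤ) : ℤ := 3 * (p / 3) ^ 2 + 3 * (p / 3) * (p % 3) + (p % 3) ^ 2

/-- quadratic weight of a multiset of letters -/
def omM (σ : Multiset ℤ) : ℤ := (σ.map om).sum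

/-- `σ` strictly precedes `τ`. -/
def Prec (σ τ : Multiset ℤ) : Prop :=
  σ.card < τ.card ∨ (σ.card = τ.card ∧ omM τ < omM σ)

/-- All letters have negative mode. -/
def Neg (σ : Multiset ℤ) : Prop := ∀ p ∈ σ, 3 ≤ p

/-- The difference conditions at level `k`. -/
def Adm (k : ℕ) (σ : Multiset ℤ) : Prop :=
  Neg σ ∧ ∀ j : ℤ,
    σ.count (3 * j) + σ.count (3 * j + 1) + σ.count (3 * j + 3) ≤ k ∧
    σ.count (3 * j + 1) + σ.count (3 * j + 2) + σ.count (3 * j + 3) ≤ k ∧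
    σ.count (3 * j + 2) + σ.count (3 * j + 3) + σ.count (3 * j + 4) ≤ k ∧
    σ.count (3 * j + 2) + σ.count (3 * j + 4) + σ.count (3 * j + 5) ≤ k

namespace VRep

variable {κ : ℝ} {V : Type*} [AddCommGroup V] [Module ℝ V] (R : VRep κ V)

/-- the operator of a word -/
def wd (u : List ℤ) : Module.End ℝ V := (u.map R.X).prod

/-- the monomial vector of a multiset of letters -/
noncomputable def mon (σ : Multiset ℤ) : V := R.wd (σ.sort (· ≥ ·)) R.v

/-- the generating current, mode `-j` -/
noncomputable def Y (t : ℝ) (j : ℤ) : Module.End ℝ V :=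
  R.X (3 * j) - t • R.X (3 * j + 1) - t ^ 2 • R.X (3 * j + 2)

/-- The generating current with a cut-off. -/
noncomputable def G (t : ℝ) (D : ℕ) : PowerSeries (Module.End ℝ V) :=
  PowerSeries.mk fun m => R.Y t (m - D)

/-- The `(k+1)`-st power of the current vanishes. -/
def FieldRel (k : ℕ) : Prop :=
  ∀ w : V, ∃ D₀ : ℕ, ∀ D, D₀ ≤ D → ∀ t : ℝ, ∀ M : ℕ,
    (PowerSeries.coeff M ((R.G t D) ^ (k + 1))) w = 0

/-- span of words of length `< n` and degree `d` applied to the vacuum -/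
def Fil (n : ℕ) (d : ℤ) : Submodule ℝ V :=
  Submodule.span ℝ {x | ∃ u : List ℤ, u.length < n ∧ degL u = d ∧ x = R.wd u R.v}

@[simp] lemma wd_nil : R.wd [] = 1 := by simp [wd]

lemma wd_cons (p : ℤ) (u : List ℤ) : R.wd (p :: u) = R.X p * R.wd u := by simp [wd]

lemma wd_append (u w : List ℤ) : R.wd (u ++ w) = R.wd u * R.wd w := by simp [wd]

lemma Fil_mono {m n : ℕ} (h : m ≤ n) (d : ℤ) : R.Fil m d ≤ R.Fil n d := by
  apply Submodule.span_mono
  rintro x ⟨u, hu, hd, rfl⟩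
  exact ⟨u, by omega, hd, rfl⟩

lemma wd_mem_Fil {n : ℕ} {d : ℤ} (u : List ℤ) (h : u.length < n) (hd : degL u = d) :
    R.wd u R.v ∈ R.Fil n d := Submodule.subset_span ⟨u, h, hd, rfl⟩

lemma X_Fil {n : ℕ} {d : ℤ} (p : ℤ) {x : V} (hx : x ∈ R.Fil n d) :
    R.X p x ∈ R.Fil (n + 1) (p / 3 + d) := by
  have : R.Fil n d ≤ (R.Fil (n + 1) (p / 3 + d)).comap (R.X p) := by
    apply Submodule.span_le.2
    rintro x ⟨u, hu, hd, rfl⟩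
    have := R.wd_mem_Fil (n := n + 1) (d := p / 3 + d) (p :: u) (by simpa using hu)
      (by simp [degL, ← hd])
    simpa [wd_cons] using this
  exact this hx

lemma sc_ne {p q : ℤ} (h : sc p q ≠ 0) : (p + q - 1) / 3 = p / 3 + q / 3 := by
  unfold sc at h
  split_ifs at h <;> first | omega | simp at h

lemma sd_ne {p q : ℤ} (h : sd p q ≠ 0) : p / 3 + q / 3 = 0 := by
  unfold sd at h
  split_ifs at h <;> first | assumption | simp at h

lemma swap_mem (p q : ℤ) (u : List ℤ) :
    R.wd (p :: q :: u) R.v - R.wd (q :: p :: u) R.v ∈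
      R.Fil (u.length + 2) (degL (p :: q :: u)) := by
  have h := congrArg (fun T : Module.End ℝ V => T (R.wd u R.v)) (R.comm p q)
  simp only [LinearMap.sub_apply, LinearMap.add_apply, LinearMap.smul_apply,
    Module.End.mul_apply, Module.End.one_apply] at h
  simp only [wd_cons, Module.End.mul_apply]
  rw [h]
  refine Submodule.add_mem _ ?_ ?_
  · by_cases hc : sc p q = 0
    · simp [hc]
    · refine Submodule.smul_mem _ _ ?_
      have := R.wd_mem_Fil (n := u.length + 2) (d := degL (p :: q :: u)) ((p + q - 1) :: u)
        (by simp) (by have := sc_ne hc; simp [degL]; omega)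
      simpa [wd_cons] using this
  · by_cases hc : sd p q = 0
    · simp [hc]
    · refine Submodule.smul_mem _ _ ?_
      exact R.wd_mem_Fil u (by simp) (by have := sd_ne hc; simp [degL]; omega)

lemma degL_perm {u w : List ℤ} (h : u.Perm w) : degL u = degL w := by
  unfold degL
  exact (h.map _).sum_eq

lemma perm_mem {u w : List ℤ} (h : u.Perm w) :
    R.wd u R.v - R.wd w R.v ∈ R.Fil u.length (degL u) := by
  induction h with
  | nil => simp
  | cons p h ih =>
    have := R.X_Fil p ih
    simpa [wd_cons, degL] using this
  | swap p q u => 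
    have := R.swap_mem q p u
    simpa using this
  | trans h1 h2 ih1 ih2 =>
    rw [← h1.length_eq, ← degL_perm h1] at ih2
    have := Submodule.add_mem _ ih1 ih2
    simpa using this

lemma nonneg_mem {u : List ℤ} {p : ℤ} (hp : p ∈ u) (h3 : p < 3) :
    R.wd u R.v ∈ R.Fil u.length (degL u) := by
  have h : u.Perm (u.erase p ++ [p]) :=
    (List.perm_cons_erase hp).trans (List.perm_append_singleton _ _).symm
  have := R.perm_mem h
  rw [wd_append] at this
  simpa [wd, R.vac p h3] using this

lemma mon_coe (u : List ℤ) :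
    R.wd u R.v - R.mon (u : Multiset ℤ) ∈ R.Fil u.length (degL u) := by
  apply R.perm_mem
  apply Multiset.coe_eq_coe.1
  exact (Multiset.sort_eq _ _).symm

lemma degM_coe (u : List ℤ) : degM (u : Multiset ℤ) = degL u := by simp [degM, degL]

lemma mon_add (σ τ : Multiset ℤ) (u : List ℤ) (hu : (u : Multiset ℤ) = σ) :
    R.wd u (R.mon τ) - R.mon (σ + τ) ∈ R.Fil (σ + τ).card (degM (σ + τ)) := by
  subst hu
  have := R.mon_coe (u ++ τ.sort (· ≥ ·))
  rw [wd_append, ← degM_coe, ← Multiset.coe_add, Multiset.sort_eq] at this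
  simpa [mon] using this

lemma Fil_le_span (n : ℕ) (d : ℤ) : R.Fil n d ≤
    Submodule.span ℝ {x | ∃ σ, Neg σ ∧ σ.card < n ∧ degM σ = d ∧ x = R.mon σ} := by
  induction n with
  | zero =>
    apply Submodule.span_le.2
    rintro x ⟨u, hu, hd, rfl⟩
    omega
  | succ n ih =>
    replace ih : R.Fil n d ≤ Submodule.span ℝ
        {x | ∃ σ, Neg σ ∧ σ.card < n + 1 ∧ degM σ = d ∧ x = R.mon σ} := by
      refine ih.trans (Submodule.span_mono ?_)
      rintro x ⟨σ, h1, h2, h3, rfl⟩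
      exact ⟨σ, h1, by omega, h3, rfl⟩
    apply Submodule.span_le.2
    rintro x ⟨u, hu, hd, rfl⟩
    have hF : R.Fil u.length (degL u) ≤ R.Fil n d := by
      rw [hd]; exact R.Fil_mono (by omega) d
    by_cases h : ∃ p ∈ u, p < 3
    · obtain ⟨p, hp, h3⟩ := h
      exact ih (hF (R.nonneg_mem hp h3))
    · push Not at h
      have h1 := ih (hF (R.mon_coe u))
      have h2 : R.mon (u : Multiset ℤ) ∈ Submodule.span ℝ
        {x | ∃ σ, Neg σ ∧ σ.card < n + 1 ∧ degM σ = d ∧ x = R.mon σ} :=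
        Submodule.subset_span ⟨u, by simpa [Neg] using h, by simpa using hu,
          by rw [← hd]; simp [degM, degL], rfl⟩
      simpa using Submodule.add_mem _ h1 h2

end VRep

lemma three_letters {x y z : ℤ} (μ : Multiset ℤ) (h : ∀ p ∈ μ, p = x ∨ p = y ∨ p = z) :
    ∃ n₁ n₂ n₃ : ℕ, μ = n₁ • {x} + n₂ • {y} + n₃ • {z} := by
  induction μ using Multiset.induction_on with
  | empty => exact ⟨0, 0, 0, by simp⟩
  | cons a s ih =>
    obtain ⟨n₁, n₂, n₃, hs⟩ := ih fun p hp => h p (Multiset.mem_cons_of_mem hp)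
    rcases h a (Multiset.mem_cons_self a s) with rfl | rfl | rfl
    · exact ⟨n₁ + 1, n₂, n₃, by rw [hs, ← Multiset.singleton_add, add_smul, one_smul]; abel⟩
    · exact ⟨n₁, n₂ + 1, n₃, by rw [hs, ← Multiset.singleton_add, add_smul, one_smul]; abel⟩
    · exact ⟨n₁, n₂, n₃ + 1, by rw [hs, ← Multiset.singleton_add, add_smul, one_smul]; abel⟩

lemma degM_add (σ τ : Multiset ℤ) : degM (σ + τ) = degM σ + degM τ := by simp [degM]
lemma colM_add (σ τ : Multiset ℤ) : colM (σ + τ) = colM σ + colM τ := by simp [colM]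
lemma omM_add (σ τ : Multiset ℤ) : omM (σ + τ) = omM σ + omM τ := by simp [omM]

lemma degM_nsmul (n : ℕ) (x : ℤ) : degM (n • {x}) = n * (x / 3) := by
  simp [degM, Multiset.map_nsmul, Multiset.sum_nsmul]
lemma colM_nsmul (n : ℕ) (x : ℤ) : colM (n • {x}) = n * (x % 3) := by
  simp [colM, Multiset.map_nsmul, Multiset.sum_nsmul]

lemma omM_ge {α β γ : ℤ} (hle : ∀ p : ℤ, α * (p / 3) + β * (p % 3) + γ ≤ om p)
    (μ : Multiset ℤ) : α * degM μ + β * colM μ + γ * μ.card ≤ omM μ := by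
  induction μ using Multiset.induction_on with
  | empty => simp [degM, colM, omM]
  | cons a s ih =>
    have := hle a
    rw [← Multiset.singleton_add, degM_add, colM_add, omM_add, Multiset.card_add]
    simp only [degM, colM, omM, Multiset.map_singleton, Multiset.sum_singleton,
      Multiset.card_singleton] at *
    push_cast
    linarith

lemma omM_eq {α β γ : ℤ} (hle : ∀ p : ℤ, α * (p / 3) + β * (p % 3) + γ ≤ om p)
    (μ : Multiset ℤ) (h : omM μ = α * degM μ + β * colM μ + γ * μ.card) :
    ∀ p ∈ μ, om p = α * (p / 3) + β * (p % 3) + γ := by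
  intro p hp
  obtain ⟨s, rfl⟩ := Multiset.exists_cons_of_mem hp
  have h1 := omM_ge hle s
  have h2 := hle p
  rw [← Multiset.singleton_add, degM_add, colM_add, omM_add, Multiset.card_add] at h
  simp only [degM, colM, omM, Multiset.map_singleton, Multiset.sum_singleton,
    Multiset.card_singleton] at *
  push_cast at h
  linarith

lemma omM_eq' {α β γ : ℤ} (μ : Multiset ℤ)
    (h : ∀ p ∈ μ, om p = α * (p / 3) + β * (p % 3) + γ) :
    omM μ = α * degM μ + β * colM μ + γ * μ.card := by
  induction μ using Multiset.induction_on with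
  | empty => simp [degM, colM, omM]
  | cons a s ih =>
    have h1 := h a (Multiset.mem_cons_self a s)
    have h2 := ih fun p hp => h p (Multiset.mem_cons_of_mem hp)
    rw [← Multiset.singleton_add, degM_add, colM_add, omM_add, Multiset.card_add]
    simp only [degM, colM, omM, Multiset.map_singleton, Multiset.sum_singleton,
      Multiset.card_singleton] at *
    push_cast
    linarith

/-- A multiset supported on a triangle minimizes the quadratic weight. -/
def Extremal (lm : Multiset ℤ) : Prop :=
  ∀ μ : Multiset ℤ, μ.card = lm.card → degM μ = degM lm → colM μ = colM lm →
    μ = lm ∨ omM lm < omM μ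

lemma extremal_of_affine {x y z : ℤ} (α β γ : ℤ)
    (hle : ∀ p : ℤ, α * (p / 3) + β * (p % 3) + γ ≤ om p)
    (heq : ∀ p : ℤ, om p = α * (p / 3) + β * (p % 3) + γ ↔ p = x ∨ p = y ∨ p = z)
    (hind : ∀ n₁ n₂ n₃ m₁ m₂ m₃ : ℤ, n₁ + n₂ + n₃ = m₁ + m₂ + m₃ →
      n₁ * (x / 3) + n₂ * (y / 3) + n₃ * (z / 3) = m₁ * (x / 3) + m₂ * (y / 3) + m₃ * (z / 3) →
      n₁ * (x % 3) + n₂ * (y % 3) + n₃ * (z % 3) = m₁ * (x % 3) + m₂ * (y % 3) + m₃ * (z % 3) →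
      n₁ = m₁ ∧ n₂ = m₂ ∧ n₃ = m₃)
    (lm : Multiset ℤ) (hl : ∀ p ∈ lm, p = x ∨ p = y ∨ p = z) : Extremal lm := by
  intro μ hc hd hs
  have h1 := omM_ge hle μ
  have h2 := omM_eq' lm fun p hp => (heq p).2 (hl p hp)
  rw [hc, hd, hs, ← h2] at h1
  rcases h1.lt_or_eq with h | h
  · exact Or.inr h
  left
  have h3 := omM_eq hle μ (by rw [← h, h2, hc, hd, hs])
  obtain ⟨n₁, n₂, n₃, rfl⟩ := three_letters μ fun p hp => (heq p).1 (h3 p hp)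
  obtain ⟨m₁, m₂, m₃, rfl⟩ := three_letters lm hl
  simp only [degM_add, colM_add, degM_nsmul, colM_nsmul, Multiset.card_add, Multiset.card_nsmul,
    Multiset.card_singleton] at hc hd hs
  obtain ⟨e1, e2, e3⟩ := hind n₁ n₂ n₃ m₁ m₂ m₃ (by exact_mod_cast (by simpa using hc)) hd hs
  norm_cast at e1 e2 e3
  rw [e1, e2, e3]

lemma extremal_of_form (j c₀ c₁ c₂ u₁ s₁ u₂ s₂ u₃ s₃ : ℤ)
    (h₁ : s₁ = 0 ∨ s₁ = 1 ∨ s₁ = 2) (h₂ : s₂ = 0 ∨ s₂ = 1 ∨ s₂ = 2)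
    (h₃ : s₃ = 0 ∨ s₃ = 1 ∨ s₃ = 2)
    (hQ : ∀ u s : ℤ, (s = 0 ∨ s = 1 ∨ s = 2) →
      0 ≤ 3 * u ^ 2 + 3 * u * s + s ^ 2 + c₀ + c₁ * u + c₂ * s ∧
      (3 * u ^ 2 + 3 * u * s + s ^ 2 + c₀ + c₁ * u + c₂ * s = 0 ↔
        (u = u₁ ∧ s = s₁) ∨ (u = u₂ ∧ s = s₂) ∨ (u = u₃ ∧ s = s₃)))
    (hind : ∀ n₁ n₂ n₃ m₁ m₂ m₃ : ℤ, n₁ + n₂ + n₃ = m₁ + m₂ + m₃ →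
      n₁ * u₁ + n₂ * u₂ + n₃ * u₃ = m₁ * u₁ + m₂ * u₂ + m₃ * u₃ →
      n₁ * s₁ + n₂ * s₂ + n₃ * s₃ = m₁ * s₁ + m₂ * s₂ + m₃ * s₃ →
      n₁ = m₁ ∧ n₂ = m₂ ∧ n₃ = m₃)
    (lm : Multiset ℤ) (hl : ∀ p ∈ lm, p = 3 * (j + u₁) + s₁ ∨ p = 3 * (j + u₂) + s₂ ∨
      p = 3 * (j + u₃) + s₃) : Extremal lm := by
  have key : ∀ p : ℤ, ∃ u s : ℤ, p = 3 * (j + u) + s ∧ p / 3 = j + u ∧ p % 3 = s ∧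
      (s = 0 ∨ s = 1 ∨ s = 2) := fun p =>
    ⟨p / 3 - j, p % 3, by omega, by omega, rfl, by omega⟩
  refine extremal_of_affine (6 * j - c₁) (3 * j - c₂) (-3 * j ^ 2 - c₀ + c₁ * j) ?_ ?_ ?_ lm hl
  · intro p
    obtain ⟨u, s, -, e1, e2, hs⟩ := key p
    have := (hQ u s hs).1
    rw [om, e1, e2]
    linarith
  · intro p
    obtain ⟨u, s, hp, e1, e2, hs⟩ := key p
    have := (hQ u s hs).2
    rw [om, e1, e2]
    clear hQ hl hind
    constructor
    · intro h
      have h' := this.1 (by linear_combination h)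
      rw [hp]
      rcases h' with ⟨rfl, rfl⟩ | ⟨rfl, rfl⟩ | ⟨rfl, rfl⟩ <;> simp
    · intro h
      have h' : (u = u₁ ∧ s = s₁) ∨ (u = u₂ ∧ s = s₂) ∨ (u = u₃ ∧ s = s₃) := by
        rcases h with h | h | h
        · exact Or.inl (by clear this h₂ h₃; omega)
        · exact Or.inr (Or.inl (by clear this h₁ h₃; omega))
        · exact Or.inr (Or.inr (by clear this h₁ h₂; omega))
      linear_combination this.2 h'
  · intro n₁ n₂ n₃ m₁ m₂ m₃ e1 e2 e3
    have a1 : (3 * (j + u₁) + s₁) / 3 = j + u₁ := by omega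
    have a2 : (3 * (j + u₂) + s₂) / 3 = j + u₂ := by omega
    have a3 : (3 * (j + u₃) + s₃) / 3 = j + u₃ := by omega
    have b1 : (3 * (j + u₁) + s₁) % 3 = s₁ := by omega
    have b2 : (3 * (j + u₂) + s₂) % 3 = s₂ := by omega
    have b3 : (3 * (j + u₃) + s₃) % 3 = s₃ := by omega
    rw [a1, a2, a3] at e2
    rw [b1, b2, b3] at e3
    have e4 : (n₁ + n₂ + n₃) * j = (m₁ + m₂ + m₃) * j := by rw [e1]
    exact hind _ _ _ _ _ _ e1 (by linarith) e3

lemma int_four_cases (u : ℤ) : u ≤ -1 ∨ u = 0 ∨ u = 1 ∨ 2 ≤ u := by omega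

lemma extremal_one (j : ℤ) (lm : Multiset ℤ)
    (hl : ∀ p ∈ lm, p = 3 * j ∨ p = 3 * j + 1 ∨ p = 3 * j + 3) : Extremal lm := by
  refine extremal_of_form j 0 (-3) (-1) 0 0 0 1 1 0 (by simp) (by simp) (by simp) ?_ ?_ lm
    fun p hp => by have := hl p hp; omega
  · intro u s hs
    rcases hs with rfl | rfl | rfl <;> rcases int_four_cases u with h | rfl | rfl | h <;>
      first | omega | exact ⟨by nlinarith, fun h' => by nlinarith, fun h' => by omega⟩
  · omega

lemma extremal_two (j : ℤ) (lm : Multiset ℤ)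
    (hl : ∀ p ∈ lm, p = 3 * j + 1 ∨ p = 3 * j + 2 ∨ p = 3 * j + 3) : Extremal lm := by
  refine extremal_of_form j 2 (-5) (-3) 0 1 0 2 1 0 (by simp) (by simp) (by simp) ?_ ?_ lm
    fun p hp => by have := hl p hp; omega
  · intro u s hs
    rcases hs with rfl | rfl | rfl <;> rcases int_four_cases u with h | rfl | rfl | h <;>
      first | omega | exact ⟨by nlinarith, fun h' => by nlinarith, fun h' => by omega⟩
  · omega

lemma extremal_three (j : ℤ) (lm : Multiset ℤ)
    (hl : ∀ p ∈ lm, p = 3 * j + 2 ∨ p = 3 * j + 3 ∨ p = 3 * j + 4) : Extremal lm := by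
  refine extremal_of_form j 4 (-7) (-4) 0 2 1 0 1 1 (by simp) (by simp) (by simp) ?_ ?_ lm
    fun p hp => by have := hl p hp; omega
  · intro u s hs
    rcases hs with rfl | rfl | rfl <;> rcases int_four_cases u with h | rfl | rfl | h <;>
      first | omega | exact ⟨by nlinarith, fun h' => by nlinarith, fun h' => by omega⟩
  · omega

lemma extremal_four (j : ℤ) (lm : Multiset ℤ)
    (hl : ∀ p ∈ lm, p = 3 * j + 2 ∨ p = 3 * j + 4 ∨ p = 3 * j + 5) : Extremal lm := by
  refine extremal_of_form j 8 (-9) (-6) 0 2 1 1 1 2 (by simp) (by simp) (by simp) ?_ ?_ lm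
    fun p hp => by have := hl p hp; omega
  · intro u s hs
    rcases hs with rfl | rfl | rfl <;> rcases int_four_cases u with h | rfl | rfl | h <;>
      first | omega | exact ⟨by nlinarith, fun h' => by nlinarith, fun h' => by omega⟩
  · omega

lemma exists_le_of_count {x y z : ℤ} (hxy : x ≠ y) (hyz : y ≠ z) (hxz : x ≠ z) {k : ℕ}
    {τ : Multiset ℤ} (h : k < τ.count x + τ.count y + τ.count z) :
    ∃ lm ≤ τ, lm.card = k + 1 ∧ ∀ p ∈ lm, p = x ∨ p = y ∨ p = z := by
  let τ' := τ.filter fun p => p = x ∨ p = y ∨ p = z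
  have hle : Multiset.replicate (τ.count x) x + Multiset.replicate (τ.count y) y +
      Multiset.replicate (τ.count z) z ≤ τ' := by
    rw [Multiset.le_iff_count]
    intro a
    simp only [Multiset.count_add, Multiset.count_replicate, τ', Multiset.count_filter]
    by_cases h1 : a = x
    · subst h1; simp [hxy.symm, hxz.symm]
    by_cases h2 : a = y
    · subst h2; simp [hxy, hyz.symm]
    by_cases h3 : a = z
    · subst h3; simp [hxz, hyz]
    · simp [Ne.symm h1, Ne.symm h2, Ne.symm h3]
  have hc := Multiset.card_le_card hle
  simp only [Multiset.card_add, Multiset.card_replicate] at hc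
  obtain ⟨lm, h1, h2⟩ : ∃ lm ≤ τ', lm.card = k + 1 := by
    have hne : 0 < (Multiset.powersetCard (k + 1) τ').card := by
      rw [Multiset.card_powersetCard]
      exact Nat.choose_pos (by omega)
    obtain ⟨lm, hlm⟩ := Multiset.card_pos_iff_exists_mem.1 hne
    exact ⟨lm, Multiset.mem_powersetCard.1 hlm⟩
  refine ⟨lm, h1.trans (Multiset.filter_le _ _), h2, fun p hp => ?_⟩
  exact (Multiset.mem_filter.1 (Multiset.mem_of_le h1 hp)).2

/-- A multiset violating the difference conditions contains an extremal multiset. -/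
lemma exists_extremal {k : ℕ} {τ : Multiset ℤ} (hn : Neg τ) (h : ¬ Adm k τ) :
    ∃ lm ≤ τ, lm.card = k + 1 ∧ Extremal lm := by
  simp only [Adm, hn, true_and, not_forall] at h
  obtain ⟨j, hj⟩ := h
  by_cases h1 : k < τ.count (3 * j) + τ.count (3 * j + 1) + τ.count (3 * j + 3)
  · obtain ⟨lm, a, b, c⟩ := exists_le_of_count (by omega) (by omega) (by omega) h1
    exact ⟨lm, a, b, extremal_one j lm c⟩
  by_cases h2 : k < τ.count (3 * j + 1) + τ.count (3 * j + 2) + τ.count (3 * j + 3)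
  · obtain ⟨lm, a, b, c⟩ := exists_le_of_count (by omega) (by omega) (by omega) h2
    exact ⟨lm, a, b, extremal_two j lm c⟩
  by_cases h3 : k < τ.count (3 * j + 2) + τ.count (3 * j + 3) + τ.count (3 * j + 4)
  · obtain ⟨lm, a, b, c⟩ := exists_le_of_count (by omega) (by omega) (by omega) h3
    exact ⟨lm, a, b, extremal_three j lm c⟩
  by_cases h4 : k < τ.count (3 * j + 2) + τ.count (3 * j + 4) + τ.count (3 * j + 5)
  · obtain ⟨lm, a, b, c⟩ := exists_le_of_count (by omega) (by omega) (by omega) h4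
    exact ⟨lm, a, b, extremal_four j lm c⟩
  exact absurd ⟨by omega, by omega, by omega, by omega⟩ hj


/-- coefficient of a colored letter in the current -/
def eps (c : Fin 3) : ℝ := if c = 0 then 1 else -1

/-- letter attached to a position and a color -/
def lett (D : ℕ) (a : ℕ × Fin 3) : ℤ := 3 * ((a.1 : ℤ) - D) + (a.2 : ℕ)

namespace VRep

variable {κ : ℝ} {V : Type*} [AddCommGroup V] [Module ℝ V] (R : VRep κ V)

lemma coeff_G (t : ℝ) (D m : ℕ) : PowerSeries.coeff m (R.G t D) =
    ∑ c : Fin 3, (eps c * t ^ (c : ℕ)) • R.X (lett D (m, c)) := by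
  simp [G, Y, Fin.sum_univ_three, eps, lett, sub_eq_add_neg]

lemma coeff_G_pow (t : ℝ) (D L n M : ℕ) (hM : M < L) :
    PowerSeries.coeff M ((R.G t D) ^ n) =
    ∑ f : Fin n → Fin L × Fin 3, if ∑ i, ((f i).1 : ℕ) = M then
      (∏ i, (eps (f i).2 * t ^ ((f i).2 : ℕ))) •
        R.wd (List.ofFn fun i => lett D ((f i).1, (f i).2)) else 0 := by
  induction n generalizing M with
  | zero =>
    simp only [pow_zero, PowerSeries.coeff_one]
    rw [Fintype.sum_unique]
    simp [eq_comm]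
  | succ n ih =>
    rw [pow_succ', PowerSeries.coeff_mul, Finset.Nat.sum_antidiagonal_eq_sum_range_succ
      (fun a b => PowerSeries.coeff a (R.G t D) * PowerSeries.coeff b (R.G t D ^ n))]
    have e1 : ∀ m ∈ Finset.range M.succ, PowerSeries.coeff m (R.G t D) *
        PowerSeries.coeff (M - m) (R.G t D ^ n) = ∑ c : Fin 3, ∑ f : Fin n → Fin L × Fin 3,
          if m + ∑ i, ((f i).1 : ℕ) = M then
          ((eps c * t ^ (c : ℕ)) * ∏ i, (eps (f i).2 * t ^ ((f i).2 : ℕ))) •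
          (R.X (lett D (m, c)) * R.wd (List.ofFn fun i => lett D ((f i).1, (f i).2)))
          else 0 := by
      intro m hm
      have hm' := Finset.mem_range.1 hm
      rw [ih (M - m) (by omega), coeff_G, Finset.sum_mul]
      refine Finset.sum_congr rfl fun c _ => ?_
      rw [Finset.mul_sum]
      refine Finset.sum_congr rfl fun f _ => ?_
      rw [mul_ite, mul_zero, smul_mul_smul_comm]
      congr 1
      simp only [eq_iff_iff]
      omega
    rw [Finset.sum_congr rfl e1]
    have e2 : ∀ g : ℕ → Module.End ℝ V, (∀ m, M < m → g m = 0) →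
        ∑ m ∈ Finset.range M.succ, g m = ∑ m : Fin L, g m := by
      intro g hg
      rw [Fin.sum_univ_eq_sum_range]
      refine Finset.sum_subset ?_ ?_
      · intro x hx
        simp only [Finset.mem_range] at *
        omega
      · intro x _ hx
        exact hg x (by simpa using hx)
    rw [e2]
    · rw [← Fintype.sum_prod_type' (f := fun (m : Fin L) (c : Fin 3) =>
        ∑ f : Fin n → Fin L × Fin 3, if (m : ℕ) + ∑ i, ((f i).1 : ℕ) = M then
          ((eps c * t ^ (c : ℕ)) * ∏ i, (eps (f i).2 * t ^ ((f i).2 : ℕ))) •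
          (R.X (lett D (m, c)) * R.wd (List.ofFn fun i => lett D ((f i).1, (f i).2)))
          else 0), ← Fintype.sum_prod_type' (f := fun (a : Fin L × Fin 3)
        (f : Fin n → Fin L × Fin 3) => if (a.1 : ℕ) + ∑ i, ((f i).1 : ℕ) = M then
          ((eps a.2 * t ^ (a.2 : ℕ)) * ∏ i, (eps (f i).2 * t ^ ((f i).2 : ℕ))) •
          (R.X (lett D (a.1, a.2)) * R.wd (List.ofFn fun i => lett D ((f i).1, (f i).2)))
          else 0)]
      refine Fintype.sum_equiv (Fin.consEquiv fun _ => Fin L × Fin 3) _ _ ?_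
      rintro ⟨a, f⟩
      simp [Fin.consEquiv, Fin.sum_univ_succ, Fin.prod_univ_succ, wd_cons]
    · intro m hm
      refine Finset.sum_eq_zero fun c _ => Finset.sum_eq_zero fun f _ => if_neg ?_
      omega

end VRep

lemma degM_nonneg {σ : Multiset ℤ} (h : Neg σ) : (σ.card : ℤ) ≤ degM σ := by
  induction σ using Multiset.induction_on with
  | empty => simp [degM]
  | cons a s ih =>
    have h1 := h a (Multiset.mem_cons_self a s)
    have h2 := ih fun p hp => h p (Multiset.mem_cons_of_mem hp)
    rw [← Multiset.singleton_add, degM_add, Multiset.card_add]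
    simp only [degM, Multiset.map_singleton, Multiset.sum_singleton,
      Multiset.card_singleton] at *
    push_cast
    omega

lemma colM_nonneg (σ : Multiset ℤ) : 0 ≤ colM σ := by
  induction σ using Multiset.induction_on with
  | empty => simp [colM]
  | cons a s ih =>
    rw [← Multiset.singleton_add, colM_add]
    simp only [colM, Multiset.map_singleton, Multiset.sum_singleton] at *
    omega

lemma le_degM {σ : Multiset ℤ} (h : Neg σ) {p : ℤ} (hp : p ∈ σ) : p / 3 ≤ degM σ := by
  obtain ⟨s, rfl⟩ := Multiset.exists_cons_of_mem hp
  have h2 : Neg s := fun p hp => h p (Multiset.mem_cons_of_mem hp)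
  have := degM_nonneg h2
  rw [← Multiset.singleton_add, degM_add]
  simp only [degM, Multiset.map_singleton, Multiset.sum_singleton] at *
  omega

/-- coefficient of a letter in the current -/
def epsZ (p : ℤ) : ℝ := if p % 3 = 0 then 1 else -1

lemma epsZ_lett (D : ℕ) (m : ℕ) (c : Fin 3) : epsZ (lett D (m, c)) = eps c := by
  fin_cases c <;> simp [epsZ, lett, eps]

lemma lett_div (D : ℕ) (m : ℕ) (c : Fin 3) : lett D (m, c) / 3 = m - D := by
  have := c.2
  simp only [lett]
  omega

lemma lett_mod (D : ℕ) (m : ℕ) (c : Fin 3) : lett D (m, c) % 3 = (c : ℕ) := by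
  have := c.2
  simp only [lett]
  omega

namespace VRep

variable {κ : ℝ} {V : Type*} [AddCommGroup V] [Module ℝ V] (R : VRep κ V)

lemma functional_eq_zero {k : ℕ} (hF : R.FieldRel k) {τ : Multiset ℤ} (hn : Neg τ)
    (ha : ¬ Adm k τ) (φ : V →ₗ[ℝ] ℝ) (h1 : ∀ x ∈ R.Fil τ.card (degM τ), φ x = 0)
    (h2 : ∀ σ, Neg σ → σ.card = τ.card → degM σ = degM τ → omM τ < omM σ → φ (R.mon σ) = 0) :
    φ (R.mon τ) = 0 := by
  obtain ⟨lm, hle, hcard, hext⟩ := exists_extremal hn ha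
  obtain ⟨ρ, rfl⟩ := Multiset.le_iff_exists_add.1 hle
  have hnl : Neg lm := fun p hp => hn p (Multiset.mem_add.2 (Or.inl hp))
  have hnr : Neg ρ := fun p hp => hn p (Multiset.mem_add.2 (Or.inr hp))
  obtain ⟨D, hD⟩ := hF (R.mon ρ)
  replace hD := hD D le_rfl
  obtain ⟨N, hN⟩ : ∃ N : ℕ, (N : ℤ) = degM lm :=
    ⟨(degM lm).toNat, Int.toNat_of_nonneg ((by positivity : (0 : ℤ) ≤ _).trans (degM_nonneg hnl))⟩
  obtain ⟨s, hs⟩ : ∃ s : ℕ, (s : ℤ) = colM lm :=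
    ⟨(colM lm).toNat, Int.toNat_of_nonneg (colM_nonneg lm)⟩
  obtain ⟨M, hM⟩ : ∃ M, M = (k + 1) * D + N := ⟨_, rfl⟩
  let word : (Fin (k + 1) → Fin (M + 1) × Fin 3) → List ℤ := fun f =>
    List.ofFn fun i => lett D ((f i).1, (f i).2)
  have wcard : ∀ f, ((word f : Multiset ℤ)).card = k + 1 := fun f => by simp [word]
  have wdeg : ∀ f, degM (word f) = ∑ i, (((f i).1 : ℕ) : ℤ) - (k + 1) * D := fun f => by
    rw [degM_coe, degL]
    simp only [word, List.map_ofFn, List.sum_ofFn, Function.comp_def]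
    rw [Finset.sum_congr rfl fun i _ => lett_div D (f i).1 (f i).2, Finset.sum_sub_distrib]
    simp
  have wcol : ∀ f, colM (word f) = ∑ i, (((f i).2 : ℕ) : ℤ) := fun f => by
    rw [colM]
    simp only [word, Multiset.map_coe, Multiset.sum_coe, List.map_ofFn, List.sum_ofFn]
    exact Finset.sum_congr rfl fun i _ => lett_mod D (f i).1 (f i).2
  have weps : ∀ f, ∏ i, eps (f i).2 = ((word f : Multiset ℤ).map epsZ).prod := fun f => by
    simp only [word, Multiset.map_coe, Multiset.prod_coe, List.map_ofFn, List.prod_ofFn]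
    exact Finset.prod_congr rfl fun i _ => (epsZ_lett D (f i).1 (f i).2).symm
  have wdeg' : ∀ f, ∑ i, ((f i).1 : ℕ) = M → degM (word f) = degM lm := fun f hf => by
    have : ∑ i, (((f i).1 : ℕ) : ℤ) = M := by exact_mod_cast hf
    rw [wdeg, this, hM, ← hN]
    push_cast
    ring
  have hphi : ∀ f, ∑ i, ((f i).1 : ℕ) = M →
      φ (R.wd (word f) (R.mon ρ)) = φ (R.mon (word f + ρ)) := fun f hf => by
    have := R.mon_add (word f) ρ (word f) rfl
    rw [← sub_eq_zero, ← map_sub]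
    refine h1 _ ?_
    convert this using 2
    · simp only [Multiset.card_add, wcard, hcard]
    · simp only [degM_add, wdeg' f hf]
  have hzero : ∀ f, ∑ i, ((f i).1 : ℕ) = M → ∑ i, ((f i).2 : ℕ) = s →
      (word f : Multiset ℤ) ≠ lm → φ (R.wd (word f) (R.mon ρ)) = 0 := fun f hf hfs hne => by
    rw [hphi f hf]
    by_cases hneg : Neg (word f + ρ)
    · refine h2 _ hneg ?_ ?_ ?_
      · simp only [Multiset.card_add, wcard, hcard]
      · simp only [degM_add, wdeg' f hf]
      · have := hext (word f) (by rw [wcard, hcard]) (wdeg' f hf) (by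
          rw [wcol, ← hs, ← hfs]; push_cast; rfl)
        rw [omM_add, omM_add]
        rcases this with h | h
        · exact absurd h hne
        · linarith
    · refine h1 _ ?_
      simp only [Neg, not_forall, not_le] at hneg
      obtain ⟨p, hp, hp3⟩ := hneg
      have := R.nonneg_mem (u := (word f + ρ : Multiset ℤ).sort (· ≥ ·)) (p := p) (by simpa using hp) hp3
      rw [← degM_coe, Multiset.sort_eq] at this
      have e1 : ((word f + ρ : Multiset ℤ).sort (· ≥ ·)).length = (lm + ρ).card := by
        rw [Multiset.length_sort, Multiset.card_add, wcard, Multiset.card_add, hcard]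
      have e2 : degM (word f + ρ) = degM (lm + ρ) := by rw [degM_add, degM_add, wdeg' f hf]
      rw [e1, e2] at this
      exact this
  let P : Polynomial ℝ := ∑ f : Fin (k + 1) → Fin (M + 1) × Fin 3,
    if ∑ i, ((f i).1 : ℕ) = M then Polynomial.monomial (∑ i, ((f i).2 : ℕ))
      ((∏ i, eps (f i).2) * φ (R.wd (word f) (R.mon ρ))) else 0
  have hP : P = 0 := by
    apply Polynomial.funext
    intro t
    have := congrArg φ (hD t M)
    rw [R.coeff_G_pow t D (M + 1) (k + 1) M (by omega)] at this
    rw [Polynomial.eval_zero, ← map_zero φ, ← this, Polynomial.eval_finsetSum,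
      LinearMap.sum_apply, map_sum]
    refine Finset.sum_congr rfl fun f _ => ?_
    split_ifs
    · rw [Polynomial.eval_monomial, LinearMap.smul_apply, map_smul, Finset.prod_mul_distrib,
        Finset.prod_pow_eq_pow_sum, smul_eq_mul]
      ring
    · simp
  have hc := congrArg (fun Q : Polynomial ℝ => Q.coeff s) hP
  simp only [P, Polynomial.finsetSum_coeff, Polynomial.coeff_zero] at hc
  have hc' : ∑ f : Fin (k + 1) → Fin (M + 1) × Fin 3,
      (if (word f : Multiset ℤ) = lm then (lm.map epsZ).prod * φ (R.mon (lm + ρ)) else 0) = 0 := by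
    refine Eq.trans (Finset.sum_congr rfl fun f _ => ?_) hc
    by_cases hw : (word f : Multiset ℤ) = lm
    · have hf : ∑ i, ((f i).1 : ℕ) = M := by
        have := wdeg f
        rw [hw, ← hN] at this
        have hM' : (M : ℤ) = (k + 1) * D + N := by exact_mod_cast hM
        have h' : ((∑ i, ((f i).1 : ℕ) : ℕ) : ℤ) = M := by
          push_cast; linarith
        exact_mod_cast h'
      have hfs : ∑ i, ((f i).2 : ℕ) = s := by
        have := wcol f
        rw [hw, ← hs] at this
        exact_mod_cast this.symm
      rw [if_pos hw, if_pos hf, hfs, Polynomial.coeff_monomial, if_pos rfl, hphi f hf, weps, hw]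
    · rw [if_neg hw]
      split_ifs with hf
      · rw [Polynomial.coeff_monomial]
        split_ifs with hfs
        · rw [hzero f hf hfs hw, mul_zero]
        · rfl
      · simp
  rw [← Finset.sum_filter, Finset.sum_const, nsmul_eq_mul] at hc'
  have he : (lm.map epsZ).prod ≠ 0 := by
    refine Multiset.prod_ne_zero ?_
    simp only [Multiset.mem_map, not_exists, not_and]
    intro p _
    unfold epsZ
    split_ifs <;> norm_num
  have hne : (Finset.univ.filter fun f => (word f : Multiset ℤ) = lm).Nonempty := by
    have hl : lm.toList.length = k + 1 := by simpa using hcard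
    have hget : ∀ i : Fin (k + 1), lm.toList.get (i.cast hl.symm) ∈ lm := fun i =>
      Multiset.mem_toList.1 (List.get_mem _ _)
    refine ⟨fun i => (⟨(lm.toList.get (i.cast hl.symm) / 3 + D).toNat, ?_⟩,
      ⟨(lm.toList.get (i.cast hl.symm) % 3).toNat, by omega⟩), ?_⟩
    · have := le_degM hnl (hget i)
      have h3 := hnl _ (hget i)
      have hM' : D + N ≤ M := by rw [hM]; nlinarith
      omega
    · rw [Finset.mem_filter]
      refine ⟨Finset.mem_univ _, ?_⟩
      conv_rhs => rw [← Multiset.coe_toList lm]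
      congr 1
      apply List.ext_get
      · simp [word, hcard]
      · intro n h1 h2
        simp only [word, List.get_ofFn, lett]
        have h3 := hnl _ (hget ((⟨n, h1⟩ : Fin _).cast (by simp [word])))
        simp only [Fin.cast_mk, List.get_eq_getElem] at h3 ⊢
        simp only [Fin.val_cast]
        omega
  have hcz : ((Finset.univ.filter fun f => (word f : Multiset ℤ) = lm).card : ℝ) ≠ 0 := by
    exact_mod_cast hne.card_pos.ne'
  rcases mul_eq_zero.1 hc' with h | h
  · exact absurd h hcz
  · exact (mul_eq_zero.1 h).resolve_left he

lemma omM_le {σ : Multiset ℤ} (h : Neg σ) : omM σ ≤ 13 * degM σ ^ 2 := by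
  induction σ using Multiset.induction_on with
  | empty => simp [degM, omM]
  | cons a s ih =>
    have h1 := h a (Multiset.mem_cons_self a s)
    have hs : Neg s := fun p hp => h p (Multiset.mem_cons_of_mem hp)
    have h2 := ih hs
    have h3 := degM_nonneg hs
    rw [← Multiset.singleton_add, degM_add, omM_add]
    simp only [degM, omM, Multiset.map_singleton, Multiset.sum_singleton] at *
    have h4 : om a ≤ 13 * (a / 3) ^ 2 := by
      have h5 : 1 ≤ a / 3 := by omega
      have h6 : a % 3 ≤ 2 := by omega
      have h7 : 0 ≤ a % 3 := by omega
      unfold om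
      nlinarith
    have h5 : 0 ≤ a / 3 := by omega
    have h6 := mul_nonneg h5 (le_trans (by positivity) h3)
    nlinarith

/-- Monomials expand in admissible ones which they strictly follow. -/
theorem mon_mem_span {k : ℕ} (hF : R.FieldRel k) (τ : Multiset ℤ) (hn : Neg τ) :
    R.mon τ ∈ Submodule.span ℝ {x | ∃ σ, Adm k σ ∧ degM σ = degM τ ∧ (σ = τ ∨ Prec σ τ) ∧
      x = R.mon σ} := by
  induction hcd : τ.card using Nat.strong_induction_on generalizing τ with
  | _ n ihn =>
  induction hod : (13 * degM τ ^ 2 - omM τ).toNat using Nat.strong_induction_on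
    generalizing τ with
  | _ m ihm =>
  by_cases ha : Adm k τ
  · exact Submodule.subset_span ⟨τ, ha, rfl, Or.inl rfl, rfl⟩
  by_contra hno
  obtain ⟨φ, hφ, hk⟩ := Submodule.exists_le_ker_of_notMem hno
  apply hφ
  refine R.functional_eq_zero hF hn ha φ ?_ ?_
  · intro x hx
    have hx' := R.Fil_le_span _ _ hx
    have : Submodule.span ℝ {x | ∃ σ, Neg σ ∧ σ.card < τ.card ∧ degM σ = degM τ ∧ x = R.mon σ} ≤
        LinearMap.ker φ := by
      apply Submodule.span_le.2
      rintro x ⟨σ, hs, hc, hd, rfl⟩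
      refine hk (Submodule.span_mono ?_ (ihn σ.card (by omega) σ hs rfl))
      rintro x ⟨σ', h1, h2, h3, rfl⟩
      refine ⟨σ', h1, h2.trans hd, Or.inr (Or.inl ?_), rfl⟩
      rcases h3 with rfl | h3 | h3 <;> omega
    exact this hx'
  · intro σ hs hc hd ho
    have hb := omM_le hs
    refine hk (Submodule.span_mono ?_ (ihm (13 * degM σ ^ 2 - omM σ).toNat (by
      rw [hd] at hb ⊢; omega) σ hs (hc.trans hcd) rfl))
    rintro x ⟨σ', h1, h2, h3, rfl⟩
    refine ⟨σ', h1, h2.trans hd, Or.inr ?_, rfl⟩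
    rcases h3 with rfl | h3 | h3
    · exact Or.inr ⟨hc, ho⟩
    · exact Or.inl (by omega)
    · exact Or.inr ⟨by omega, by omega⟩

end VRep

/-- One step of the greedy choice of a level one part of a colored partition:
`s` is the choice in the preceding block, `a b c` are the multiplicities in the current block
and `a'` is the next multiplicity of `e`. -/
def greedyStep (K : ℕ) (s : ℕ × ℕ × ℕ) (a b c a' : ℕ) : ℕ × ℕ × ℕ :=
  if s.2.2 ≠ 0 then (0, 0, 0)
  else if s.1 = 0 ∧ s.2.1 = 0 then
    (if 0 < a then (1, 0, if 0 < c then 1 else 0)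
    else if 0 < b then (0, 1, 0)
    else if 0 < c then (0, 0, 1)
    else (0, 0, 0))
  else if 0 < b then (0, 1, 0)
  else if 0 < c ∧ a + a' < K then (0, 0, 1)
  else (0, 0, 0)

/-- The greedy choice of a level one part. -/
def greedy (K : ℕ) (a b c : ℕ → ℕ) : ℕ → ℕ × ℕ × ℕ
  | 0 => (0, 0, 0)
  | j + 1 => greedyStep K (greedy K a b c j) (a (j + 1)) (b (j + 1)) (c (j + 1)) (a (j + 2))

lemma greedyStep_spec (K : ℕ) (α β γ a b c a' : ℕ) : ∃ α' β' γ',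
    greedyStep K (α, β, γ) a b c a' = (α', β', γ') ∧
    ((γ ≠ 0 ∧ α' = 0 ∧ β' = 0 ∧ γ' = 0) ∨
     (γ = 0 ∧ α = 0 ∧ β = 0 ∧ 0 < a ∧ 0 < c ∧ α' = 1 ∧ β' = 0 ∧ γ' = 1) ∨
     (γ = 0 ∧ α = 0 ∧ β = 0 ∧ 0 < a ∧ c = 0 ∧ α' = 1 ∧ β' = 0 ∧ γ' = 0) ∨
     (γ = 0 ∧ α = 0 ∧ β = 0 ∧ a = 0 ∧ 0 < b ∧ α' = 0 ∧ β' = 1 ∧ γ' = 0) ∨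
     (γ = 0 ∧ α = 0 ∧ β = 0 ∧ a = 0 ∧ b = 0 ∧ 0 < c ∧ α' = 0 ∧ β' = 0 ∧ γ' = 1) ∨
     (γ = 0 ∧ α = 0 ∧ β = 0 ∧ a = 0 ∧ b = 0 ∧ c = 0 ∧ α' = 0 ∧ β' = 0 ∧ γ' = 0) ∨
     (γ = 0 ∧ 0 < α + β ∧ 0 < b ∧ α' = 0 ∧ β' = 1 ∧ γ' = 0) ∨
     (γ = 0 ∧ 0 < α + β ∧ b = 0 ∧ 0 < c ∧ a + a' < K ∧ α' = 0 ∧ β' = 0 ∧ γ' = 1) ∨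
     (γ = 0 ∧ 0 < α + β ∧ b = 0 ∧ (c = 0 ∨ K ≤ a + a') ∧ α' = 0 ∧ β' = 0 ∧ γ' = 0)) := by
  obtain ⟨⟨x, y, z⟩, hs⟩ : ∃ s, greedyStep K (α, β, γ) a b c a' = s := ⟨_, rfl⟩
  refine ⟨x, y, z, hs, ?_⟩
  simp only [greedyStep] at hs
  split_ifs at hs <;> simp only [Prod.mk.injEq] at hs <;>
    obtain ⟨rfl, rfl, rfl⟩ := hs <;> simp_all <;> omega

lemma greedy_spec (K : ℕ) (hK : 0 < K) (a b c : ℕ → ℕ) (ha : a 0 = 0) (hb : b 0 = 0)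
    (hc : c 0 = 0)
    (h : ∀ j, a j + b j + a (j + 1) ≤ K ∧ b j + c j + a (j + 1) ≤ K ∧
      c j + a (j + 1) + b (j + 1) ≤ K ∧ c j + b (j + 1) + c (j + 1) ≤ K) (j : ℕ) :
    ∀ α β γ, greedy K a b c j = (α, β, γ) →
    (α ≤ a j ∧ β ≤ b j ∧ γ ≤ c j ∧ α + β ≤ 1 ∧ β + γ ≤ 1 ∧ α ≤ 1 ∧ γ ≤ 1) ∧
    ((α = 0 ∧ β = 0 ∧ γ = 0 ∧ c j < K ∧ (a (j + 1) = 0 → a j + b j + a (j + 1) < K ∧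
        b j + c j + a (j + 1) < K)) ∨
      (γ = 0 ∧ 0 < α + β ∧ ((0 < a j ∧ c j = 0) ∨ 0 < b j)) ∨
      (γ = 1)) ∧
    (α = 0 → β = 0 → γ ≠ 0 → a j + b j + a (j + 1) < K) ∧
    (β = 0 → γ = 0 → 0 < α → b j + c j + a (j + 1) < K) := by
  induction j with
  | zero =>
    rintro α β γ hg
    simp only [greedy, Prod.mk.injEq] at hg
    obtain ⟨rfl, rfl, rfl⟩ := hg
    have := h 0
    refine ⟨by omega, Or.inl ⟨rfl, rfl, rfl, by omega, by omega⟩, by omega, by omega⟩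
  | succ j ih =>
    rintro α' β' γ' hg
    obtain ⟨⟨α, β, γ⟩, hs⟩ : ∃ s, greedy K a b c j = s := ⟨_, rfl⟩
    have ih := ih α β γ hs
    rw [greedy, hs] at hg
    obtain ⟨x, y, z, e, hx⟩ :=
      greedyStep_spec K α β γ (a (j + 1)) (b (j + 1)) (c (j + 1)) (a (j + 2))
    rw [e] at hg
    simp only [Prod.mk.injEq] at hg
    obtain ⟨rfl, rfl, rfl⟩ := hg
    have h1 := h j
    have h2 := h (j + 1)
    clear h hs e ha hb hc
    rw [show j + 1 + 1 = j + 2 from rfl] at *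
    generalize a j = a0, b j = b0, c j = c0, a (j + 1) = a1, b (j + 1) = b1, c (j + 1) = c1,
      a (j + 2) = a2, b (j + 2) = b2, c (j + 2) = c2 at *
    obtain ⟨h3, h4, h5, h6⟩ := ih
    rcases h4 with h4 | h4 | h4 <;>
    rcases hx with hx | hx | hx | hx | hx | hx | hx | hx | hx <;>
      refine ⟨?_, ?_, ?_, ?_⟩ <;> omega

lemma greedy_cliques (K : ℕ) (hK : 0 < K) (a b c : ℕ → ℕ) (ha : a 0 = 0) (hb : b 0 = 0)
    (hc : c 0 = 0)
    (h : ∀ j, a j + b j + a (j + 1) ≤ K ∧ b j + c j + a (j + 1) ≤ K ∧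
      c j + a (j + 1) + b (j + 1) ≤ K ∧ c j + b (j + 1) + c (j + 1) ≤ K) (j : ℕ)
    (α β γ α' β' γ' : ℕ) (e : greedy K a b c j = (α, β, γ))
    (e' : greedy K a b c (j + 1) = (α', β', γ')) :
    (α + β + α' ≤ 1 ∧ β + γ + α' ≤ 1 ∧ γ + α' + β' ≤ 1 ∧ γ + β' + γ' ≤ 1) ∧
    (a j + b j + a (j + 1) < K + (α + β + α') ∧ b j + c j + a (j + 1) < K + (β + γ + α') ∧
      c j + a (j + 1) + b (j + 1) < K + (γ + α' + β') ∧
      c j + b (j + 1) + c (j + 1) < K + (γ + β' + γ')) := by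
  obtain ⟨h3, h4, h5, h6⟩ := greedy_spec K hK a b c ha hb hc h j α β γ e
  rw [greedy, e] at e'
  obtain ⟨x, y, z, e2, hx⟩ :=
      greedyStep_spec K α β γ (a (j + 1)) (b (j + 1)) (c (j + 1)) (a (j + 2))
  rw [e2] at e'
  simp only [Prod.mk.injEq] at e'
  obtain ⟨rfl, rfl, rfl⟩ := e'
  have h1 := h j
  have h2 := h (j + 1)
  clear h e e2 ha hb hc
  rw [show j + 1 + 1 = j + 2 from rfl] at *
  generalize a j = a0, b j = b0, c j = c0, a (j + 1) = a1, b (j + 1) = b1, c (j + 1) = c1,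
      a (j + 2) = a2, b (j + 2) = b2, c (j + 2) = c2 at *
  rcases h4 with h4 | h4 | h4 <;>
    rcases hx with hx | hx | hx | hx | hx | hx | hx | hx | hx <;>
      refine ⟨?_, ?_⟩ <;> omega

lemma adm_decompose {k : ℕ} {π : Multiset ℤ} (h : Adm (k + 1) π) :
    ∃ σ π', π = σ + π' ∧ Adm 1 σ ∧ Adm k π' := by
  obtain ⟨hn, hj⟩ := h
  have hz : ∀ p : ℤ, p < 3 → π.count p = 0 := fun p hp =>
    Multiset.count_eq_zero_of_notMem fun hm => by have := hn p hm; omega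
  let a : ℕ → ℕ := fun j => π.count (3 * (j : ℤ))
  let b : ℕ → ℕ := fun j => π.count (3 * (j : ℤ) + 1)
  let c : ℕ → ℕ := fun j => π.count (3 * (j : ℤ) + 2)
  obtain ⟨gr, hgr⟩ : ∃ gr, greedy (k + 1) a b c = gr := ⟨_, rfl⟩
  have hcl : ∀ j, a j + b j + a (j + 1) ≤ k + 1 ∧ b j + c j + a (j + 1) ≤ k + 1 ∧
      c j + a (j + 1) + b (j + 1) ≤ k + 1 ∧ c j + b (j + 1) + c (j + 1) ≤ k + 1 := by
    intro j
    have := hj j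
    simp only [a, b, c]
    push_cast
    rw [show 3 * ((j : ℤ) + 1) = 3 * j + 3 by ring, show 3 * (j : ℤ) + 3 + 1 = 3 * j + 4 by ring,
      show 3 * (j : ℤ) + 3 + 2 = 3 * j + 5 by ring]
    exact this
  have ha : a 0 = 0 := hz _ (by norm_num)
  have hb : b 0 = 0 := hz _ (by norm_num)
  have hc : c 0 = 0 := hz _ (by norm_num)
  let ind : ℤ → ℕ := fun p => if p % 3 = 0 then (gr (p / 3).toNat).1 else
    if p % 3 = 1 then (gr (p / 3).toNat).2.1 else (gr (p / 3).toNat).2.2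
  have hi0 : ∀ j : ℕ, ind (3 * j) = (gr j).1 := fun j => by
    have e1 : (3 * (j : ℤ)) % 3 = 0 := by omega
    have e2 : (3 * (j : ℤ)) / 3 = j := by omega
    simp [ind, e2]
  have hi1 : ∀ j : ℕ, ind (3 * j + 1) = (gr j).2.1 := fun j => by
    have e1 : (3 * (j : ℤ) + 1) % 3 = 1 := by omega
    have e2 : (3 * (j : ℤ) + 1) / 3 = j := by omega
    simp [ind, e1, e2]
  have hi2 : ∀ j : ℕ, ind (3 * j + 2) = (gr j).2.2 := fun j => by
    have e1 : (3 * (j : ℤ) + 2) % 3 = 2 := by omega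
    have e2 : (3 * (j : ℤ) + 2) / 3 = j := by omega
    simp [ind, e1, e2]
  have hspec : ∀ j : ℕ, (gr j).1 ≤ a j ∧ (gr j).2.1 ≤ b j ∧ (gr j).2.2 ≤ c j ∧
      (gr j).1 ≤ 1 ∧ (gr j).2.1 ≤ 1 ∧ (gr j).2.2 ≤ 1 := fun j => by
    have := (greedy_spec (k + 1) (by omega) a b c ha hb hc hcl j (gr j).1 (gr j).2.1
      (gr j).2.2 (by rw [hgr])).1
    omega
  let σ : Multiset ℤ := π.dedup.filter fun p => ind p = 1
  have hσle : σ ≤ π := (Multiset.filter_le _ _).trans (Multiset.dedup_le π)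
  have hcount : ∀ p : ℤ, 0 ≤ p → σ.count p = ind p := by
    intro p hp
    have hle : ind p ≤ π.count p ∧ ind p ≤ 1 := by
      obtain ⟨j, hj | hj | hj⟩ : ∃ j : ℕ, p = 3 * j ∨ p = 3 * j + 1 ∨ p = 3 * j + 2 :=
        ⟨(p / 3).toNat, by omega⟩
      · rw [hj, hi0]; exact ⟨(hspec j).1, (hspec j).2.2.2.1⟩
      · rw [hj, hi1]; exact ⟨(hspec j).2.1, (hspec j).2.2.2.2.1⟩
      · rw [hj, hi2]; exact ⟨(hspec j).2.2.1, (hspec j).2.2.2.2.2⟩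
    simp only [σ, Multiset.count_filter]
    split_ifs with h1
    · rw [h1]
      rw [Multiset.count_eq_one_of_mem (Multiset.nodup_dedup π)]
      rw [Multiset.mem_dedup, ← Multiset.count_pos]
      omega
    · omega
  have hneg : ∀ τ ≤ π, Neg τ := fun τ hτ p hp => hn p (Multiset.mem_of_le hτ hp)
  have hsub : π - σ ≤ π := Multiset.sub_le_self π σ
  have hz' : ∀ τ ≤ π, ∀ p < 3, τ.count p = 0 := fun τ hτ p hp =>
    Nat.le_zero.1 ((Multiset.count_le_of_le p hτ).trans (hz p hp).le)
  have main : ∀ j : ℕ, _ := fun j => greedy_cliques (k + 1) (by omega) a b c ha hb hc hcl j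
    (gr j).1 (gr j).2.1 (gr j).2.2 (gr (j + 1)).1 (gr (j + 1)).2.1 (gr (j + 1)).2.2
    (by rw [hgr]) (by rw [hgr])
  have hcσ : ∀ j : ℕ, σ.count (3 * (j : ℤ)) = (gr j).1 ∧ σ.count (3 * (j : ℤ) + 1) = (gr j).2.1 ∧
      σ.count (3 * (j : ℤ) + 2) = (gr j).2.2 ∧ σ.count (3 * (j : ℤ) + 3) = (gr (j + 1)).1 ∧
      σ.count (3 * (j : ℤ) + 4) = (gr (j + 1)).2.1 ∧
      σ.count (3 * (j : ℤ) + 5) = (gr (j + 1)).2.2 := fun j => by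
    refine ⟨?_, ?_, ?_, ?_, ?_, ?_⟩
    · rw [hcount _ (by omega), hi0]
    · rw [hcount _ (by omega), hi1]
    · rw [hcount _ (by omega), hi2]
    · rw [hcount _ (by omega), ← hi0]; congr 1
    · rw [hcount _ (by omega), ← hi1]; congr 1
    · rw [hcount _ (by omega), ← hi2]; congr 1
  have hcπ : ∀ j : ℕ, π.count (3 * (j : ℤ)) = a j ∧ π.count (3 * (j : ℤ) + 1) = b j ∧
      π.count (3 * (j : ℤ) + 2) = c j ∧ π.count (3 * (j : ℤ) + 3) = a (j + 1) ∧
      π.count (3 * (j : ℤ) + 4) = b (j + 1) ∧ π.count (3 * (j : ℤ) + 5) = c (j + 1) := fun j => by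
    refine ⟨rfl, rfl, rfl, ?_, ?_, ?_⟩
    · simp only [a]; congr 1
    · simp only [b]; congr 1
    · simp only [c]; congr 1
  refine ⟨σ, π - σ, (add_tsub_cancel_of_le hσle).symm, ⟨hneg σ hσle, fun j => ?_⟩,
    ⟨hneg _ hsub, fun j => ?_⟩⟩
  · rcases lt_or_ge j 0 with h0 | h0
    · refine ⟨?_, ?_, ?_, ?_⟩ <;>
        (rw [hz' σ hσle _ (by omega), hz' σ hσle _ (by omega), hz' σ hσle _ (by omega)]; exact Nat.zero_le _)
    · obtain ⟨n, rfl⟩ := Int.eq_ofNat_of_zero_le h0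
      obtain ⟨e1, e2, e3, e4, e5, e6⟩ := hcσ n
      rw [e1, e2, e3, e4, e5, e6]
      exact (main n).1
  · rcases lt_or_ge j 0 with h0 | h0
    · refine ⟨?_, ?_, ?_, ?_⟩ <;>
        rw [hz' _ hsub _ (by omega), hz' _ hsub _ (by omega), hz' _ hsub _ (by omega)] <;> omega
    · obtain ⟨n, rfl⟩ := Int.eq_ofNat_of_zero_le h0
      obtain ⟨e1, e2, e3, e4, e5, e6⟩ := hcσ n
      obtain ⟨f1, f2, f3, f4, f5, f6⟩ := hcπ n
      simp only [Multiset.count_sub]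
      rw [e1, e2, e3, e4, e5, e6, f1, f2, f3, f4, f5, f6]
      have h1 := (main n).2
      have h2 := hspec n
      have h3 := hspec (n + 1)
      omega


/-- The space of creation modes of four families of fermions. -/
abbrev FW : Type := (Fin 4 × ℕ) →₀ ℝ

/-- The fermionic Fock space. -/
abbrev Fk : Type := ExteriorAlgebra ℝ FW

/-- creation mode -/
noncomputable def cr (i : Fin 4 × ℕ) : Fk := ExteriorAlgebra.ι ℝ (Finsupp.single i 1)

/-- annihilation mode -/
noncomputable def an (i : Fin 4 × ℕ) : Module.End ℝ Fk :=
  CliffordAlgebra.contractLeft (Q := (0 : QuadraticForm ℝ FW)) (Finsupp.lapply i)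

/-- vacuum expectation -/
noncomputable def vev : Fk →ₗ[ℝ] ℝ := (ExteriorAlgebra.algebraMapInv (R := ℝ)).toLinearMap

lemma an_ι (i : Fin 4 × ℕ) (w : FW) (x : Fk) :
    an i (ExteriorAlgebra.ι ℝ w * x) = w i • x - ExteriorAlgebra.ι ℝ w * an i x :=
  CliffordAlgebra.contractLeft_ι_mul (Q := (0 : QuadraticForm ℝ FW)) _ _ _

lemma an_cr (i j : Fin 4 × ℕ) (x : Fk) :
    an i (cr j * x) = (if i = j then x else 0) - cr j * an i x := by
  rw [cr, an_ι, Finsupp.single_apply]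
  simp only [eq_comm]
  split_ifs <;> simp

lemma an_one (i : Fin 4 × ℕ) : an i 1 = 0 :=
  CliffordAlgebra.contractLeft_one (Q := (0 : QuadraticForm ℝ FW)) _

lemma an_an (i j : Fin 4 × ℕ) (x : Fk) : an i (an j x) + an j (an i x) = 0 := by
  unfold an
  rw [CliffordAlgebra.contractLeft_comm, neg_add_cancel]

lemma cr_cr (i j : Fin 4 × ℕ) : cr i * cr j + cr j * cr i = 0 := ExteriorAlgebra.ι_add_mul_swap _ _

lemma vev_one : vev 1 = 1 := by simp [vev]

lemma vev_ι (w : FW) (x : Fk) : vev (ExteriorAlgebra.ι ℝ w * x) = 0 := by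
  simp [vev, ExteriorAlgebra.algebraMapInv]

lemma fock_induction {P : Fk → Prop} (h1 : P 1) (hs : ∀ (r : ℝ) x, P x → P (r • x))
    (ha : ∀ x y, P x → P y → P (x + y)) (hc : ∀ i x, P x → P (cr i * x)) (x : Fk) : P x := by
  induction x using CliffordAlgebra.left_induction with
  | algebraMap r => rw [Algebra.algebraMap_eq_smul_one]; exact hs r 1 h1
  | add x y hx hy => exact ha x y hx hy
  | ι_mul x m hx =>
    induction m using Finsupp.induction_linear with
    | zero => rw [map_zero, zero_mul]; simpa using hs 0 1 h1
    | add f g hf hg => rw [map_add, add_mul]; exact ha _ _ hf hg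
    | single i r =>
      have : Finsupp.single i r = r • Finsupp.single i (1 : ℝ) := by simp
      rw [this, map_smul, smul_mul_assoc]
      exact hs _ _ (hc i x hx)

lemma fock_hom_ext {A : Type*} [Semiring A] [Algebra ℝ A] {f g : Fk →ₐ[ℝ] A}
    (h : ∀ i, f (cr i) = g (cr i)) : f = g := by
  apply ExteriorAlgebra.hom_ext
  ext i
  simpa [cr] using h i

/-- projection killing the modes in `J` -/
noncomputable def killMap (J : Finset (Fin 4 × ℕ)) : Fk →ₐ[ℝ] Fk :=
  ExteriorAlgebra.map (Finsupp.lsum ℝ fun i => if i ∈ J then 0 else Finsupp.lsingle i)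

lemma killMap_cr (J : Finset (Fin 4 × ℕ)) (i : Fin 4 × ℕ) :
    killMap J (cr i) = if i ∈ J then 0 else cr i := by
  simp only [killMap, cr, ExteriorAlgebra.map_apply_ι]
  split_ifs with h <;> simp [h]

lemma killMap_singleton (i : Fin 4 × ℕ) (x : Fk) : killMap {i} x = x - cr i * an i x := by
  induction x using fock_induction with
  | h1 => simp [an_one]
  | hs r x hx => simp [hx, smul_sub]
  | ha x y hx hy => simp only [map_add, hx, hy, mul_add]; abel
  | hc j x hx =>
    rw [map_mul, hx, killMap_cr, an_cr, mul_sub, mul_sub, ← mul_assoc (cr i) (cr j)]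
    have e := cr_cr i j
    simp only [Finset.mem_singleton]
    split_ifs with h h' h'
    · subst h
      have : cr j * cr j = 0 := ExteriorAlgebra.ι_sq_zero _
      simp [this]
    · exact absurd h.symm h'
    · exact absurd h'.symm h
    · rw [eq_neg_of_add_eq_zero_left e]
      simp [mul_assoc]

lemma vac_unique {x : Fk} (h : ∀ i, an i x = 0) : x = vev x • 1 := by
  have h1 : ∀ J, killMap J x = x := by
    intro J
    induction J using Finset.induction_on with
    | empty =>
      have : killMap ∅ = AlgHom.id ℝ Fk := fock_hom_ext fun i => by simp [killMap_cr]
      simp [this]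
    | insert i J hi ih =>
      have : killMap (insert i J) = (killMap J).comp (killMap {i}) := fock_hom_ext fun j => by
        simp only [AlgHom.comp_apply, killMap_cr, Finset.mem_insert, Finset.mem_singleton]
        split_ifs <;> simp_all [killMap_cr]
      rw [this, AlgHom.comp_apply, killMap_singleton, h, mul_zero, sub_zero, ih]
  have h2 : ∀ y : Fk, ∃ J, ∀ J', J ⊆ J' → killMap J' y = vev y • 1 := by
    intro y
    induction y using fock_induction with
    | h1 => exact ⟨∅, fun J _ => by simp [vev_one]⟩
    | hs r x hx =>
      obtain ⟨J, hJ⟩ := hx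
      exact ⟨J, fun J' h => by rw [map_smul, hJ J' h, map_smul, smul_assoc]⟩
    | ha x y hx hy =>
      obtain ⟨J, hJ⟩ := hx
      obtain ⟨J2, hJ2⟩ := hy
      refine ⟨J ∪ J2, fun J' h => ?_⟩
      rw [map_add, hJ J' (Finset.union_subset_left h), hJ2 J' (Finset.union_subset_right h),
        map_add, add_smul]
    | hc i x hx =>
      refine ⟨{i}, fun J' h => ?_⟩
      rw [map_mul, killMap_cr, if_pos (by simpa using h), cr, vev_ι]
      simp
  obtain ⟨J, hJ⟩ := h2 x
  rw [← hJ J subset_rfl, h1]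

/-- fermion mode -/
noncomputable def fm (s : Fin 4) (m : ℤ) : Module.End ℝ Fk :=
  if m < 0 then LinearMap.mulLeft ℝ (cr (s, (-m - 1).toNat)) else an (s + 2, m.toNat)

lemma fm_neg {s : Fin 4} {m : ℤ} (h : m < 0) (x : Fk) :
    fm s m x = cr (s, (-m - 1).toNat) * x := by simp [fm, h]

lemma fm_nonneg {s : Fin 4} {m : ℤ} (h : 0 ≤ m) (x : Fk) :
    fm s m x = an (s + 2, m.toNat) x := by simp [fm, not_lt.2 h]

lemma fm_fm (s t : Fin 4) (m n : ℤ) (x : Fk) : fm s m (fm t n x) + fm t n (fm s m x) =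
    if t = s + 2 ∧ m + n + 1 = 0 then x else 0 := by
  have h4 : ∀ s t : Fin 4, t + 2 = s ↔ t = s + 2 := by decide
  have h5 : ∀ s t : Fin 4, s + 2 = t ↔ t = s + 2 := by decide
  rcases lt_or_ge m 0 with hm | hm <;> rcases lt_or_ge n 0 with hn | hn
  · rw [fm_neg hm, fm_neg hn, fm_neg hm, fm_neg hn, ← mul_assoc, ← mul_assoc, ← add_mul, cr_cr,
      zero_mul, if_neg (by omega)]
  · rw [fm_neg hm, fm_nonneg hn, fm_nonneg hn, fm_neg hm, an_cr]
    simp only [Prod.mk.injEq, h4]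
    have : n.toNat = (-m - 1).toNat ↔ m + n + 1 = 0 := by omega
    simp only [this]
    abel
  · rw [fm_neg hn, fm_nonneg hm, fm_nonneg hm, fm_neg hn, an_cr]
    simp only [Prod.mk.injEq, h5]
    have : m.toNat = (-n - 1).toNat ↔ m + n + 1 = 0 := by omega
    simp only [this]
    abel
  · rw [fm_nonneg hm, fm_nonneg hn, fm_nonneg hm, fm_nonneg hn, an_an, if_neg (by omega)]

lemma fm_one {s : Fin 4} {m : ℤ} (h : 0 ≤ m) : fm s m 1 = 0 := by rw [fm_nonneg h, an_one]

lemma vev_fm {s : Fin 4} {m : ℤ} (h : m < 0) (x : Fk) : vev (fm s m x) = 0 := by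
  rw [fm_neg h, cr, vev_ι]

lemma cr_eq_fm (i : Fin 4 × ℕ) (x : Fk) : cr i * x = fm i.1 (-(i.2 : ℤ) - 1) x := by
  rw [fm_neg (by omega)]
  congr 3
  ext <;> simp

lemma an_eq_fm (i : Fin 4 × ℕ) (x : Fk) : an i x = fm (i.1 + 2) i.2 x := by
  rw [fm_nonneg (by omega)]
  have : ∀ s : Fin 4, s + 2 + 2 = s := by decide
  simp [this]

lemma fock_induction' {P : Fk → Prop} (h1 : P 1) (hs : ∀ (r : ℝ) x, P x → P (r • x))
    (ha : ∀ x y, P x → P y → P (x + y)) (hc : ∀ s m x, m < 0 → P x → P (fm s m x)) (x : Fk) :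
    P x := by
  induction x using fock_induction with
  | h1 => exact h1
  | hs r x hx => exact hs r x hx
  | ha x y hx hy => exact ha x y hx hy
  | hc i x hx => rw [cr_eq_fm]; exact hc _ _ _ (by omega) hx

lemma fm_loc (x : Fk) : ∃ d : ℕ, ∀ s (m : ℤ), d ≤ m → fm s m x = 0 := by
  induction x using fock_induction' with
  | h1 => exact ⟨0, fun s m h => fm_one (by simpa using h)⟩
  | hs r x hx =>
    obtain ⟨d, hd⟩ := hx
    exact ⟨d, fun s m h => by rw [map_smul, hd s m h, smul_zero]⟩
  | ha x y hx hy =>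
    obtain ⟨d, hd⟩ := hx
    obtain ⟨d', hd'⟩ := hy
    exact ⟨max d d', fun s m h => by
      rw [map_add, hd s m (by omega), hd' s m (by omega), add_zero]⟩
  | hc s m x hm hx =>
    obtain ⟨d, hd⟩ := hx
    refine ⟨d + (-m).toNat, fun t n h => ?_⟩
    have := fm_fm t s n m x
    rw [if_neg (by omega), hd t n (by omega), map_zero, add_zero] at this
    exact this

/-- one term of a normally ordered quadratic current -/
noncomputable def qt (s t : Fin 4) (n m : ℤ) : Module.End ℝ Fk :=
  if m < 0 then fm s m * fm t (n - 1 - m) else -(fm t (n - 1 - m) * fm s m)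

lemma qt_neg {s t : Fin 4} {n m : ℤ} (h : m < 0) (x : Fk) :
    qt s t n m x = fm s m (fm t (n - 1 - m) x) := by simp [qt, h]

lemma qt_nonneg {s t : Fin 4} {n m : ℤ} (h : 0 ≤ m) (x : Fk) :
    qt s t n m x = -fm t (n - 1 - m) (fm s m x) := by simp [qt, not_lt.2 h]

lemma qt_finite (s t : Fin 4) (n : ℤ) (x : Fk) : (Function.support fun m => qt s t n m x).Finite := by
  obtain ⟨d, hd⟩ := fm_loc x
  refine (Set.finite_Icc (n - 1 - d) d).subset fun m hm => ?_
  rw [Function.mem_support] at hm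
  by_contra hc
  apply hm
  rw [Set.mem_Icc, not_and_or] at hc
  rcases lt_or_ge m 0 with h | h
  · rw [qt_neg h, hd t _ (by omega), map_zero]
  · rw [qt_nonneg h]
    rcases hc with hc | hc
    · have := fm_fm t s (n - 1 - m) m x
      rw [if_neg (by omega), hd t _ (by omega), map_zero, add_zero] at this
      rw [this, neg_zero]
    · rw [hd s m (by omega), map_zero, neg_zero]

/-- normally ordered quadratic current -/
noncomputable def cur (s t : Fin 4) (n : ℤ) : Module.End ℝ Fk where
  toFun x := ∑ᶠ m, qt s t n m x
  map_add' x y := by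
    simp only [map_add]
    exact finsum_add_distrib (qt_finite s t n x) (qt_finite s t n y)
  map_smul' r x := by
    simp only [map_smul, RingHom.id_apply]
    exact (smul_finsum r _).symm

lemma cur_apply (s t : Fin 4) (n : ℤ) (x : Fk) : cur s t n x = ∑ᶠ m, qt s t n m x := rfl

lemma qt_fm (s t u : Fin 4) (n m r : ℤ) (x : Fk) :
    qt s t n m (fm u r x) = fm u r (qt s t n m x) +
      ((if m = n + r then (if u = t + 2 then fm s (n + r) x else 0) else 0) -
       (if m = - r - 1 then (if u = s + 2 then fm t (n + r) x else 0) else 0)) := by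
  have h1 := fm_fm s u m r x
  have h2 := fm_fm t u (n - 1 - m) r x
  have h1' := fm_fm s u m r (fm t (n - 1 - m) x)
  have h2' := fm_fm t u (n - 1 - m) r (fm s m x)
  have e1 : fm t (n - 1 - m) (if u = s + 2 ∧ m + r + 1 = 0 then x else 0) =
      if m = - r - 1 then (if u = s + 2 then fm t (n + r) x else 0) else 0 := by
    by_cases h : m = -r - 1
    · subst h
      by_cases h : u = s + 2
      · rw [if_pos ⟨h, by ring⟩, if_pos rfl, if_pos h]; congr 2; ring
      · rw [if_neg (by tauto), if_pos rfl, if_neg h, map_zero]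
    · rw [if_neg (by omega), if_neg h, map_zero]
  have e2 : fm s m (if u = t + 2 ∧ n - 1 - m + r + 1 = 0 then x else 0) =
      if m = n + r then (if u = t + 2 then fm s (n + r) x else 0) else 0 := by
    by_cases h : m = n + r
    · subst h
      by_cases h : u = t + 2
      · rw [if_pos ⟨h, by ring⟩, if_pos rfl, if_pos h]
      · rw [if_neg (by tauto), if_pos rfl, if_neg h, map_zero]
    · rw [if_neg (by omega), if_neg h, map_zero]
  have e1' : (if u = s + 2 ∧ m + r + 1 = 0 then fm t (n - 1 - m) x else 0) =
      if m = - r - 1 then (if u = s + 2 then fm t (n + r) x else 0) else 0 := by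
    rw [← e1]; split_ifs <;> simp
  have e2' : (if u = t + 2 ∧ n - 1 - m + r + 1 = 0 then fm s m x else 0) =
      if m = n + r then (if u = t + 2 then fm s (n + r) x else 0) else 0 := by
    rw [← e2]; split_ifs <;> simp
  rw [e1'] at h1'
  rw [e2'] at h2'
  have h3 := congrArg (fm s m) h2
  have h4 := congrArg (fm t (n - 1 - m)) h1
  rw [e2, map_add] at h3
  rw [e1, map_add] at h4
  generalize (if m = - r - 1 then (if u = s + 2 then fm t (n + r) x else 0) else 0) = P at *
  generalize (if m = n + r then (if u = t + 2 then fm s (n + r) x else 0) else 0) = Q at *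
  rcases lt_or_ge m 0 with hm | hm
  · rw [qt_neg hm, qt_neg hm, ← h3, ← h1']
    abel
  · rw [qt_nonneg hm, qt_nonneg hm, ← h4, ← h2', map_neg]
    abel

lemma cur_fm (s t u : Fin 4) (n r : ℤ) (x : Fk) :
    cur s t n (fm u r x) = fm u r (cur s t n x) +
      ((if u = t + 2 then fm s (n + r) x else 0) - (if u = s + 2 then fm t (n + r) x else 0)) := by
  have key : ∀ (a : ℤ) (y : Fk), (Function.support fun m : ℤ => if m = a then y else 0).Finite :=
    fun a y => (Set.finite_singleton a).subset fun m hm => by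
      by_contra h; exact hm (if_neg h)
  have key2 : ∀ (a : ℤ) (y : Fk), ∑ᶠ m : ℤ, (if m = a then y else 0) = y := fun a y => by
    rw [finsum_eq_single _ a fun m h => if_neg h, if_pos rfl]
  rw [cur_apply, finsum_congr fun m => qt_fm s t u n m r x]
  rw [finsum_add_distrib, finsum_sub_distrib (key _ _) (key _ _), key2, key2]
  · congr 1
    rw [cur_apply]
    exact ((fm u r).toAddMonoidHom.map_finsum (qt_finite s t n x)).symm
  · refine (qt_finite s t n x).subset fun m hm h => hm ?_
    simp only at h ⊢
    rw [h, map_zero]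
  · refine ((key _ _).union (key _ _)).subset (Function.support_sub _ _)

lemma cur_one {s t : Fin 4} {n : ℤ} (h : 0 ≤ n) : cur s t n 1 = 0 := by
  rw [cur_apply, ← finsum_zero (M := Fk) (α := ℤ)]
  refine finsum_congr fun m => ?_
  rcases lt_or_ge m 0 with hm | hm
  · rw [qt_neg hm, fm_one (by omega), map_zero]
  · rw [qt_nonneg hm, fm_one hm, map_zero, neg_zero]

lemma vev_cur {s t : Fin 4} {n : ℤ} (h : n ≤ 0) (x : Fk) : vev (cur s t n x) = 0 := by
  rw [cur_apply, ← LinearMap.toAddMonoidHom_coe, AddMonoidHom.map_finsum _ (qt_finite s t n x),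
    ← finsum_zero (M := ℝ) (α := ℤ)]
  refine finsum_congr fun m => ?_
  rw [LinearMap.toAddMonoidHom_coe]
  rcases lt_or_ge m 0 with hm | hm
  · rw [qt_neg hm, vev_fm hm]
  · rw [qt_nonneg hm, map_neg, vev_fm (by omega), neg_zero]

lemma cur_vac (s t : Fin 4) (n : ℕ) : cur s t (-n) 1 =
    ∑ i ∈ Finset.range n, fm s (-(i : ℤ) - 1) (fm t (-((n - 1 - i : ℕ) : ℤ) - 1) 1) := by
  rw [cur_apply]
  rw [finsum_eq_sum_of_support_subset (s := (Finset.range n).image fun i : ℕ => -(i : ℤ) - 1),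
    Finset.sum_image]
  · refine Finset.sum_congr rfl fun i hi => ?_
    have := Finset.mem_range.1 hi
    rw [qt_neg (by omega)]
    congr 3
    omega
  · intro i _ j _ h
    simp only at h
    omega
  · intro m hm
    rw [Function.mem_support] at hm
    by_contra hc
    apply hm
    have hc' : ∀ i : ℕ, i < n → m ≠ -(i : ℤ) - 1 := by
      rintro i hi rfl
      exact hc (Finset.mem_coe.2 (Finset.mem_image.2 ⟨i, Finset.mem_range.2 hi, rfl⟩))
    rcases lt_or_ge m 0 with h | h
    · have : -(n : ℤ) - 1 - m ≥ 0 := by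
        by_contra h'
        exact hc' (-m - 1).toNat (by omega) (by omega)
      rw [qt_neg h, fm_one this, map_zero]
    · rw [qt_nonneg h, fm_one h, map_zero, neg_zero]


/-- coefficient of the adjoint action of a current on a fermion -/
def co (c : ℤ) (u : Fin 4) : ℝ :=
  if c = 0 then ![0, 1, -1, 0] u else if c = 1 then ![1, -1, -1, 1] u else ![1, 0, 0, -1] u

/-- target of the adjoint action of a current on a fermion -/
def tg (c : ℤ) (u : Fin 4) : Fin 4 :=
  if c = 0 then ![0, 0, 3, 3] u else if c = 1 then u else ![1, 1, 2, 2] u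

/-- the fermionic realization of the letters -/
noncomputable def fX (p : ℤ) : Module.End ℝ Fk :=
  if p % 3 = 0 then cur 0 3 (-(p / 3)) else
  if p % 3 = 1 then cur 0 2 (-(p / 3)) - cur 1 3 (-(p / 3)) else cur 1 2 (-(p / 3))

lemma fX_fm (p : ℤ) (u : Fin 4) (r : ℤ) (x : Fk) :
    fX p (fm u r x) = fm u r (fX p x) + co (p % 3) u • fm (tg (p % 3) u) (r - p / 3) x := by
  have e : -(p / 3) + r = r - p / 3 := by ring
  unfold fX co tg
  split_ifs with h1 h2
  · rw [cur_fm, e]; congr 1; fin_cases u <;> simp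
  · rw [LinearMap.sub_apply, LinearMap.sub_apply, cur_fm, cur_fm, e, map_sub, add_sub_add_comm]
    congr 1; fin_cases u <;> simp
  · rw [cur_fm, e]; congr 1; fin_cases u <;> simp

lemma fX_one {p : ℤ} (h : p < 3) : fX p 1 = 0 := by
  have : 0 ≤ -(p / 3) := by omega
  unfold fX
  split_ifs <;> simp [cur_one this]

lemma vev_fX {p : ℤ} (h : 0 ≤ p) (x : Fk) : vev (fX p x) = 0 := by
  have : -(p / 3) ≤ 0 := by omega
  unfold fX
  split_ifs <;> simp [vev_cur this]

lemma vev_fm_fm_one {s t : Fin 4} {m n : ℤ} (h : n < 0) :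
    vev (fm s m (fm t n 1)) = if t = s + 2 ∧ m + n + 1 = 0 then 1 else 0 := by
  rcases lt_or_ge m 0 with hm | hm
  · rw [vev_fm hm, if_neg (by omega)]
  · have := fm_fm s t m n 1
    rw [fm_one hm, map_zero, add_zero] at this
    rw [this]
    split_ifs <;> simp [vev_one]

lemma vev_fX_cur (p : ℤ) (s t : Fin 4) (n : ℕ) : vev (fX p (cur s t (-n) 1)) =
    if p / 3 + n = 0 then n * (co (p % 3) s * if t = tg (p % 3) s + 2 then 1 else 0) else 0 := by
  rw [cur_vac, map_sum, map_sum, Finset.sum_congr rfl (g := fun i : ℕ =>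
    if p / 3 + n = 0 then (co (p % 3) s * if t = tg (p % 3) s + 2 then 1 else 0) else 0)]
  · rw [Finset.sum_const, Finset.card_range]
    split_ifs <;> simp
  · intro i hi
    have := Finset.mem_range.1 hi
    rw [fX_fm, map_add, vev_fm (by omega), zero_add, map_smul, vev_fm_fm_one (by omega)]
    have e : (-(i : ℤ) - 1 - p / 3 + (-((n - 1 - i : ℕ) : ℤ) - 1) + 1 = 0) ↔ p / 3 + n = 0 := by
      omega
    simp only [e]
    split_ifs <;> simp_all

lemma vev_fX_fX {p q : ℤ} (hq : 0 < q / 3) : vev (fX p (fX q 1)) = sd p q := by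
  obtain ⟨n, hn⟩ := Int.eq_ofNat_of_zero_le hq.le
  rw [fX.eq_1 q, hn]
  have h3 : p % 3 = 0 ∨ p % 3 = 1 ∨ p % 3 = 2 := by omega
  have h3' : q % 3 = 0 ∨ q % 3 = 1 ∨ q % 3 = 2 := by omega
  unfold sd
  rw [hn]
  have e : (n : ℝ) = ((n : ℤ) : ℝ) := by simp
  by_cases hp : p / 3 + n = 0
  · have e2 : ((p / 3 : ℤ) : ℝ) = -(n : ℝ) := by
      rw [e, ← Int.cast_neg]; congr 1; omega
    rcases h3 with h3 | h3 | h3 <;> rcases h3' with h3' | h3' | h3' <;>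
      simp [h3, h3', vev_fX_cur, hp, e2, co, tg]
    ring
  · rcases h3' with h3' | h3' | h3' <;>
      simp [h3', vev_fX_cur, hp]

lemma schur {T : Module.End ℝ Fk} (h : ∀ u r x, T (fm u r x) = fm u r (T x)) (x : Fk) :
    T x = vev (T 1) • x := by
  have h1 : T 1 = vev (T 1) • 1 := by
    apply vac_unique
    intro i
    rw [an_eq_fm, ← h, fm_one (by omega), map_zero]
  induction x using fock_induction' with
  | h1 => exact h1
  | hs r x hx => rw [map_smul, hx, smul_comm]
  | ha x y hx hy => rw [map_add, hx, hy, smul_add]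
  | hc s m x hm hx => rw [h, hx, map_smul]

lemma co_comm (p q : ℤ) (u : Fin 4) (r : ℤ) (x : Fk) :
    (co (q % 3) u * co (p % 3) (tg (q % 3) u)) •
      fm (tg (p % 3) (tg (q % 3) u)) (r - q / 3 - p / 3) x -
    (co (p % 3) u * co (q % 3) (tg (p % 3) u)) •
      fm (tg (q % 3) (tg (p % 3) u)) (r - p / 3 - q / 3) x =
    (sc p q * co ((p + q - 1) % 3) u) •
      fm (tg ((p + q - 1) % 3) u) (r - (p + q - 1) / 3) x := by
  obtain ⟨a, i, hi, rfl⟩ : ∃ a i : ℤ, (i = 0 ∨ i = 1 ∨ i = 2) ∧ p = 3 * a + i :=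
    ⟨p / 3, p % 3, by omega, by omega⟩
  obtain ⟨b, j, hj, rfl⟩ : ∃ a i : ℤ, (i = 0 ∨ i = 1 ∨ i = 2) ∧ q = 3 * a + i :=
    ⟨q / 3, q % 3, by omega, by omega⟩
  have e3 : r - b - a = r - a - b := by ring
  by_cases hs : sc (3 * a + i) (3 * b + j) = 0
  · rw [hs, zero_mul, zero_smul]
    rcases hi with rfl | rfl | rfl <;> rcases hj with rfl | rfl | rfl
    all_goals first
      | (exfalso; revert hs
         have e1 : ∀ z : ℤ, (3 * z) % 3 = 0 := fun z => by omega
         have e2 : ∀ z : ℤ, (3 * z + 1) % 3 = 1 := fun z => by omega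
         have e4 : ∀ z : ℤ, (3 * z + 2) % 3 = 2 := fun z => by omega
         simp [sc, e1, e2, e4]; done)
      | skip
    all_goals
      have e1 : ∀ z : ℤ, (3 * z) % 3 = 0 := fun z => by omega
      have e2 : ∀ z : ℤ, (3 * z + 1) % 3 = 1 := fun z => by omega
      have e4 : ∀ z : ℤ, (3 * z + 2) % 3 = 2 := fun z => by omega
      have f1 : ∀ z : ℤ, (3 * z) / 3 = z := fun z => by omega
      have f2 : ∀ z : ℤ, (3 * z + 1) / 3 = z := fun z => by omega
      have f4 : ∀ z : ℤ, (3 * z + 2) / 3 = z := fun z => by omega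
      simp only [add_zero, e1, e2, e4, f1, f2, f4, e3]
      fin_cases u <;> simp [co, tg]
  · have hd := VRep.sc_ne hs
    have hm : (3 * a + i + (3 * b + j) - 1) % 3 = i + j - 1 := by
      have : (3 * a + i) % 3 = i ∧ (3 * b + j) % 3 = j := by omega
      omega
    have g1 : (3 * a + i) / 3 = a := by omega
    have g2 : (3 * b + j) / 3 = b := by omega
    have g3 : (3 * a + i) % 3 = i := by omega
    have g4 : (3 * b + j) % 3 = j := by omega
    rw [hd, hm]
    unfold sc at hs ⊢
    rw [g1, g2, g3, g4, e3, ← sub_sub] at *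
    rcases hi with rfl | rfl | rfl <;> rcases hj with rfl | rfl | rfl <;>
      fin_cases u <;> simp [co, tg] at hs ⊢
    all_goals module

lemma fX_comm (p q : ℤ) :
    fX p * fX q - fX q * fX p = sc p q • fX (p + q - 1) + (1 * sd p q) • 1 := by
  have hc := schur (T := fX p * fX q - fX q * fX p - sc p q • fX (p + q - 1)) (by
    intro u r x
    simp only [LinearMap.sub_apply, Module.End.mul_apply, LinearMap.smul_apply, fX_fm, map_add,
      map_sub, map_smul, smul_add, smul_smul]
    have := co_comm p q u r x
    rw [← sub_eq_zero] at this ⊢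
    rw [← this]
    abel)
  have hv : ∀ r, vev (fX r 1) = 0 := fun r => by
    rcases lt_or_ge r 3 with h | h
    · rw [fX_one h, map_zero]
    · exact vev_fX (by omega) _
  have hs : vev ((fX p * fX q - fX q * fX p - sc p q • fX (p + q - 1)) 1) = sd p q := by
    simp only [LinearMap.sub_apply, Module.End.mul_apply, LinearMap.smul_apply, map_sub, map_smul,
      hv, smul_zero, sub_zero]
    rcases lt_trichotomy 0 (q / 3) with h | h | h
    · rw [vev_fX_fX h]
      rcases lt_or_ge p 3 with h' | h'
      · rw [fX_one h', map_zero, map_zero, sub_zero]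
      · rw [vev_fX (by omega), sub_zero]
    · have h1 : sd p q = 0 := by
        unfold sd
        split_ifs with h1
        · rw [show p / 3 = 0 by omega]; simp
        · rw [show p / 3 = 0 by omega]; simp
        · rfl
        · rfl
      rw [h1, fX_one (p := q) (by omega), vev_fX (p := q) (by omega)]
      simp
    · rw [fX_one (p := q) (by omega), map_zero, map_zero, zero_sub]
      rcases lt_or_ge p 3 with h' | h'
      · rw [fX_one h', map_zero, map_zero]
        unfold sd
        rw [if_neg (by omega), neg_zero]
      · rw [vev_fX_fX (by omega)]
        unfold sd
        rw [add_comm (q / 3), add_comm (q % 3)]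
        split_ifs with h1 h2 h3 h4 <;> try simp
        all_goals try omega
        all_goals
          rw [show p / 3 = - (q / 3) by omega]; push_cast; ring
  refine LinearMap.ext fun x => ?_
  have := hc x
  rw [hs, LinearMap.sub_apply, sub_eq_iff_eq_add'] at this
  simpa using this


/-- the level one vacuum representation on the Fock space -/
noncomputable def fockRep : VRep 1 Fk where
  X := fX
  v := 1
  comm := fX_comm
  vac _ h := fX_one h

/-- contraction by the mode functionals, as an anti-homomorphism -/
noncomputable def contr : Fk →ₐ[ℝ] (Module.End ℝ Fk)ᵐᵒᵖ :=
  ExteriorAlgebra.lift ℝ ⟨(MulOpposite.opLinearEquiv ℝ).toLinearMap ∘ₗ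
    (CliffordAlgebra.contractLeft (Q := (0 : QuadraticForm ℝ FW))) ∘ₗ
    Finsupp.linearCombination ℝ fun i => Finsupp.lapply i, fun w => by
      apply MulOpposite.unop_injective
      refine LinearMap.ext fun x => ?_
      exact CliffordAlgebra.contractLeft_contractLeft (Q := (0 : QuadraticForm ℝ FW)) _ x⟩

/-- the invariant form -/
noncomputable def fB (x y : Fk) : ℝ := vev ((contr x).unop y)

lemma contr_cr (i : Fin 4 × ℕ) : contr (cr i) = MulOpposite.op (an i) := by
  simp [contr, cr, an]

lemma fB_add_left (x x' y : Fk) : fB (x + x') y = fB x y + fB x' y := by simp [fB]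
lemma fB_add_right (x y y' : Fk) : fB x (y + y') = fB x y + fB x y' := by simp [fB]
lemma fB_smul_left (r : ℝ) (x y : Fk) : fB (r • x) y = r * fB x y := by simp [fB]
lemma fB_smul_right (r : ℝ) (x y : Fk) : fB x (r • y) = r * fB x y := by simp [fB]
lemma fB_zero_left (y : Fk) : fB 0 y = 0 := by simp [fB]
lemma fB_zero_right (y : Fk) : fB y 0 = 0 := by simp [fB]
lemma fB_sub_right (x y y' : Fk) : fB x (y - y') = fB x y - fB x y' := by simp [fB]
lemma fB_sub_left (x y y' : Fk) : fB (x - y') y = fB x y - fB y' y := by simp [fB]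
lemma fB_one (y : Fk) : fB 1 y = vev y := by simp [fB]

lemma fB_cr (i : Fin 4 × ℕ) (x y : Fk) : fB (cr i * x) y = fB x (an i y) := by
  simp [fB, contr_cr]

lemma fB_an (i : Fin 4 × ℕ) (x y : Fk) : fB (an i x) y = fB x (cr i * y) := by
  induction x using fock_induction generalizing y with
  | h1 => rw [an_one, fB_zero_left, fB_one, cr, vev_ι]
  | hs r x hx => rw [map_smul, fB_smul_left, fB_smul_left, hx]
  | ha x y hx hy => rw [map_add, fB_add_left, fB_add_left, hx, hy]
  | hc j x hx =>
    rw [an_cr, fB_cr, an_cr, fB_sub_left, fB_sub_right, fB_cr, hx]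
    simp only [eq_comm (a := i)]
    split_ifs <;> simp [fB_zero_left, fB_zero_right]

lemma fB_symm (x y : Fk) : fB x y = fB y x := by
  induction x using fock_induction generalizing y with
  | h1 =>
    induction y using fock_induction with
    | h1 => rfl
    | hs r x hx => rw [fB_smul_left, fB_smul_right, hx]
    | ha x y hx hy => rw [fB_add_left, fB_add_right, hx, hy]
    | hc i x hx => rw [fB_cr, fB_one, an_one, fB_zero_right, cr, vev_ι]
  | hs r x hx => rw [fB_smul_left, fB_smul_right, hx]
  | ha x y hx hy => rw [fB_add_left, fB_add_right, hx, hy]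
  | hc i x hx => rw [fB_cr, hx, fB_an]

lemma fB_pos (x : Fk) : 0 ≤ fB x x ∧ (fB x x = 0 → x = 0) := by
  have hfin : ∃ J : Finset (Fin 4 × ℕ), ∀ i ∉ J, an i x = 0 := by
    induction x using fock_induction with
    | h1 => exact ⟨∅, fun i _ => an_one i⟩
    | hs r x hx =>
      obtain ⟨J, hJ⟩ := hx
      exact ⟨J, fun i h => by rw [map_smul, hJ i h, smul_zero]⟩
    | ha x y hx hy =>
      obtain ⟨J, hJ⟩ := hx
      obtain ⟨J', hJ'⟩ := hy
      refine ⟨J ∪ J', fun i h => ?_⟩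
      rw [Finset.mem_union, not_or] at h
      rw [map_add, hJ i h.1, hJ' i h.2, add_zero]
    | hc j x hx =>
      obtain ⟨J, hJ⟩ := hx
      refine ⟨insert j J, fun i h => ?_⟩
      rw [Finset.mem_insert, not_or] at h
      rw [an_cr, if_neg h.1, hJ i h.2, mul_zero, sub_zero]
  obtain ⟨J, hJ⟩ := hfin
  induction J using Finset.induction_on generalizing x with
  | empty =>
    have hx := vac_unique fun i => hJ i (by simp)
    have : fB x x = vev x * vev x := by
      conv_lhs => rw [hx]
      rw [fB_smul_left, fB_one]; simp [vev_one]
    rw [this]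
    refine ⟨mul_self_nonneg _, fun h => ?_⟩
    rw [hx, mul_self_eq_zero.1 h, zero_smul]
  | insert j J hj ih =>
    have hw : ∀ i ∉ J, an i (an j x) = 0 := fun i hi => by
      by_cases h : i = j
      · subst h
        have := an_an i i x
        rw [← two_smul ℝ, smul_eq_zero] at this
        exact this.resolve_left two_ne_zero
      · rw [eq_neg_of_add_eq_zero_left (an_an i j x), hJ i (by simp [h, hi]), map_zero, neg_zero]
    have hu : ∀ i ∉ J, an i (x - cr j * an j x) = 0 := fun i hi => by
      rw [map_sub, an_cr, hw i hi, mul_zero, sub_zero]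
      split_ifs with h
      · rw [h, sub_self]
      · rw [hJ i (by simp [h, hi]), sub_zero]
    have e : fB x x = fB (x - cr j * an j x) (x - cr j * an j x) + fB (an j x) (an j x) := by
      have e1 : fB (x - cr j * an j x) (cr j * an j x) = 0 := by
        rw [← fB_an, hu j hj, fB_zero_left]
      have e2 : fB (cr j * an j x) (cr j * an j x) = fB (an j x) (an j x) := by
        rw [fB_cr, an_cr, if_pos rfl, hw j hj, mul_zero, sub_zero]
      rw [fB_sub_left, e2] at e1
      rw [fB_sub_left, fB_sub_right, fB_sub_right, e2, fB_symm (cr j * an j x) x]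
      linarith
    obtain ⟨h1, h1'⟩ := ih _ hu
    obtain ⟨h2, h2'⟩ := ih _ hw
    rw [e]
    refine ⟨add_nonneg h1 h2, fun h => ?_⟩
    have h3 := h1' (by linarith)
    have h4 := h2' (by linarith)
    rw [h4, mul_zero, sub_zero] at h3
    exact h3

lemma add_two_two (s : Fin 4) : s + 2 + 2 = s := by revert s; decide

lemma fB_fm (s : Fin 4) (m : ℤ) (x y : Fk) : fB (fm s m x) y = fB x (fm (s + 2) (-m - 1) y) := by
  rcases lt_or_ge m 0 with h | h
  · rw [fm_neg h, fm_nonneg (by omega), fB_cr, add_two_two]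
  · rw [fm_nonneg h, fm_neg (by omega), fB_an]
    congr 5
    omega

lemma co_adj (p : ℤ) (u : Fin 4) (r : ℤ) (x : Fk) :
    co (p % 3) u • fm (tg (p % 3) u + 2) r x +
      co ((2 - p) % 3) (u + 2) • fm (tg ((2 - p) % 3) (u + 2)) r x = 0 := by
  have h3 : (p % 3 = 0 ∧ (2 - p) % 3 = 2) ∨ (p % 3 = 1 ∧ (2 - p) % 3 = 1) ∨
    (p % 3 = 2 ∧ (2 - p) % 3 = 0) := by omega
  rcases h3 with ⟨h, h'⟩ | ⟨h, h'⟩ | ⟨h, h'⟩ <;> rw [h, h'] <;> fin_cases u <;> simp [co, tg]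

lemma fB_fX (p : ℤ) (x y : Fk) : fB (fX p x) y = fB x (fX (2 - p) y) := by
  have hd : (2 - p) / 3 = -(p / 3) := by omega
  have hm : (2 - (2 - p)) = p := by ring
  induction x using fock_induction' generalizing y with
  | h1 =>
    rw [fB_one]
    rcases lt_or_ge p 3 with h | h
    · rw [fX_one h, fB_zero_left, vev_fX (by omega)]
    · induction y using fock_induction' with
      | h1 => rw [fB_symm, fB_one, vev_fX (by omega), fX_one (by omega), map_zero]
      | hs r x hx => rw [fB_smul_right, hx, map_smul, map_smul, smul_eq_mul]
      | ha x y hx hy => rw [fB_add_right, hx, hy, map_add, map_add]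
      | hc u r y hr hy =>
        have e1 := fX_fm p (u + 2) (-r - 1) 1
        rw [fm_one (by omega), map_zero] at e1
        have e2 := eq_neg_of_add_eq_zero_left e1.symm
        have e3 := congrArg vev (co_adj p (u + 2) (r + p / 3) y)
        rw [fB_symm, fB_fm, e2, fB_symm, ← neg_smul, fB_smul_left, fB_fm, fB_one, fX_fm, map_add,
          vev_fm hr, zero_add, map_smul, hd]
        rw [add_two_two, map_add, map_smul, map_smul, map_zero] at e3
        rw [show -(-r - 1 - p / 3) - 1 = r + p / 3 by ring, show r - -(p / 3) = r + p / 3 by ring]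
        simp only [smul_eq_mul] at e3 ⊢
        linarith
  | hs r x hx => rw [map_smul, fB_smul_left, fB_smul_left, hx]
  | ha x y hx hy => rw [map_add, fB_add_left, fB_add_left, hx, hy]
  | hc u r x hr hx =>
    have e3 := congrArg (fB x) (co_adj p u (-r - 1 + p / 3) y)
    rw [fB_zero_right, fB_add_right, fB_smul_right, fB_smul_right] at e3
    rw [fX_fm, fB_add_left, fB_smul_left, fB_fm, fB_fm, fB_fm, hx, fX_fm, fB_add_right,
      fB_smul_right, hd, show -r - 1 - -(p / 3) = -r - 1 + p / 3 by ring,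
      show -(r - p / 3) - 1 = -r - 1 + p / 3 by ring]
    linarith

/-- first factor of the current -/
noncomputable def psi (t : ℝ) (m : ℤ) : Module.End ℝ Fk := fm 0 m + t • fm 1 m

/-- second factor of the current -/
noncomputable def chi (t : ℝ) (m : ℤ) : Module.End ℝ Fk := fm 3 m - t • fm 2 m

lemma psi_psi (t : ℝ) (m n : ℤ) : psi t m * psi t n = -(psi t n * psi t m) := by
  refine LinearMap.ext fun x => eq_neg_of_add_eq_zero_left ?_
  simp only [psi, Module.End.mul_apply, LinearMap.add_apply, LinearMap.smul_apply, map_add,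
    map_smul, smul_add]
  have h1 := fm_fm 0 0 m n x
  have h2 := fm_fm 0 1 m n x
  have h3 := fm_fm 1 0 m n x
  have h4 := fm_fm 1 1 m n x
  simp only [Fin.isValue, Fin.reduceAdd, Fin.reduceEq, false_and, if_false] at h1 h2 h3 h4
  have h := congrArg₂ (· + ·) (congrArg₂ (· + ·) (congrArg₂ (· + ·) h1 (congrArg (t • ·) h2))
    (congrArg (t • ·) h3)) (congrArg (t • t • ·) h4)
  simp only [smul_zero, add_zero] at h
  rw [← h]
  module

lemma chi_chi (t : ℝ) (m n : ℤ) : chi t m * chi t n = -(chi t n * chi t m) := by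
  refine LinearMap.ext fun x => eq_neg_of_add_eq_zero_left ?_
  simp only [chi, Module.End.mul_apply, LinearMap.sub_apply, LinearMap.smul_apply, map_sub,
    map_smul, smul_sub]
  have h1 := fm_fm 3 3 m n x
  have h2 := fm_fm 3 2 m n x
  have h3 := fm_fm 2 3 m n x
  have h4 := fm_fm 2 2 m n x
  simp only [Fin.isValue, Fin.reduceAdd, Fin.reduceEq, false_and, if_false] at h1 h2 h3 h4
  have h := congrArg₂ (· + ·) (congrArg₂ (· - ·) (congrArg₂ (· - ·) h1 (congrArg (t • ·) h2))
    (congrArg (t • ·) h3)) (congrArg (t • t • ·) h4)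
  simp only [smul_zero, sub_zero, add_zero] at h
  rw [← h]
  module

lemma chi_psi (t : ℝ) (m n : ℤ) : chi t m * psi t n = -(psi t n * chi t m) := by
  refine LinearMap.ext fun x => eq_neg_of_add_eq_zero_left ?_
  simp only [chi, psi, Module.End.mul_apply, LinearMap.sub_apply, LinearMap.add_apply,
    LinearMap.smul_apply, map_sub, map_add, map_smul, smul_sub, smul_add]
  have h1 := fm_fm 3 0 m n x
  have h2 := fm_fm 3 1 m n x
  have h3 := fm_fm 2 0 m n x
  have h4 := fm_fm 2 1 m n x
  simp only [Fin.isValue, Fin.reduceAdd, Fin.reduceEq, false_and, true_and, if_false] at h1 h2 h3 h4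
  have h := congrArg₂ (· - ·) (congrArg₂ (· - ·) (congrArg₂ (· + ·) h1 (congrArg (t • ·) h2))
    (congrArg (t • ·) h3)) (congrArg (t • t • ·) h4)
  simp only [smul_zero, zero_add, sub_self] at h
  rw [← h]
  module

lemma Y_term (t : ℝ) (n m : ℤ) (x : Fk) :
    qt 0 3 n m x - t • (qt 0 2 n m x - qt 1 3 n m x) - t ^ 2 • qt 1 2 n m x =
      psi t m (chi t (n - 1 - m) x) := by
  rcases lt_or_ge m 0 with h | h
  · simp only [qt_neg h, psi, chi, LinearMap.sub_apply, LinearMap.add_apply, LinearMap.smul_apply,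
      map_sub, map_smul]
    module
  · have e := LinearMap.congr_fun (chi_psi t (n - 1 - m) m) x
    rw [LinearMap.neg_apply, Module.End.mul_apply, Module.End.mul_apply] at e
    rw [← neg_eq_iff_eq_neg.2 e]
    simp only [qt_nonneg h, psi, chi, LinearMap.sub_apply, LinearMap.add_apply,
      LinearMap.smul_apply, map_add, map_smul]
    module

lemma fock_Y (t : ℝ) (j : ℤ) (x : Fk) :
    fockRep.Y t j x = ∑ᶠ m : ℤ, psi t m (chi t (-j - 1 - m) x) := by
  have h0 : fX (3 * j) = cur 0 3 (-j) := by
    rw [fX.eq_1, if_pos (by omega), show 3 * j / 3 = j by omega]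
  have h1 : fX (3 * j + 1) = cur 0 2 (-j) - cur 1 3 (-j) := by
    rw [fX.eq_1, if_neg (by omega), if_pos (by omega), show (3 * j + 1) / 3 = j by omega]
  have h2 : fX (3 * j + 2) = cur 1 2 (-j) := by
    rw [fX.eq_1, if_neg (by omega), if_neg (by omega), show (3 * j + 2) / 3 = j by omega]
  rw [finsum_congr fun m => (Y_term t (-j) m x).symm]
  have f1 := qt_finite 0 3 (-j) x
  have f2 := qt_finite 0 2 (-j) x
  have f3 := qt_finite 1 3 (-j) x
  have f4 := qt_finite 1 2 (-j) x
  have f5 : (Function.support fun m => t • (qt 0 2 (-j) m x - qt 1 3 (-j) m x)).Finite :=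
    (f2.union f3).subset fun m hm => by
      by_contra hc
      simp only [Set.mem_union, Function.mem_support, not_or, not_not] at hc
      apply hm
      simp only [hc.1, hc.2, sub_zero, smul_zero]
  have f6 : (Function.support fun m => t ^ 2 • qt 1 2 (-j) m x).Finite :=
    f4.subset fun m hm => by
      by_contra hc
      simp only [Function.mem_support, not_not] at hc
      apply hm
      simp only [hc, smul_zero]
  have f7 : (Function.support fun m => qt 0 3 (-j) m x -
      t • (qt 0 2 (-j) m x - qt 1 3 (-j) m x)).Finite :=
    (f1.union f5).subset fun m hm => by
      by_contra hc
      simp only [Set.mem_union, Function.mem_support, not_or, not_not] at hc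
      apply hm
      simp only [hc.1, hc.2, sub_zero]
  rw [finsum_sub_distrib f7 f6, finsum_sub_distrib f1 f5, ← smul_finsum, ← smul_finsum,
    finsum_sub_distrib f2 f3]
  simp only [VRep.Y, fockRep, h0, h1, h2, LinearMap.sub_apply, LinearMap.smul_apply, cur_apply]

/-- power series of first factors -/
noncomputable def Ps (t : ℝ) (d : ℤ) : PowerSeries (Module.End ℝ Fk) :=
  PowerSeries.mk fun i => psi t (d - 1 - i)

/-- power series of second factors -/
noncomputable def Ch (t : ℝ) (d : ℤ) : PowerSeries (Module.End ℝ Fk) :=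
  PowerSeries.mk fun i => chi t (d - i)

lemma mk_anticomm {f g : ℕ → Module.End ℝ Fk} (h : ∀ i j, f i * g j = -(g j * f i)) :
    PowerSeries.mk f * PowerSeries.mk g + PowerSeries.mk g * PowerSeries.mk f = 0 := by
  refine PowerSeries.ext fun n => ?_
  rw [map_add, map_zero, add_eq_zero_iff_eq_neg, PowerSeries.coeff_mul, PowerSeries.coeff_mul,
    ← Finset.sum_neg_distrib, ← Finset.Nat.sum_antidiagonal_swap]
  refine Finset.sum_congr rfl fun p _ => ?_
  simp only [PowerSeries.coeff_mk, Prod.fst_swap, Prod.snd_swap]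
  exact h _ _

lemma Ps_sq (t : ℝ) (d : ℤ) : Ps t d * Ps t d = 0 := by
  have h : Ps t d * Ps t d + Ps t d * Ps t d = 0 := mk_anticomm fun i j => psi_psi t _ _
  refine PowerSeries.ext fun n => LinearMap.ext fun x => ?_
  have := LinearMap.congr_fun (congrArg (PowerSeries.coeff n) h) x
  rw [map_add, LinearMap.add_apply, ← two_smul ℝ, map_zero, LinearMap.zero_apply,
    smul_eq_zero] at this
  simpa using this

lemma PsCh_sq (t : ℝ) (d d' : ℤ) : (Ps t d * Ch t d') ^ 2 = 0 := by
  have h : Ch t d' * Ps t d + Ps t d * Ch t d' = 0 := mk_anticomm fun i j => chi_psi t _ _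
  have h0 : Ps t d * (Ps t d * Ch t d') * Ch t d' = 0 := by
    rw [← mul_assoc, Ps_sq, zero_mul, zero_mul]
  calc (Ps t d * Ch t d') ^ 2 = Ps t d * (Ch t d' * Ps t d) * Ch t d' := by
        rw [pow_two]; simp only [mul_assoc]
    _ = Ps t d * (Ch t d' * Ps t d + Ps t d * Ch t d') * Ch t d' := by
        rw [mul_add, add_mul, h0, add_zero]
    _ = 0 := by rw [h, mul_zero, zero_mul]

lemma fock_Y_conv {t : ℝ} {d D : ℤ} {x : Fk} (h1 : ∀ m, d ≤ m → psi t m x = 0)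
    (h2 : ∀ m, D - d < m → chi t m x = 0) (b : ℕ) :
    fockRep.Y t (b - D) x = PowerSeries.coeff b (Ps t d * Ch t (D - d)) x := by
  rw [fock_Y, PowerSeries.coeff_mul, LinearMap.sum_apply]
  simp only [Ps, Ch, PowerSeries.coeff_mk, Module.End.mul_apply]
  rw [Finset.Nat.sum_antidiagonal_eq_sum_range_succ
    (fun i j => psi t (d - 1 - i) (chi t (D - d - j) x))]
  have inj : Set.InjOn (fun i : ℕ => d - 1 - (i : ℤ)) (Finset.range b.succ : Finset ℕ) :=
    fun i _ j _ hij => by simp only at hij; omega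
  rw [finsum_eq_sum_of_support_subset (s := (Finset.range b.succ).image fun i : ℕ => d - 1 - (i : ℤ)),
    Finset.sum_image inj]
  · refine Finset.sum_congr rfl fun i hi => ?_
    rw [Finset.mem_range] at hi
    congr 3
    omega
  · intro m hm
    rw [Function.mem_support] at hm
    have hm1 : m < d := by
      by_contra hc
      apply hm
      have e := LinearMap.congr_fun (chi_psi t (-(b - D) - 1 - m) m) x
      rw [LinearMap.neg_apply, Module.End.mul_apply, Module.End.mul_apply, h1 m (by omega),
        map_zero] at e
      exact neg_eq_zero.1 e.symm
    have hm2 : d - 1 - b ≤ m := by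
      by_contra hc
      apply hm
      rw [h2 _ (by omega), map_zero]
    simp only [Finset.coe_image, Set.mem_image, Finset.mem_coe, Finset.mem_range]
    exact ⟨(d - 1 - m).toNat, by omega, by omega⟩

lemma fock_fieldRel : fockRep.FieldRel 1 := by
  intro w
  obtain ⟨d, hd⟩ := fm_loc w
  refine ⟨2 * d, fun D hD t M => ?_⟩
  have h1 : ∀ m, (d : ℤ) ≤ m → psi t m w = 0 := fun m hm => by
    simp [psi, hd _ m hm]
  have h2 : ∀ m, (D : ℤ) - d < m → chi t m w = 0 := fun m hm => by
    simp [chi, hd _ m (by omega)]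
  have key : ∀ (T : Module.End ℝ Fk), (∀ a b, T * (psi t a * chi t b) = psi t a * chi t b * T) →
      T w = 0 → ∀ j, T (PowerSeries.coeff j (Ps t d * Ch t (D - d)) w) = 0 := by
    intro T hT hw j
    rw [PowerSeries.coeff_mul, LinearMap.sum_apply, map_sum]
    refine Finset.sum_eq_zero fun q _ => ?_
    simp only [Ps, Ch, PowerSeries.coeff_mk]
    rw [← Module.End.mul_apply, hT, Module.End.mul_apply, hw, map_zero]
  have e : ∀ b, PowerSeries.coeff b (fockRep.G t D) = fockRep.Y t (b - D) := fun b => by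
    rw [VRep.G, PowerSeries.coeff_mk]
  have : (PowerSeries.coeff M (fockRep.G t D ^ (1 + 1)) : Module.End ℝ Fk) w =
      (PowerSeries.coeff M ((Ps t d * Ch t (D - d)) ^ 2) : Module.End ℝ Fk) w := by
    rw [pow_two, pow_two, PowerSeries.coeff_mul, PowerSeries.coeff_mul, LinearMap.sum_apply,
      LinearMap.sum_apply]
    refine Finset.sum_congr rfl fun q _ => ?_
    rw [Module.End.mul_apply, Module.End.mul_apply, e, e, fock_Y_conv h1 h2, fock_Y_conv]
    · intro m hm
      refine key _ (fun a b => ?_) (h1 m hm) _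
      refine LinearMap.ext fun y => ?_
      have e1 := LinearMap.congr_fun (psi_psi t m a) (chi t b y)
      have e2 := LinearMap.congr_fun (chi_psi t b m) y
      simp only [LinearMap.neg_apply, Module.End.mul_apply] at e1 e2 ⊢
      rw [e1, e2, map_neg]
    · intro m hm
      refine key _ (fun a b => ?_) (h2 m hm) _
      refine LinearMap.ext fun y => ?_
      have e1 := LinearMap.congr_fun (chi_psi t m a) (chi t b y)
      have e2 := LinearMap.congr_fun (chi_chi t m b) y
      simp only [LinearMap.neg_apply, Module.End.mul_apply] at e1 e2 ⊢
      rw [e1, e2, map_neg, neg_neg]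
  rw [this, PsCh_sq, map_zero, LinearMap.zero_apply]


lemma cr_cr_mul (i j : Fin 4 × ℕ) (x : Fk) : cr i * (cr j * x) = -(cr j * (cr i * x)) := by
  rw [← mul_assoc, eq_neg_of_add_eq_zero_left (cr_cr i j), neg_mul, mul_assoc]

lemma cr_sq_mul (i : Fin 4 × ℕ) (x : Fk) : cr i * (cr i * x) = 0 := by
  rw [← mul_assoc, cr, ExteriorAlgebra.ι_sq_zero, zero_mul]

lemma cr_cr_central (i j : Fin 4 × ℕ) : cr i * cr j ∈ Subalgebra.center ℝ Fk := by
  rw [Subalgebra.mem_center_iff]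
  intro x
  induction x using fock_induction with
  | h1 => rw [one_mul, mul_one]
  | hs r x hx => rw [smul_mul_assoc, hx, mul_smul_comm]
  | ha x y hx hy => rw [add_mul, hx, hy, mul_add]
  | hc l x hx =>
    rw [mul_assoc, hx, mul_assoc, mul_assoc, cr_cr_mul j l, cr_cr_mul l i, mul_neg]

/-- quadratic elements of the Grassmann algebra -/
noncomputable def qd (s t : Fin 4) (n : ℕ) : Fk :=
  ∑ i ∈ Finset.range n, cr (s, i) * cr (t, n - 1 - i)

/-- leading terms of the letters -/
noncomputable def ge (c : Fin 3) (n : ℕ) : Fk :=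
  ![qd 0 3 n, qd 0 2 n - qd 1 3 n, qd 1 2 n] c

lemma qd_central (s t : Fin 4) (n : ℕ) : qd s t n ∈ Subalgebra.center ℝ Fk :=
  Subalgebra.sum_mem _ fun _ _ => cr_cr_central _ _

lemma ge_central (c : Fin 3) (n : ℕ) : ge c n ∈ Subalgebra.center ℝ Fk := by
  fin_cases c
  · exact qd_central _ _ _
  · exact sub_mem (qd_central _ _ _) (qd_central _ _ _)
  · exact qd_central _ _ _

/-- shift of the modes of the flavors in `P`, killing the zero modes -/
noncomputable def shf (P : Finset (Fin 4)) : Fk →ₐ[ℝ] Fk :=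
  ExteriorAlgebra.map (Finsupp.lsum ℝ fun i =>
    if i.1 ∈ P then (if i.2 = 0 then 0 else Finsupp.lsingle (i.1, i.2 - 1)) else Finsupp.lsingle i)

lemma shf_of_notMem {P : Finset (Fin 4)} {s : Fin 4} (h : s ∉ P) (n : ℕ) :
    shf P (cr (s, n)) = cr (s, n) := by
  simp [shf, cr, h]

lemma shf_zero {P : Finset (Fin 4)} {s : Fin 4} (h : s ∈ P) : shf P (cr (s, 0)) = 0 := by
  simp [shf, cr, h]

lemma shf_succ {P : Finset (Fin 4)} {s : Fin 4} (h : s ∈ P) (n : ℕ) :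
    shf P (cr (s, n + 1)) = cr (s, n) := by
  simp [shf, cr, h]

lemma shf_qd_left {P : Finset (Fin 4)} {s t : Fin 4} (h : s ∈ P) (ht : t ∉ P) (n : ℕ) :
    shf P (qd s t (n + 1)) = qd s t n := by
  rw [qd, map_sum, Finset.sum_range_succ', map_mul, shf_zero h, zero_mul, add_zero, qd]
  refine Finset.sum_congr rfl fun i _ => ?_
  rw [map_mul, shf_succ h, shf_of_notMem ht, show n + 1 - 1 - (i + 1) = n - 1 - i by omega]

lemma shf_qd_right {P : Finset (Fin 4)} {s t : Fin 4} (h : s ∉ P) (ht : t ∈ P) (n : ℕ) :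
    shf P (qd s t (n + 1)) = qd s t n := by
  rw [qd, map_sum, Finset.sum_range_succ, map_mul, show n + 1 - 1 - n = 0 by omega, shf_zero ht,
    mul_zero, add_zero, qd]
  refine Finset.sum_congr rfl fun i hi => ?_
  rw [Finset.mem_range] at hi
  rw [map_mul, shf_of_notMem h, show n + 1 - 1 - i = (n - 1 - i) + 1 by omega, shf_succ ht]

/-- shift of the first factor -/
noncomputable def thA : Fk →ₐ[ℝ] Fk := shf {0, 1}
/-- shift of the second factor -/
noncomputable def thC : Fk →ₐ[ℝ] Fk := shf {2, 3}

lemma thA_ge (c : Fin 3) (n : ℕ) : thA (ge c (n + 1)) = ge c n := by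
  fin_cases c
  · exact shf_qd_left (by decide) (by decide) n
  · exact (map_sub thA _ _).trans (congrArg₂ _ (shf_qd_left (by decide) (by decide) n)
      (shf_qd_left (by decide) (by decide) n))
  · exact shf_qd_left (by decide) (by decide) n

lemma thC_ge (c : Fin 3) (n : ℕ) : thC (ge c (n + 1)) = ge c n := by
  fin_cases c
  · exact shf_qd_right (by decide) (by decide) n
  · exact (map_sub thC _ _).trans (congrArg₂ _ (shf_qd_right (by decide) (by decide) n)
      (shf_qd_right (by decide) (by decide) n))
  · exact shf_qd_right (by decide) (by decide) n

lemma ge_zero (c : Fin 3) : ge c 0 = 0 := by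
  fin_cases c <;> simp [ge, qd]

lemma shf_eq_zero {P : Finset (Fin 4)} {s t : Fin 4} (hs : s ∈ P) (ht : t ∈ P) (hst : s ≠ t)
    {z : Fk} (h : cr (s, 0) * (cr (t, 0) * z) = 0) : shf P z = 0 := by
  have h1 := congrArg (fun x => shf P (an (t, 0) (an (s, 0) x))) h
  simp only [map_zero, an_cr, if_true, map_sub, Prod.mk.injEq, hst, false_and, if_false, zero_sub,
    map_neg, map_mul, shf_zero hs, shf_zero ht, zero_mul, hst.symm] at h1
  simpa using h1

lemma thA_eq_zero {z : Fk} (h : cr (0, 0) * (cr (1, 0) * z) = 0) : thA z = 0 :=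
  shf_eq_zero (by decide) (by decide) (by decide) h

lemma thC_eq_zero {z : Fk} (h : cr (2, 0) * (cr (3, 0) * z) = 0) : thC z = 0 :=
  shf_eq_zero (by decide) (by decide) (by decide) h

/-- monomials in one block of letters: `1, e, h, f, ef` -/
noncomputable def bl (s : ℕ) (B : Fin 5) : Fk := ![1, ge 0 s, ge 1 s, ge 2 s, ge 0 s * ge 2 s] B

/-- linear combination of products of blocks -/
noncomputable def ev : ℕ → ℕ → (List (Fin 5) → ℝ) → Fk
  | _, 0, f => f [] • 1
  | s, N + 1, f => ∑ B, bl (s + 1) B * ev (s + 1) N fun L => f (B :: L)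

lemma ev_of_zero (s N : ℕ) (f : List (Fin 5) → ℝ) (h : ∀ L, L.length = N → f L = 0) :
    ev s N f = 0 := by
  induction N generalizing s f with
  | zero => rw [ev, h [] rfl, zero_smul]
  | succ N ih =>
    rw [ev]
    refine Finset.sum_eq_zero fun B _ => ?_
    rw [ih, mul_zero]
    exact fun L hL => h _ (by simp [hL])

lemma th_ev {θ : Fk →ₐ[ℝ] Fk} (hθ : ∀ c n, θ (ge c (n + 1)) = ge c n) (s N : ℕ)
    (f : List (Fin 5) → ℝ) : θ (ev (s + 1) N f) = ev s N f := by
  induction N generalizing s f with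
  | zero => simp [ev]
  | succ N ih =>
    rw [ev, ev, map_sum]
    refine Finset.sum_congr rfl fun B _ => ?_
    rw [map_mul, ih]
    congr 1
    fin_cases B <;> simp [bl, hθ]

lemma th_ev_zero {θ : Fk →ₐ[ℝ] Fk} (hθ : ∀ c n, θ (ge c (n + 1)) = ge c n) (N : ℕ)
    (f : List (Fin 5) → ℝ) : θ (ev 0 (N + 1) f) = ev 0 N fun L => f (0 :: L) := by
  rw [ev, map_sum, Fin.sum_univ_five]
  simp [bl, hθ, ge_zero, th_ev hθ]

/-- which block may follow in a given state -/
def alw (st : Fin 3) (B : Fin 5) : Bool :=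
  (st == 0) || (B == 0) || (st == 1 && (B == 2 || B == 3))

/-- the state after a block -/
def nxt (B : Fin 5) : Fin 3 := ![0, 1, 1, 2, 2] B

/-- valid lists of blocks -/
def vld : Fin 3 → List (Fin 5) → Bool
  | _, [] => true
  | st, B :: L => alw st B && vld (nxt B) L

/-- functions supported on valid lists -/
def Sup (st : Fin 3) (f : List (Fin 5) → ℝ) : Prop := ∀ L, vld st L = false → f L = 0

lemma Sup.cons {st : Fin 3} {f : List (Fin 5) → ℝ} (h : Sup st f) (B : Fin 5) :
    Sup (nxt B) fun L => f (B :: L) := fun L hL => h _ (by simp [vld, hL])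

lemma Sup.zero {st : Fin 3} {f : List (Fin 5) → ℝ} (h : Sup st f) {B : Fin 5}
    (hB : alw st B = false) (L : List (Fin 5)) : f (B :: L) = 0 := h _ (by simp [vld, hB])

/-- vanishing on lists of given length -/
def Van (N : ℕ) (f : List (Fin 5) → ℝ) : Prop := ∀ L, L.length = N → f L = 0

lemma van_succ {N : ℕ} {f : List (Fin 5) → ℝ} (h : ∀ B, Van N fun L => f (B :: L)) :
    Van (N + 1) f := by
  intro L hL
  obtain ⟨B, L, rfl⟩ := List.exists_cons_of_length_eq_add_one hL
  exact h B L (by simpa using hL)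

lemma van_zero {f : List (Fin 5) → ℝ} (h : f [] = 0) : Van 0 f := by
  intro L hL
  rw [List.length_eq_zero_iff.1 hL, h]

lemma ge_one : ge 0 1 = cr (0, 0) * cr (3, 0) ∧
    ge 1 1 = cr (0, 0) * cr (2, 0) - cr (1, 0) * cr (3, 0) ∧ ge 2 1 = cr (1, 0) * cr (2, 0) := by
  simp [ge, qd]

lemma cr_zero_ne_zero (s : Fin 4) {r : ℝ} (h : cr (s, 0) * (r • (1 : Fk)) = 0) : r = 0 := by
  have := congrArg (fun x => vev (an (s, 0) x)) h
  simpa only [an_cr, an_one, vev_one, if_true, map_smul, smul_eq_mul, mul_one, mul_zero, smul_zero,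
    sub_zero, map_zero] using this

set_option linter.unusedSimpArgs false in
/-- The three independence statements, proved simultaneously. -/
lemma grassmann_indep (N : ℕ) :
    (∀ f, Sup 0 f → ev 0 N f = 0 → Van N f) ∧
    (∀ f, Sup 1 f → (cr (3, 0) * ev 0 N f = 0 ∨ cr (0, 0) * ev 0 N f = 0) → Van N f) ∧
    (∀ f, Sup 2 f → (thC (ev 0 N f) = 0 ∨ thA (ev 0 N f) = 0) → Van N f) := by
  have b10 (x) := cr_cr_mul (1, 0) (0, 0) x
  have b20 (x) := cr_cr_mul (2, 0) (0, 0) x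
  have b30 (x) := cr_cr_mul (3, 0) (0, 0) x
  have b21 (x) := cr_cr_mul (2, 0) (1, 0) x
  have b31 (x) := cr_cr_mul (3, 0) (1, 0) x
  have b32 (x) := cr_cr_mul (3, 0) (2, 0) x
  obtain ⟨g0, g1, g2⟩ := ge_one
  induction N with
  | zero =>
    refine ⟨fun f _ h => van_zero ?_, fun f _ h => van_zero ?_, fun f _ h => van_zero ?_⟩
    · simpa [ev, vev_one] using congrArg vev h
    · rcases h with h | h
      · exact cr_zero_ne_zero _ h
      · exact cr_zero_ne_zero _ h
    · simp only [ev, map_smul, map_one, or_self] at h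
      simpa [vev_one] using congrArg vev h
  | succ N ih =>
    obtain ⟨hO, hX, hC⟩ := ih
    have hA (f) : thA (ev 1 N f) = ev 0 N f := th_ev thA_ge 0 N f
    have hB (f) : thC (ev 1 N f) = ev 0 N f := th_ev thC_ge 0 N f
    have tA2 : thA (cr (2, 0)) = cr (2, 0) := shf_of_notMem (by decide) _
    have tA3 : thA (cr (3, 0)) = cr (3, 0) := shf_of_notMem (by decide) _
    have tC0 : thC (cr (0, 0)) = cr (0, 0) := shf_of_notMem (by decide) _
    have tC1 : thC (cr (1, 0)) = cr (1, 0) := shf_of_notMem (by decide) _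
    refine ⟨fun f hf h => ?_, fun f hf h => ?_, fun f hf h => ?_⟩
    · have v0 : Van N fun L => f (0 :: L) := hO _ (hf.cons 0) (by
        rw [← th_ev_zero thA_ge, h, map_zero])
      have e0 := ev_of_zero 1 N _ v0
      rw [ev, Fin.sum_univ_five] at h
      simp only [zero_add, e0, mul_zero, bl, Matrix.cons_val, g0, g1, g2, mul_assoc, sub_mul] at h
      set Y1 := ev 1 N fun L => f (1 :: L) with hY1
      set Y2 := ev 1 N fun L => f (2 :: L) with hY2
      set Y3 := ev 1 N fun L => f (3 :: L) with hY3
      set Y4 := ev 1 N fun L => f (4 :: L) with hY4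
      have r1 := thA_eq_zero (z := cr (3, 0) * Y1 + cr (2, 0) * Y2) (by
        have := congrArg (cr (1, 0) * ·) h
        simp only [mul_add, mul_sub, mul_neg, b10, b20, b30, b21, b31, b32, cr_sq_mul, mul_zero, neg_zero] at this ⊢
        rw [← neg_eq_zero, ← this]
        abel)
      have r2 := thA_eq_zero (z := cr (2, 0) * Y3 - cr (3, 0) * Y2) (by
        have := congrArg (cr (0, 0) * ·) h
        simp only [mul_add, mul_sub, mul_neg, b10, b20, b30, b21, b31, b32, cr_sq_mul, mul_zero, neg_zero] at this ⊢
        rw [← this]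
        abel)
      rw [map_add, map_mul, map_mul, tA2, tA3, hY1, hY2, hA, hA] at r1
      rw [map_sub, map_mul, map_mul, tA2, tA3, hY3, hY2, hA, hA] at r2
      have v3 : Van N fun L => f (3 :: L) := hC _ (hf.cons 3) (Or.inl (thC_eq_zero (by
        have := congrArg (cr (3, 0) * ·) r2
        simp only [mul_add, mul_sub, mul_neg, b10, b20, b30, b21, b31, b32, cr_sq_mul, mul_zero, neg_zero] at this
        rw [← neg_eq_zero, ← this]
        abel)))
      rw [ev_of_zero 0 N _ v3, mul_zero, zero_sub, neg_eq_zero] at r2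
      have v2 : Van N fun L => f (2 :: L) := hX _ (hf.cons 2) (Or.inl r2)
      rw [ev_of_zero 0 N _ v2, mul_zero, add_zero] at r1
      have v1 : Van N fun L => f (1 :: L) := hX _ (hf.cons 1) (Or.inl r1)
      rw [hY1, hY2, hY3, ev_of_zero 1 N _ v1, ev_of_zero 1 N _ v2, ev_of_zero 1 N _ v3] at h
      have r4 := thA_eq_zero (z := cr (2, 0) * (cr (3, 0) * Y4)) (by
        simp only [mul_add, mul_sub, mul_neg, b10, b20, b30, b21, b31, b32, cr_sq_mul, mul_zero, neg_zero, sub_zero, zero_add, neg_neg] at h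
        exact h)
      rw [map_mul, map_mul, tA2, tA3, hY4, hA] at r4
      have v4 : Van N fun L => f (4 :: L) := hC _ (hf.cons 4) (Or.inl (thC_eq_zero r4))
      refine van_succ fun B => ?_
      fin_cases B
      exacts [v0, v1, v2, v3, v4]
    · have v1 : Van N fun L => f (1 :: L) := fun L _ => hf.zero (by decide) L
      have v4 : Van N fun L => f (4 :: L) := fun L _ => hf.zero (by decide) L
      rw [ev, Fin.sum_univ_five] at h
      simp only [zero_add, ev_of_zero 1 N _ v1, ev_of_zero 1 N _ v4, mul_zero, bl, Matrix.cons_val,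
        g0, g1, g2, mul_assoc, sub_mul, one_mul, add_zero] at h
      set Y0 := ev 1 N fun L => f (0 :: L) with hY0
      set Y2 := ev 1 N fun L => f (2 :: L) with hY2
      set Y3 := ev 1 N fun L => f (3 :: L) with hY3
      have v0 : Van N fun L => f (0 :: L) := by
        refine hO _ (hf.cons 0) ?_
        rcases h with h | h
        · rw [← hB]
          refine thC_eq_zero ?_
          have := congrArg (cr (2, 0) * ·) h
          simp only [mul_add, mul_sub, mul_neg, b10, b20, b30, b21, b31, b32, cr_sq_mul, mul_zero, neg_zero, neg_neg] at this
          rw [← this]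
          abel
        · rw [← hA]
          refine thA_eq_zero ?_
          have := congrArg (cr (1, 0) * ·) h
          simp only [mul_add, mul_sub, mul_neg, b10, b20, b30, b21, b31, b32, cr_sq_mul, mul_zero, neg_zero, neg_neg] at this
          rw [← neg_eq_zero, ← this]
          abel
      rw [hY0, ev_of_zero 1 N _ v0, zero_add] at h
      have v23 : (Van N fun L => f (3 :: L)) ∧ Van N fun L => f (2 :: L) := by
        rcases h with h | h
        · have r1 := thC_eq_zero (z := cr (0, 0) * Y2 + cr (1, 0) * Y3) (by
            simp only [mul_add, mul_sub, mul_neg, b10, b20, b30, b21, b31, b32, cr_sq_mul, mul_zero, neg_zero, neg_neg] at h ⊢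
            rw [← h]
            abel)
          rw [map_add, map_mul, map_mul, tC0, tC1, hY2, hY3, hB, hB] at r1
          have v3 : Van N fun L => f (3 :: L) := hC _ (hf.cons 3) (Or.inr (thA_eq_zero (by
            have := congrArg (cr (0, 0) * ·) r1
            simp only [mul_add, mul_sub, mul_neg, b10, b20, b30, b21, b31, b32, cr_sq_mul, mul_zero, neg_zero] at this
            rw [← this]
            abel)))
          rw [ev_of_zero 0 N _ v3, mul_zero, add_zero] at r1
          exact ⟨v3, hX _ (hf.cons 2) (Or.inr r1)⟩
        · have r1 := thA_eq_zero (z := cr (2, 0) * Y3 - cr (3, 0) * Y2) (by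
            simp only [mul_add, mul_sub, mul_neg, b10, b20, b30, b21, b31, b32, cr_sq_mul, mul_zero, neg_zero, neg_neg] at h ⊢
            rw [← h]
            abel)
          rw [map_sub, map_mul, map_mul, tA2, tA3, hY2, hY3, hA, hA] at r1
          have v3 : Van N fun L => f (3 :: L) := hC _ (hf.cons 3) (Or.inl (thC_eq_zero (by
            have := congrArg (cr (3, 0) * ·) r1
            simp only [mul_add, mul_sub, mul_neg, b10, b20, b30, b21, b31, b32, cr_sq_mul, mul_zero, neg_zero] at this
            rw [← neg_eq_zero, ← this]
            abel)))
          rw [ev_of_zero 0 N _ v3, mul_zero, zero_sub, neg_eq_zero] at r1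
          exact ⟨v3, hX _ (hf.cons 2) (Or.inl r1)⟩
      refine van_succ fun B => ?_
      fin_cases B
      exacts [v0, v1, v23.2, v23.1, v4]
    · have v0 : Van N fun L => f (0 :: L) := hO _ (hf.cons 0) (by
        rcases h with h | h
        · rw [← th_ev_zero thC_ge, h]
        · rw [← th_ev_zero thA_ge, h])
      refine van_succ fun B => ?_
      by_cases hB : B = 0
      · rw [hB]; exact v0
      · exact fun L _ => hf.zero (by revert hB; revert B; decide) L


/-- leading terms of the letters in the center of the Grassmann algebra -/
noncomputable def ez (p : ℤ) : Subalgebra.center ℝ Fk :=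
  ⟨if p % 3 = 0 then ge 0 (p / 3).toNat else
    if p % 3 = 1 then ge 1 (p / 3).toNat else ge 2 (p / 3).toNat, by
    split_ifs <;> exact ge_central _ _⟩

lemma cur_vac_qd (s t : Fin 4) {p : ℤ} (hp : 0 ≤ p) :
    cur s t (-(p / 3)) 1 = qd s t (p / 3).toNat := by
  have e : p / 3 = ((p / 3).toNat : ℤ) := by omega
  rw [e, cur_vac, Int.toNat_natCast, qd]
  refine Finset.sum_congr rfl fun i _ => ?_
  rw [← cr_eq_fm (s, i), ← cr_eq_fm (t, _), mul_one]

lemma fX_vac {p : ℤ} (hp : 0 ≤ p) : fX p 1 = ez p := by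
  rw [fX, ez]
  split_ifs
  · rw [cur_vac_qd _ _ hp]; rfl
  · rw [LinearMap.sub_apply, cur_vac_qd _ _ hp, cur_vac_qd _ _ hp]; rfl
  · rw [cur_vac_qd _ _ hp]; rfl

/-- the graded components of the Grassmann algebra -/
noncomputable def gr (n : ℕ) : Submodule ℝ Fk :=
  LinearMap.range (ExteriorAlgebra.ι ℝ : FW →ₗ[ℝ] Fk) ^ n

lemma cr_mem (i : Fin 4 × ℕ) : cr i ∈ gr 1 := by
  rw [gr, pow_one]
  exact LinearMap.mem_range_self _ _

lemma ext_induction {P : ℕ → Fk → Prop} (h1 : P 0 1) (hs : ∀ n (r : ℝ) x, P n x → P n (r • x))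
    (ha : ∀ n x y, P n x → P n y → P n (x + y)) (hc : ∀ n i x, x ∈ gr n → P n x → P (n + 1) (cr i * x))
    (n : ℕ) (x : Fk) (hx : x ∈ gr n) : P n x := by
  have h0 : ∀ n, P n 0 := fun n => by
    induction n with
    | zero => simpa using hs 0 0 1 h1
    | succ n ih => simpa using hc n (0, 0) 0 (zero_mem _) ih
  induction n generalizing x with
  | zero =>
    rw [gr, pow_zero, Submodule.mem_one] at hx
    obtain ⟨r, rfl⟩ := hx
    rw [Algebra.algebraMap_eq_smul_one]
    exact hs 0 r 1 h1
  | succ n ih =>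
    rw [gr, pow_succ'] at hx
    induction hx using Submodule.mul_induction_on' with
    | mem_mul_mem w hw y hy =>
      obtain ⟨w, rfl⟩ := hw
      have hP := ih y hy
      induction w using Finsupp.induction_linear with
      | zero => rw [map_zero, zero_mul]; exact h0 _
      | add f g hf hg => rw [map_add, add_mul]; exact ha _ _ _ hf hg
      | single i r =>
        rw [show Finsupp.single i r = r • (Finsupp.single i 1 : FW) by simp, map_smul,
          smul_mul_assoc]
        exact hs _ _ _ (hc _ _ _ hy hP)
    | add x _ y _ hx hy => exact ha _ _ _ hx hy

lemma ext_mul {m n : ℕ} {x y : Fk} (hx : x ∈ gr m) (hy : y ∈ gr n) :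
    x * y ∈ gr (m + n) := by
  rw [gr, pow_add]
  exact Submodule.mul_mem_mul hx hy

lemma qd_mem (s t : Fin 4) (n : ℕ) : qd s t n ∈ gr 2 :=
  Submodule.sum_mem _ fun _ _ => ext_mul (cr_mem _) (cr_mem _)

lemma ez_mem (p : ℤ) : (ez p : Fk) ∈ gr 2 := by
  rw [ez]
  dsimp only
  split_ifs
  · exact qd_mem _ _ _
  · exact sub_mem (qd_mem _ _ _) (qd_mem _ _ _)
  · exact qd_mem _ _ _

lemma fX_sub_mem {p : ℤ} (hp : 3 ≤ p) (n : ℕ) (x : Fk) (hx : x ∈ gr n) :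
    fX p x - ez p * x ∈ gr n := by
  refine ext_induction (P := fun n x => fX p x - ez p * x ∈ gr n) ?_ ?_ ?_ ?_ n x hx
  · rw [fX_vac (by omega), mul_one, sub_self]
    exact zero_mem _
  · intro n r x h
    rw [map_smul, mul_smul_comm, ← smul_sub]
    exact Submodule.smul_mem _ _ h
  · intro n x y h h'
    rw [map_add, mul_add, add_sub_add_comm]
    exact add_mem h h'
  · intro n i x hx h
    have hz := Subalgebra.mem_center_iff.1 (ez p).2 (cr i)
    rw [cr_eq_fm i x, fX_fm, ← cr_eq_fm, ← cr_eq_fm, ← mul_assoc, ← hz, mul_assoc,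
      add_sub_right_comm, ← mul_sub, fm_neg (by omega), add_comm n 1]
    exact add_mem (ext_mul (cr_mem _) h) (Submodule.smul_mem _ _ (ext_mul (cr_mem _) hx))

/-- the components of degree less than `n` -/
noncomputable def grLt (n : ℕ) : Submodule ℝ Fk := ⨆ m, ⨆ (_ : m < n), gr m

lemma gr_le_grLt {m n : ℕ} (h : m < n) : gr m ≤ grLt n := le_iSup₂_of_le m h le_rfl

lemma grLt_map {T : Module.End ℝ Fk} {k : ℕ} (hT : ∀ m x, x ∈ gr m → T x ∈ gr (m + k)) {n : ℕ}
    {x : Fk} (hx : x ∈ grLt n) : T x ∈ grLt (n + k) := by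
  have : grLt n ≤ (grLt (n + k)).comap T :=
    iSup₂_le fun m hm y hy => gr_le_grLt (by omega) (hT m y hy)
  exact this hx

lemma grLt_mono {m n : ℕ} (h : m ≤ n) : grLt m ≤ grLt n :=
  iSup₂_le fun _ hi => gr_le_grLt (by omega)

lemma wd_lead (u : List ℤ) (hu : ∀ p ∈ u, 3 ≤ p) :
    (((u.map ez).prod : Subalgebra.center ℝ Fk) : Fk) ∈ gr (2 * u.length) ∧
    fockRep.wd u 1 - ((u.map ez).prod : Subalgebra.center ℝ Fk) ∈ grLt (2 * u.length) := by
  induction u with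
  | nil => simp [VRep.wd_nil, gr]
  | cons p u ih =>
    obtain ⟨h1, h2⟩ := ih fun q hq => hu q (List.mem_cons_of_mem _ hq)
    have hp := hu p List.mem_cons_self
    rw [List.map_cons, List.prod_cons, VRep.wd_cons, List.length_cons, Subalgebra.coe_mul,
      Module.End.mul_apply, mul_add, mul_one]
    set y : Fk := (((u.map ez).prod : Subalgebra.center ℝ Fk) : Fk)
    set z := fockRep.wd u 1
    refine ⟨add_comm 2 (2 * u.length) ▸ ext_mul (ez_mem p) h1, ?_⟩
    have e : fockRep.X p z - ez p * y = (fX p y - ez p * y) +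
        ((fX p (z - y) - ez p * (z - y)) + ez p * (z - y)) := by
      rw [map_sub, mul_sub]
      change fX p z - _ = _
      abel
    rw [e]
    refine add_mem (gr_le_grLt (by omega) (fX_sub_mem hp _ _ h1)) (add_mem
      (grLt_mono (by omega) (grLt_map (k := 0) (T := fX p - LinearMap.mulLeft ℝ (ez p : Fk))
        (fun m x hx => fX_sub_mem hp m x hx) h2))
      (grLt_map (T := LinearMap.mulLeft ℝ (ez p : Fk)) (fun m x hx => ?_) h2))
    rw [add_comm m 2]
    exact ext_mul (ez_mem p) hx

lemma mon_lead {σ : Multiset ℤ} (h : Neg σ) :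
    (((σ.map ez).prod : Subalgebra.center ℝ Fk) : Fk) ∈ gr (2 * σ.card) ∧
    fockRep.mon σ - ((σ.map ez).prod : Subalgebra.center ℝ Fk) ∈ grLt (2 * σ.card) := by
  have := wd_lead (σ.sort (· ≥ ·)) fun p hp => h p ((Multiset.mem_sort _).1 hp)
  rwa [Multiset.length_sort, ← Multiset.prod_coe, ← Multiset.map_coe, Multiset.sort_eq] at this

/-- projection on a component -/
noncomputable def prj (n : ℕ) : Fk →ₗ[ℝ] Fk :=
  GradedAlgebra.proj (fun i => ⋀[ℝ]^i FW) n

lemma prj_same {n : ℕ} {x : Fk} (h : x ∈ gr n) : prj n x = x :=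
  DirectSum.decompose_of_mem_same (fun i => ⋀[ℝ]^i FW) h

lemma prj_ne {m n : ℕ} {x : Fk} (h : x ∈ gr m) (hmn : m ≠ n) : prj n x = 0 :=
  DirectSum.decompose_of_mem_ne (fun i => ⋀[ℝ]^i FW) h hmn

lemma prj_lt {n : ℕ} {x : Fk} (h : x ∈ grLt n) {m : ℕ} (hm : n ≤ m) : prj m x = 0 := by
  have : grLt n ≤ LinearMap.ker (prj m) := iSup₂_le fun i hi y hy => prj_ne hy (by omega)
  exact this h

lemma prj_mon {σ : Multiset ℤ} (h : Neg σ) {n : ℕ} (hn : σ.card ≤ n) :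
    prj (2 * n) (fockRep.mon σ) =
      if σ.card = n then (((σ.map ez).prod : Subalgebra.center ℝ Fk) : Fk) else 0 := by
  obtain ⟨h1, h2⟩ := mon_lead h
  have h3 := prj_lt h2 (show 2 * σ.card ≤ 2 * n by omega)
  rw [map_sub, sub_eq_zero] at h3
  rw [h3]
  split_ifs with h4
  · rw [prj_same (h4 ▸ h1)]
  · exact prj_ne h1 (by omega)

/-- independence of monomials follows from independence of the leading terms -/
lemma fock_indep_of_lead {A : Set (Multiset ℤ)} (hA : ∀ σ ∈ A, Neg σ)
    (h : LinearIndependent ℝ fun σ : A =>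
      (((σ.1.map ez).prod : Subalgebra.center ℝ Fk) : Fk)) :
    LinearIndependent ℝ fun σ : A => fockRep.mon σ.1 := by
  rw [linearIndependent_iff'] at h ⊢
  intro s g hg
  by_contra! hc
  obtain ⟨i, hi, hgi⟩ := hc
  obtain ⟨j, hj, hmax⟩ := Finset.exists_max_image (s.filter fun σ => g σ ≠ 0)
    (fun σ => σ.1.card) ⟨i, Finset.mem_filter.2 ⟨hi, hgi⟩⟩
  rw [Finset.mem_filter] at hj
  refine hj.2 (h (s.filter fun σ => g σ ≠ 0 ∧ σ.1.card = j.1.card) g ?_ j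
    (Finset.mem_filter.2 ⟨hj.1, hj.2, rfl⟩))
  have := congrArg (prj (2 * j.1.card)) hg
  rw [map_sum, map_zero] at this
  rw [Finset.sum_filter]
  refine (Finset.sum_congr rfl fun σ hσ => ?_).trans this
  rw [map_smul]
  by_cases h0 : g σ = 0
  · simp [h0]
  · rw [prj_mon (hA _ σ.2) (hmax σ (Finset.mem_filter.2 ⟨hσ, h0⟩))]
    simp [h0]

/-- the block with given exponents -/
def bk (a b c : ℕ) : Fin 5 :=
  if a = 1 then (if c = 1 then 4 else 1) else if b = 1 then 2 else if c = 1 then 3 else 0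

lemma alw_bk {a b c a' b' c' : ℕ} (h1 : a + b + a' ≤ 1) (h2 : b + c + a' ≤ 1)
    (h3 : c + a' + b' ≤ 1) (h4 : c + b' + c' ≤ 1) : alw (nxt (bk a b c)) (bk a' b' c') = true := by
  have key : ∀ a b c a' b' c' : Fin 2, (a : ℕ) + b + a' ≤ 1 → (b : ℕ) + c + a' ≤ 1 →
      (c : ℕ) + a' + b' ≤ 1 → (c : ℕ) + b' + c' ≤ 1 →
      alw (nxt (bk a b c)) (bk a' b' c') = true := by decide
  exact key ⟨a, by omega⟩ ⟨b, by omega⟩ ⟨c, by omega⟩ ⟨a', by omega⟩ ⟨b', by omega⟩ ⟨c', by omega⟩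
    h1 h2 h3 h4

lemma bk_inj {a b c a' b' c' : ℕ} (h1 : a + b ≤ 1) (h2 : b + c ≤ 1) (h3 : a' + b' ≤ 1)
    (h4 : b' + c' ≤ 1) (h : bk a b c = bk a' b' c') : a = a' ∧ b = b' ∧ c = c' := by
  have key : ∀ a b c a' b' c' : Fin 2, (a : ℕ) + b ≤ 1 → (b : ℕ) + c ≤ 1 →
      (a' : ℕ) + b' ≤ 1 → (b' : ℕ) + c' ≤ 1 → bk a b c = bk a' b' c' →
      (a : ℕ) = a' ∧ (b : ℕ) = b' ∧ (c : ℕ) = c' := by decide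
  exact key ⟨a, by omega⟩ ⟨b, by omega⟩ ⟨c, by omega⟩ ⟨a', by omega⟩ ⟨b', by omega⟩ ⟨c', by omega⟩
    h1 h2 h3 h4 h

/-- blocks in the center -/
noncomputable def blz (s : ℕ) (B : Fin 5) : Subalgebra.center ℝ Fk :=
  ![1, ez (3 * s), ez (3 * s + 1), ez (3 * s + 2), ez (3 * s) * ez (3 * s + 2)] B

lemma ez_block (s : ℕ) : (ez (3 * s) : Fk) = ge 0 s ∧ (ez (3 * s + 1) : Fk) = ge 1 s ∧
    (ez (3 * s + 2) : Fk) = ge 2 s := by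
  refine ⟨?_, ?_, ?_⟩
  · rw [ez]
    dsimp only
    rw [if_pos (by omega), show (3 * (s : ℤ) / 3).toNat = s by omega]
  · rw [ez]
    dsimp only
    rw [if_neg (by omega), if_pos (by omega), show ((3 * (s : ℤ) + 1) / 3).toNat = s by omega]
  · rw [ez]
    dsimp only
    rw [if_neg (by omega), if_neg (by omega), show ((3 * (s : ℤ) + 2) / 3).toNat = s by omega]

lemma blz_coe (s : ℕ) (B : Fin 5) : (blz s B : Fk) = bl s B := by
  obtain ⟨h0, h1, h2⟩ := ez_block s
  fin_cases B <;> simp [blz, bl, h0, h1, h2]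

lemma blz_bk (s : ℕ) {a b c : ℕ} (h1 : a + b ≤ 1) (h2 : b + c ≤ 1) :
    ez (3 * s) ^ a * ez (3 * s + 1) ^ b * ez (3 * s + 2) ^ c = blz s (bk a b c) := by
  have ha : a = 0 ∨ a = 1 := by omega
  have hb : b = 0 ∨ b = 1 := by omega
  have hc : c = 0 ∨ c = 1 := by omega
  rcases ha with rfl | rfl <;> rcases hb with rfl | rfl <;> rcases hc with rfl | rfl <;>
    first | omega | simp [blz, bk]

/-- the block of a multiset of letters -/
def blk (σ : Multiset ℤ) (j : ℕ) : Fin 5 :=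
  bk (σ.count (3 * (j : ℤ))) (σ.count (3 * (j : ℤ) + 1)) (σ.count (3 * (j : ℤ) + 2))

lemma Adm.alw_blk {σ : Multiset ℤ} (h : Adm 1 σ) (j : ℕ) :
    alw (nxt (blk σ j)) (blk σ (j + 1)) = true := by
  obtain ⟨h1, h2, h3, h4⟩ := h.2 j
  rw [blk, blk]
  push_cast
  rw [show (3 * ((j : ℤ) + 1) + 1) = 3 * j + 4 by ring, show (3 * ((j : ℤ) + 1) + 2) = 3 * j + 5 by
    ring, show (3 * ((j : ℤ) + 1)) = 3 * j + 3 by ring]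
  exact alw_bk h1 h2 h3 h4

lemma Adm.blk_zero {σ : Multiset ℤ} (h : Adm 1 σ) : blk σ 0 = 0 := by
  have h0 : ∀ p < 3, σ.count p = 0 := fun p hp =>
    Multiset.count_eq_zero.2 fun hm => by have := h.1 p hm; omega
  rw [blk, h0 _ (by simp), h0 _ (by simp), h0 _ (by simp)]
  rfl

lemma Adm.vld {σ : Multiset ℤ} (h : Adm 1 σ) (s N : ℕ) :
    vld (nxt (blk σ s)) ((List.range N).map fun i => blk σ (s + 1 + i)) = true := by
  induction N generalizing s with
  | zero => rfl
  | succ N ih =>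
    rw [List.range_succ_eq_map, List.map_cons, List.map_map, SL2Vac.vld, Nat.add_zero, h.alw_blk,
      Bool.true_and, ← ih (s + 1)]
    congr 1
    refine List.map_congr_left fun i _ => ?_
    rw [Function.comp_apply, show s + 1 + i.succ = s + 1 + 1 + i by omega]

lemma ev_sum {ι : Type*} (S : Finset ι) (s N : ℕ) (F : ι → List (Fin 5) → ℝ) :
    ev s N (fun L => ∑ i ∈ S, F i L) = ∑ i ∈ S, ev s N (F i) := by
  induction N generalizing s F with
  | zero => rw [ev, Finset.sum_smul]; rfl
  | succ N ih =>
    simp only [ev, ih, Finset.mul_sum]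
    exact Finset.sum_comm

lemma ev_delta (s N : ℕ) (g : ℕ → Fin 5) (r : ℝ) :
    ev s N (fun L => if (List.range N).map g = L then r else 0) =
      r • ((∏ i ∈ Finset.range N, blz (s + 1 + i) (g i) : Subalgebra.center ℝ Fk) : Fk) := by
  induction N generalizing s g with
  | zero => simp [ev]
  | succ N ih =>
    rw [ev, Finset.sum_eq_single (g 0), Finset.prod_range_succ', mul_comm, Subalgebra.coe_mul,
      ← mul_smul_comm, blz_coe]
    · congr 1
      have := ih (s + 1) (g ∘ Nat.succ)
      rw [List.range_succ_eq_map, List.map_cons, List.map_map]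
      simp only [List.cons.injEq, true_and]
      rw [this]
      congr 2
      refine Finset.prod_congr rfl fun i _ => ?_
      rw [Function.comp_apply, show s + 1 + 1 + i = s + 1 + (i + 1) by omega]
    · intro B _ hB
      rw [ev_of_zero, mul_zero]
      intro L _
      rw [if_neg]
      rw [List.range_succ_eq_map, List.map_cons, List.cons.injEq]
      exact fun h => hB h.1.symm
    · intro h
      exact absurd (Finset.mem_univ _) h

lemma Adm.prod_ez {σ : Multiset ℤ} (h : Adm 1 σ) {N : ℕ} (hN : ∀ p ∈ σ, p < 3 * (N + 1)) :
    (σ.map ez).prod = ∏ i ∈ Finset.range N, blz (0 + 1 + i) (blk σ (0 + 1 + i)) := by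
  rw [Finset.prod_multiset_map_count, Finset.prod_subset
    (s₂ := (Finset.range N ×ˢ Finset.range 3).image fun q : ℕ × ℕ =>
      3 * ((0 + 1 + q.1 : ℕ) : ℤ) + q.2),
    Finset.prod_image, Finset.prod_product]
  · refine Finset.prod_congr rfl fun i _ => ?_
    obtain ⟨h1, h2, h3, h4⟩ := h.2 (0 + 1 + i : ℕ)
    rw [Finset.prod_range_succ, Finset.prod_range_succ, Finset.prod_range_one, blk, ← blz_bk]
    · simp
    · omega
    · omega
  · rintro ⟨i, c⟩ hq ⟨i', c'⟩ hq' hqq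
    simp only [Finset.coe_product, Set.mem_prod, Finset.mem_coe, Finset.mem_range] at hq hq'
    simp only at hqq
    push_cast at hqq
    ext <;> dsimp only <;> omega
  · intro p hp
    rw [Multiset.mem_toFinset] at hp
    have h1 := h.1 p hp
    have h2 := hN p hp
    simp only [Finset.mem_image, Finset.mem_product, Finset.mem_range]
    refine ⟨(((p / 3).toNat - 1), (p % 3).toNat), ⟨by omega, by omega⟩, ?_⟩
    dsimp only
    omega
  · intro p _ hp
    rw [Multiset.mem_toFinset, ← Multiset.count_eq_zero] at hp
    rw [hp, pow_zero]

lemma Adm.ext_blk {σ σ' : Multiset ℤ} (h : Adm 1 σ) (h' : Adm 1 σ') {N : ℕ}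
    (hN : ∀ p ∈ σ, p < 3 * (N + 1)) (hN' : ∀ p ∈ σ', p < 3 * (N + 1))
    (he : ∀ i < N, blk σ (0 + 1 + i) = blk σ' (0 + 1 + i)) : σ = σ' := by
  refine Multiset.ext.2 fun p => ?_
  by_cases hp : 3 ≤ p ∧ p < 3 * (N + 1)
  · have e := he ((p / 3).toNat - 1) (by omega)
    have ep : ((0 + 1 + ((p / 3).toNat - 1) : ℕ) : ℤ) = p / 3 := by omega
    have h1 := h.2 (p / 3)
    have h2 := h'.2 (p / 3)
    rw [blk, blk, ep] at e
    obtain ⟨e1, e2, e3⟩ := bk_inj (by omega) (by omega) (by omega) (by omega) e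
    have : p = 3 * (p / 3) ∨ p = 3 * (p / 3) + 1 ∨ p = 3 * (p / 3) + 2 := by omega
    rcases this with h3 | h3 | h3 <;> rw [h3] <;> assumption
  · rw [Multiset.count_eq_zero.2 fun hm => hp ⟨h.1 p hm, hN p hm⟩,
      Multiset.count_eq_zero.2 fun hm => hp ⟨h'.1 p hm, hN' p hm⟩]

lemma lead_indep : LinearIndependent ℝ fun σ : {σ | Adm 1 σ} =>
    (((σ.1.map ez).prod : Subalgebra.center ℝ Fk) : Fk) := by
  rw [linearIndependent_iff']
  intro s g hg τ hτ
  obtain ⟨N, hN⟩ : ∃ N : ℕ, ∀ σ ∈ s, ∀ p ∈ σ.1, p < 3 * ((N : ℤ) + 1) := by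
    refine ⟨s.sup fun σ => (σ.1.map Int.toNat).sum, fun σ hσ p hp => ?_⟩
    have h1 := Finset.le_sup (f := fun σ : {σ | Adm 1 σ} => (σ.1.map Int.toNat).sum) hσ
    have h2 := Multiset.le_sum_of_mem (Multiset.mem_map_of_mem Int.toNat hp)
    omega
  have key := (grassmann_indep N).1 (fun L => ∑ σ ∈ s,
    if (List.range N).map (fun i => blk σ.1 (0 + 1 + i)) = L then g σ else 0) ?_ ?_
  · have := key ((List.range N).map fun i => blk τ.1 (0 + 1 + i)) (by simp)
    beta_reduce at this
    rw [Finset.sum_eq_single τ, if_pos rfl] at this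
    · exact this
    · intro σ hσ hne
      rw [if_neg]
      intro he
      refine hne (Subtype.ext (σ.2.ext_blk τ.2 (hN σ hσ) (hN τ hτ) fun i hi => ?_))
      exact List.map_inj_left.1 he i (List.mem_range.2 hi)
    · exact fun h => absurd hτ h
  · intro L hL
    refine Finset.sum_eq_zero fun σ _ => if_neg fun he => ?_
    have := σ.2.vld 0 N
    rw [he, σ.2.blk_zero] at this
    exact absurd (this.symm.trans hL) (by simp)
  · rw [ev_sum, ← hg]
    refine Finset.sum_congr rfl fun σ hσ => ?_
    rw [ev_delta, σ.2.prod_ez (hN σ hσ)]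

/-- independence of the admissible monomials in the Fock space -/
lemma fock_indep : LinearIndependent ℝ fun σ : {σ | Adm 1 σ} => fockRep.mon σ.1 :=
  fock_indep_of_lead (fun _ h => h.1) lead_indep


open scoped TensorProduct

/-- all ways of distributing the letters of a word over two words -/
def splits : List ℤ → List (List ℤ × List ℤ)
  | [] => [([], [])]
  | p :: u => (splits u).map (fun x => (p :: x.1, x.2)) ++ (splits u).map fun x => (x.1, p :: x.2)

lemma splits_spec {u : List ℤ} {x : List ℤ × List ℤ} (hx : x ∈ splits u) :
    x.1.Sublist u ∧ x.2.Sublist u ∧ (x.1 : Multiset ℤ) + (x.2 : Multiset ℤ) = (u : Multiset ℤ) := by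
  induction u generalizing x with
  | nil =>
    obtain rfl : x = ([], []) := by simpa [splits] using hx
    simp
  | cons p u ih =>
    simp only [splits, List.mem_append, List.mem_map] at hx
    rcases hx with ⟨y, hy, rfl⟩ | ⟨y, hy, rfl⟩
    · obtain ⟨h1, h2, h3⟩ := ih hy
      refine ⟨h1.cons_cons p, h2.cons p, ?_⟩
      dsimp only
      rw [← Multiset.cons_coe, ← Multiset.cons_coe, Multiset.cons_add, h3]
    · obtain ⟨h1, h2, h3⟩ := ih hy
      refine ⟨h1.cons p, h2.cons_cons p, ?_⟩
      dsimp only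
      rw [← Multiset.cons_coe, ← Multiset.cons_coe, Multiset.add_cons, h3]

lemma exists_split (u : List ℤ) (α β : Multiset ℤ) (h : (u : Multiset ℤ) = α + β) :
    ∃ x ∈ splits u, (x.1 : Multiset ℤ) = α ∧ (x.2 : Multiset ℤ) = β := by
  induction u generalizing α β with
  | nil =>
    have h' : α + β = 0 := h.symm
    obtain ⟨rfl, rfl⟩ : α = 0 ∧ β = 0 := by simpa using h'
    exact ⟨([], []), by simp [splits], rfl, rfl⟩
  | cons p u ih =>
    have hp : p ∈ α + β := by rw [← h]; simp
    simp only [splits, List.mem_append, List.mem_map]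
    rcases Multiset.mem_add.1 hp with hp | hp
    · obtain ⟨γ, rfl⟩ := Multiset.exists_cons_of_mem hp
      rw [← Multiset.cons_coe, Multiset.cons_add, Multiset.cons_inj_right] at h
      obtain ⟨x, hx, h1, h2⟩ := ih _ _ h
      exact ⟨_, Or.inl ⟨x, hx, rfl⟩, by rw [← Multiset.cons_coe, h1], h2⟩
    · obtain ⟨γ, rfl⟩ := Multiset.exists_cons_of_mem hp
      rw [← Multiset.cons_coe, Multiset.add_cons, Multiset.cons_inj_right] at h
      obtain ⟨x, hx, h1, h2⟩ := ih _ _ h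
      exact ⟨_, Or.inr ⟨x, hx, rfl⟩, h1, by rw [← Multiset.cons_coe, h2]⟩

namespace VRep

section
variable {κ κ₁ κ₂ : ℝ} {V W : Type*} [AddCommGroup V] [Module ℝ V] [AddCommGroup W] [Module ℝ W]
  (R : VRep κ₁ V) (S : VRep κ₂ W)

lemma wd_sorted {u : List ℤ} (h : u.Pairwise (· ≥ ·)) :
    R.wd u R.v = R.mon (u : Multiset ℤ) := by
  rw [mon]
  congr 2
  exact ((Multiset.coe_eq_coe.1 (Multiset.sort_eq (u : Multiset ℤ) (· ≥ ·))).eq_of_pairwise'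
    (Multiset.pairwise_sort _ _) h).symm

/-- the tensor product of two vacuum representations -/
noncomputable def tens (h : κ = κ₁ + κ₂) : VRep κ (V ⊗[ℝ] W) where
  X p := (R.X p).rTensor W + (S.X p).lTensor V
  v := R.v ⊗ₜ S.v
  comm p q := by
    refine TensorProduct.ext' fun x y => ?_
    have h1 := LinearMap.congr_fun (R.comm p q) x
    have h2 := LinearMap.congr_fun (S.comm p q) y
    simp only [LinearMap.sub_apply, Module.End.mul_apply, LinearMap.add_apply,
      LinearMap.smul_apply, Module.End.one_apply] at h1 h2
    simp only [LinearMap.sub_apply, Module.End.mul_apply, LinearMap.add_apply,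
      LinearMap.smul_apply, Module.End.one_apply, LinearMap.rTensor_tmul, LinearMap.lTensor_tmul,
      map_add]
    rw [sub_eq_iff_eq_add] at h1 h2
    rw [h1, h2, h]
    simp only [TensorProduct.add_tmul, TensorProduct.tmul_add, ← TensorProduct.smul_tmul',
      TensorProduct.tmul_smul]
    module
  vac p hp := by simp [R.vac p hp, S.vac p hp]

variable (h : κ = κ₁ + κ₂)

lemma tens_X (p : ℤ) (x : V) (y : W) :
    (R.tens S h).X p (x ⊗ₜ y) = R.X p x ⊗ₜ y + x ⊗ₜ S.X p y := by
  simp [tens]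

lemma tens_v : (R.tens S h).v = R.v ⊗ₜ S.v := rfl

lemma tens_wd (u : List ℤ) (x : V) (y : W) : (R.tens S h).wd u (x ⊗ₜ y) =
    ((splits u).map fun s => R.wd s.1 x ⊗ₜ[ℝ] S.wd s.2 y).sum := by
  induction u with
  | nil => simp [splits]
  | cons p u ih =>
    rw [wd_cons, Module.End.mul_apply, ih, map_list_sum]
    simp only [splits, List.map_append, List.map_map, List.sum_append]
    rw [← List.sum_map_add]
    refine congrArg List.sum (List.map_congr_left fun s _ => ?_)
    simp [tens_X, wd_cons]

lemma tens_functional {π σ : Multiset ℤ} (L : V →ₗ[ℝ] ℝ) (M : W →ₗ[ℝ] ℝ)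
    (h0 : L (R.mon π) ≠ 0)
    (hL : ∀ τ, Neg τ → L (R.mon τ) ≠ 0 → π = τ ∨ Prec π τ)
    (h0' : M (S.mon σ) ≠ 0)
    (hM : ∀ τ, Neg τ → M (S.mon τ) ≠ 0 → σ = τ ∨ Prec σ τ) (hN : Neg (σ + π)) :
    ∃ L' : V ⊗[ℝ] W →ₗ[ℝ] ℝ, L' ((R.tens S h).mon (σ + π)) ≠ 0 ∧
      ∀ τ, Neg τ → L' ((R.tens S h).mon τ) ≠ 0 → σ + π = τ ∨ Prec (σ + π) τ := by
  refine ⟨TensorProduct.lift (LinearMap.mk₂ ℝ (fun x y => L x * M y) (by simp [add_mul])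
    (by simp [mul_assoc]) (by simp [mul_add]) (by simp [mul_left_comm])), ?_⟩
  have key : ∀ τ : Multiset ℤ, TensorProduct.lift (LinearMap.mk₂ ℝ (fun x y => L x * M y)
      (by simp [add_mul]) (by simp [mul_assoc]) (by simp [mul_add]) (by simp [mul_left_comm]))
      ((R.tens S h).mon τ) = ((splits (τ.sort (· ≥ ·))).map fun s =>
        L (R.mon (s.1 : Multiset ℤ)) * M (S.mon (s.2 : Multiset ℤ))).sum := by
    intro τ
    rw [mon, tens_v, tens_wd, map_list_sum, List.map_map]
    congr 1
    refine List.map_congr_left fun s hs => ?_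
    have h1 := splits_spec hs
    rw [← R.wd_sorted ((Multiset.pairwise_sort _ _).sublist h1.1),
      ← S.wd_sorted ((Multiset.pairwise_sort _ _).sublist h1.2.1)]
    simp
  have cmp : ∀ τ, Neg τ → ∀ s ∈ splits (τ.sort (· ≥ ·)),
      L (R.mon (s.1 : Multiset ℤ)) * M (S.mon (s.2 : Multiset ℤ)) ≠ 0 →
      (π = s.1 ∧ σ = s.2 ∧ σ + π = τ) ∨ Prec (σ + π) τ := by
    intro τ hτ s hs hne
    obtain ⟨-, -, h3⟩ := splits_spec hs
    rw [Multiset.sort_eq] at h3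
    subst h3
    have hn1 : Neg (s.1 : Multiset ℤ) := fun p hp => hτ p (Multiset.mem_add.2 (Or.inl hp))
    have hn2 : Neg (s.2 : Multiset ℤ) := fun p hp => hτ p (Multiset.mem_add.2 (Or.inr hp))
    rcases hL _ hn1 (left_ne_zero_of_mul hne) with e1 | e1
    · rcases hM _ hn2 (right_ne_zero_of_mul hne) with e2 | e2
      · exact Or.inl ⟨e1, e2, by rw [e1, e2, add_comm]⟩
      · right
        unfold Prec at e2 ⊢
        rw [e1]
        simp only [Multiset.card_add, omM_add]
        omega
    · right
      have e2 : (s.2 : Multiset ℤ) = σ ∨ Prec σ s.2 := by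
        rcases hM _ hn2 (right_ne_zero_of_mul hne) with e2 | e2
        · exact Or.inl e2.symm
        · exact Or.inr e2
      unfold Prec at e1 e2 ⊢
      simp only [Multiset.card_add, omM_add]
      rcases e2 with e2 | e2
      · rw [e2]
        omega
      · omega
  have irr : ¬ Prec (σ + π) (σ + π) := by
    unfold Prec
    omega
  refine ⟨?_, ?_⟩
  · rw [key]
    obtain ⟨x, hx, hx1, hx2⟩ := exists_split ((σ + π).sort (· ≥ ·)) π σ
      (by rw [Multiset.sort_eq, add_comm])
    intro hz
    have hpos : 0 < ((splits ((σ + π).sort (· ≥ ·))).map fun s =>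
        (L (R.mon (s.1 : Multiset ℤ)) * M (S.mon (s.2 : Multiset ℤ))) *
          (L (R.mon π) * M (S.mon σ))).sum := by
      have hne : L (R.mon π) * M (S.mon σ) ≠ 0 := mul_ne_zero h0 h0'
      refine lt_of_lt_of_le (mul_self_pos.2 hne) (List.single_le_sum ?_ _ ?_)
      · intro y hy
        obtain ⟨s, hs, rfl⟩ := List.mem_map.1 hy
        by_cases hc : L (R.mon (s.1 : Multiset ℤ)) * M (S.mon (s.2 : Multiset ℤ)) = 0
        · rw [hc, zero_mul]
        · rcases cmp _ hN s hs hc with ⟨e1, e2, -⟩ | e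
          · rw [← e1, ← e2]
            exact mul_self_nonneg _
          · exact absurd e irr
      · exact List.mem_map.2 ⟨x, hx, by rw [hx1, hx2]⟩
    rw [List.sum_map_mul_right, hz, zero_mul] at hpos
    exact lt_irrefl _ hpos
  · intro τ hτ hne
    rw [key] at hne
    have : ∃ s ∈ splits (τ.sort (· ≥ ·)),
        L (R.mon (s.1 : Multiset ℤ)) * M (S.mon (s.2 : Multiset ℤ)) ≠ 0 := by
      by_contra hc
      push Not at hc
      refine hne (List.sum_eq_zero fun y hy => ?_)
      obtain ⟨s, hs, rfl⟩ := List.mem_map.1 hy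
      exact hc s hs
    obtain ⟨s, hs, hc⟩ := this
    rcases cmp τ hτ s hs hc with e | e
    · exact Or.inl e.2.2
    · exact Or.inr e

end

end VRep

namespace VRep

section
variable {κ κ₁ κ₂ : ℝ} {V W : Type*} [AddCommGroup V] [Module ℝ V] [AddCommGroup W] [Module ℝ W]
  (R : VRep κ₁ V) (S : VRep κ₂ W) (h : κ = κ₁ + κ₂)

lemma rTensorAlgHom_tmul (f : Module.End ℝ V) (x : V) (y : W) :
    (Module.End.rTensorAlgHom ℝ V W).toRingHom f (x ⊗ₜ y) = f x ⊗ₜ y := rfl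

lemma lTensorAlgHom_tmul (f : Module.End ℝ W) (x : V) (y : W) :
    (Module.End.lTensorAlgHom ℝ W V).toRingHom f (x ⊗ₜ y) = x ⊗ₜ f y := rfl

lemma tens_G (t : ℝ) (D : ℕ) : (R.tens S h).G t D =
    PowerSeries.map (Module.End.rTensorAlgHom ℝ V W).toRingHom (R.G t D) +
      PowerSeries.map (Module.End.lTensorAlgHom ℝ W V).toRingHom (S.G t D) := by
  refine PowerSeries.ext fun m => ?_
  refine TensorProduct.ext' fun x y => ?_
  simp only [G, map_add, PowerSeries.coeff_map, PowerSeries.coeff_mk, Y, LinearMap.sub_apply,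
    LinearMap.smul_apply, LinearMap.add_apply, tens_X, rTensorAlgHom_tmul, lTensorAlgHom_tmul,
    TensorProduct.tmul_sub, TensorProduct.sub_tmul, TensorProduct.tmul_smul,
    ← TensorProduct.smul_tmul']
  module

lemma commute_map_tensor (A : PowerSeries (Module.End ℝ V)) (B : PowerSeries (Module.End ℝ W)) :
    Commute (PowerSeries.map (Module.End.rTensorAlgHom ℝ V W).toRingHom A)
      (PowerSeries.map (Module.End.lTensorAlgHom ℝ W V).toRingHom B) := by
  refine PowerSeries.ext fun m => ?_
  rw [PowerSeries.coeff_mul, PowerSeries.coeff_mul, ← Finset.Nat.sum_antidiagonal_swap]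
  refine Finset.sum_congr rfl fun x _ => ?_
  refine TensorProduct.ext' fun x y => ?_
  simp only [PowerSeries.coeff_map, Module.End.mul_apply, Prod.fst_swap, Prod.snd_swap,
    rTensorAlgHom_tmul, lTensorAlgHom_tmul]

lemma coeff_map_mul_tmul (A : PowerSeries (Module.End ℝ V)) (B : PowerSeries (Module.End ℝ W))
    (m : ℕ) (x : V) (y : W) :
    (PowerSeries.coeff m (PowerSeries.map (Module.End.rTensorAlgHom ℝ V W).toRingHom A *
      PowerSeries.map (Module.End.lTensorAlgHom ℝ W V).toRingHom B) :
        Module.End ℝ (V ⊗[ℝ] W)) (x ⊗ₜ y) =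
    ∑ i ∈ Finset.HasAntidiagonal.antidiagonal m, (PowerSeries.coeff i.1 A) x ⊗ₜ[ℝ] (PowerSeries.coeff i.2 B) y := by
  rw [PowerSeries.coeff_mul, LinearMap.sum_apply]
  refine Finset.sum_congr rfl fun i _ => ?_
  simp only [PowerSeries.coeff_map, Module.End.mul_apply, rTensorAlgHom_tmul, lTensorAlgHom_tmul]

lemma coeff_pow_eq_zero {A : PowerSeries (Module.End ℝ V)} {x : V} {n i : ℕ} (hi : n ≤ i)
    (hA : ∀ m, (PowerSeries.coeff m (A ^ n) : Module.End ℝ V) x = 0) (m : ℕ) :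
    (PowerSeries.coeff m (A ^ i) : Module.End ℝ V) x = 0 := by
  obtain ⟨j, rfl⟩ := Nat.exists_eq_add_of_le' hi
  rw [pow_add, PowerSeries.coeff_mul, LinearMap.sum_apply]
  refine Finset.sum_eq_zero fun i _ => ?_
  rw [Module.End.mul_apply, hA, map_zero]

lemma tens_fieldRel {k l : ℕ} (hR : R.FieldRel k) (hS : S.FieldRel l) :
    (R.tens S h).FieldRel (k + l) := by
  intro w
  induction w with
  | zero => exact ⟨0, by simp⟩
  | add x y hx hy =>
    obtain ⟨D₁, h1⟩ := hx
    obtain ⟨D₂, h2⟩ := hy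
    refine ⟨max D₁ D₂, fun D hD t M => ?_⟩
    rw [map_add, h1 D (le_trans (le_max_left _ _) hD), h2 D (le_trans (le_max_right _ _) hD),
      add_zero]
  | tmul x y =>
    obtain ⟨D₁, h1⟩ := hR x
    obtain ⟨D₂, h2⟩ := hS y
    refine ⟨max D₁ D₂, fun D hD t M => ?_⟩
    rw [tens_G, (commute_map_tensor _ _).add_pow, map_sum, LinearMap.sum_apply]
    refine Finset.sum_eq_zero fun m hm => ?_
    rw [← nsmul_eq_mul', map_nsmul, LinearMap.smul_apply, ← map_pow, ← map_pow,
      coeff_map_mul_tmul, Finset.sum_eq_zero, smul_zero]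
    intro i _
    rw [Finset.mem_range] at hm
    rcases le_or_gt (k + 1) m with hk | hk
    · rw [coeff_pow_eq_zero hk (h1 D (le_trans (le_max_left _ _) hD) t), TensorProduct.zero_tmul]
    · rw [coeff_pow_eq_zero (i := k + l + 1 - m) (n := l + 1) (by omega)
        (h2 D (le_trans (le_max_right _ _) hD) t), TensorProduct.tmul_zero]

end

end VRep

/-- A unitary model of level `k` with functionals separating the admissible monomials. -/
structure VacModel (k : ℕ) where
  V : Type
  [normed : NormedAddCommGroup V]
  [inner : InnerProductSpace ℝ V]
  R : VRep (k : ℝ) V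
  norm_v : Inner.inner ℝ R.v R.v = 1
  adj : ∀ p x y, Inner.inner ℝ (R.X p x) y = Inner.inner ℝ x (R.X (2 - p) y)
  rel : R.FieldRel k
  func : ∀ π, Adm k π → ∃ L : V →ₗ[ℝ] ℝ, L (R.mon π) ≠ 0 ∧
    ∀ τ, Neg τ → L (R.mon τ) ≠ 0 → π = τ ∨ Prec π τ

attribute [instance] VacModel.normed VacModel.inner

/-- the inner product of the Fock space -/
@[reducible] noncomputable def fockCore : InnerProductSpace.Core ℝ Fk where
  inner := fB
  conj_inner_symm x y := by simp [fB_symm x y]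
  re_inner_nonneg x := by simpa using (fB_pos x).1
  add_left := fB_add_left
  smul_left x y r := by simp [fB_smul_left]
  definite x := (fB_pos x).2

noncomputable instance fockNormed : NormedAddCommGroup Fk := fockCore.toNormedAddCommGroup

noncomputable instance fockInner : InnerProductSpace ℝ Fk := InnerProductSpace.ofCore fockCore.1

lemma fock_inner (x y : Fk) : inner ℝ x y = fB x y := rfl

lemma fock_functional {π : Multiset ℤ} (hπ : Adm 1 π) : ∃ L : Fk →ₗ[ℝ] ℝ,
    L (fockRep.mon π) ≠ 0 ∧
      ∀ τ, Neg τ → L (fockRep.mon τ) ≠ 0 → π = τ ∨ Prec π τ := by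
  set U := Submodule.span ℝ ((fun σ : {σ | Adm 1 σ} => fockRep.mon σ.1) '' {σ | σ.1 ≠ π})
  have hU : fockRep.mon π ∉ U := by
    have := fock_indep.notMem_span_image (s := {σ | σ.1 ≠ π}) (x := ⟨π, hπ⟩) (by simp)
    exact this
  obtain ⟨L, hL, hUL⟩ := Submodule.exists_le_ker_of_notMem hU
  refine ⟨L, hL, fun τ hτ hne => ?_⟩
  by_contra hc
  push Not at hc
  refine hne (hUL ?_)
  refine Submodule.span_le.2 ?_ (fockRep.mon_mem_span fock_fieldRel τ hτ)
  rintro x ⟨σ, h1, -, h3, rfl⟩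
  refine Submodule.subset_span ⟨⟨σ, h1⟩, ?_, rfl⟩
  rintro rfl
  exact h3.elim hc.1 hc.2

/-- unitary models exist at every level -/
theorem exists_vacModel (k : ℕ) : Nonempty (VacModel k) := by
  induction k with
  | zero =>
    refine ⟨⟨ℝ, ⟨fun _ => 0, 1, by simp, by simp⟩, by simp, by simp, ?_, ?_⟩⟩
    · intro w
      refine ⟨0, fun D _ t M => ?_⟩
      have : (⟨fun _ => 0, 1, by simp, by simp⟩ : VRep ((0 : ℕ) : ℝ) ℝ).G t D = 0 := by
        refine PowerSeries.ext fun m => ?_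
        simp [VRep.G, VRep.Y]
      rw [this]
      simp
    · intro π hπ
      have h0 : π = 0 := by
        refine Multiset.eq_zero_of_forall_notMem fun p hp => ?_
        have h1 := Multiset.count_pos.2 hp
        have h2 := hπ.2 (p / 3)
        have : p = 3 * (p / 3) ∨ p = 3 * (p / 3) + 1 ∨ p = 3 * (p / 3) + 2 := by omega
        rcases this with h3 | h3 | h3 <;> rw [h3] at h1 <;> omega
      subst h0
      refine ⟨LinearMap.id, by simp [VRep.mon], fun τ _ _ => ?_⟩
      rcases eq_or_ne τ 0 with rfl | hne
      · exact Or.inl rfl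
      · exact Or.inr (Or.inl (by simpa using Multiset.card_pos.2 hne))
  | succ k ih =>
    obtain ⟨M⟩ := ih
    refine ⟨⟨M.V ⊗[ℝ] Fk, M.R.tens fockRep (by push_cast; rfl), ?_, ?_, ?_, ?_⟩⟩
    · rw [VRep.tens_v, TensorProduct.inner_tmul, M.norm_v, fock_inner]
      change 1 * fB 1 1 = 1
      rw [fB_one, vev_one, one_mul]
    · intro p x y
      induction x with
      | zero => simp
      | add x x' hx hx' => rw [map_add, inner_add_left, hx, hx', inner_add_left]
      | tmul x x' =>
        induction y with
        | zero => simp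
        | add y y' hy hy' => rw [map_add, inner_add_right, hy, hy', inner_add_right]
        | tmul y y' =>
          have : inner ℝ (fockRep.X p x') y' = inner ℝ x' (fockRep.X (2 - p) y') :=
            fB_fX p x' y'
          rw [VRep.tens_X, VRep.tens_X, inner_add_left, inner_add_right]
          simp only [TensorProduct.inner_tmul, M.adj, this]
    · exact M.R.tens_fieldRel fockRep _ M.rel fock_fieldRel
    · intro π hπ
      obtain ⟨σ, π', rfl, h1, h2⟩ := adm_decompose hπ
      obtain ⟨L, hL, hL'⟩ := M.func π' h2
      obtain ⟨L', hM, hM'⟩ := fock_functional h1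
      exact M.R.tens_functional fockRep _ L L' hL hL' hM hM' hπ.1


namespace VRep

section
variable {κ : ℝ} {V W : Type*} [AddCommGroup V] [Module ℝ V] [AddCommGroup W] [Module ℝ W]
  (R : VRep κ V) (S : VRep κ W)

/-- the direct product of two vacuum representations of the same level -/
def prod : VRep κ (V × W) where
  X p := (R.X p).prodMap (S.X p)
  v := (R.v, S.v)
  comm p q := by
    refine LinearMap.ext fun x => ?_
    have h1 := LinearMap.congr_fun (R.comm p q) x.1
    have h2 := LinearMap.congr_fun (S.comm p q) x.2
    exact Prod.ext h1 h2
  vac p hp := Prod.ext (R.vac p hp) (S.vac p hp)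

lemma prod_wd (u : List ℤ) (x : V × W) : (R.prod S).wd u x = (R.wd u x.1, S.wd u x.2) := by
  induction u with
  | nil => simp
  | cons p u ih =>
    rw [wd_cons, Module.End.mul_apply, ih, wd_cons, wd_cons]
    rfl

lemma prod_mon (σ : Multiset ℤ) : (R.prod S).mon σ = (R.mon σ, S.mon σ) :=
  prod_wd R S _ _

lemma mon_zero : R.mon 0 = R.v := by simp [mon]

lemma wd_mem_span (u : List ℤ) :
    R.wd u R.v ∈ Submodule.span ℝ {x | ∃ σ, Neg σ ∧ x = R.mon σ} := by
  refine Submodule.span_mono ?_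
    (R.Fil_le_span _ _ (R.wd_mem_Fil u (Nat.lt_succ_self _) rfl))
  rintro x ⟨σ, h1, -, -, rfl⟩
  exact ⟨σ, h1, rfl⟩

lemma exists_vev (u : List ℤ) : ∃ c : ℝ,
    R.wd u R.v - c • R.v ∈ Submodule.span ℝ {x | ∃ σ, Neg σ ∧ σ ≠ 0 ∧ x = R.mon σ} := by
  have h : R.wd u R.v ∈ Submodule.span ℝ (insert R.v {x | ∃ σ, Neg σ ∧ σ ≠ 0 ∧ x = R.mon σ}) := by
    refine Submodule.span_mono ?_ (R.wd_mem_span u)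
    rintro x ⟨σ, h1, rfl⟩
    by_cases h0 : σ = 0
    · left
      rw [h0, mon_zero]
    · exact Or.inr ⟨σ, h1, h0, rfl⟩
  obtain ⟨c, z, hz, h⟩ := Submodule.mem_span_insert.1 h
  exact ⟨c, by rw [h, add_sub_cancel_left]; exact hz⟩

lemma exists_common_vev (u : List ℤ) : ∃ c : ℝ,
    R.wd u R.v - c • R.v ∈ Submodule.span ℝ {x | ∃ σ, Neg σ ∧ σ ≠ 0 ∧ x = R.mon σ} ∧
    S.wd u S.v - c • S.v ∈ Submodule.span ℝ {x | ∃ σ, Neg σ ∧ σ ≠ 0 ∧ x = S.mon σ} := by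
  obtain ⟨c, hc⟩ := (R.prod S).exists_vev u
  have e : (R.prod S).wd u (R.prod S).v - c • (R.prod S).v =
      (R.wd u R.v - c • R.v, S.wd u S.v - c • S.v) := by
    rw [prod_wd]
    rfl
  rw [e] at hc
  refine ⟨c, ?_, ?_⟩
  · have h := Submodule.mem_map_of_mem (f := LinearMap.fst ℝ V W) hc
    rw [Submodule.map_span] at h
    refine Submodule.span_mono ?_ h
    rintro _ ⟨_, ⟨σ, h1, h2, rfl⟩, rfl⟩
    exact ⟨σ, h1, h2, by rw [prod_mon]; rfl⟩
  · have h := Submodule.mem_map_of_mem (f := LinearMap.snd ℝ V W) hc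
    rw [Submodule.map_span] at h
    refine Submodule.span_mono ?_ h
    rintro _ ⟨_, ⟨σ, h1, h2, rfl⟩, rfl⟩
    exact ⟨σ, h1, h2, by rw [prod_mon]; rfl⟩

end

end VRep

namespace VacModel

variable {k : ℕ} (M : VacModel k)

lemma inner_wd (u : List ℤ) (x y : M.V) : Inner.inner ℝ (M.R.wd u x) y =
    Inner.inner ℝ x (M.R.wd (u.reverse.map (2 - ·)) y) := by
  induction u generalizing y with
  | nil => simp
  | cons p u ih =>
    rw [VRep.wd_cons, Module.End.mul_apply, M.adj, ih, List.reverse_cons, List.map_append,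
      VRep.wd_append, Module.End.mul_apply]
    simp [VRep.wd_cons]

lemma inner_v_mon {σ : Multiset ℤ} (hσ : Neg σ) (h0 : σ ≠ 0) :
    Inner.inner ℝ M.R.v (M.R.mon σ) = 0 := by
  rw [VRep.mon]
  have hl : σ.sort (· ≥ ·) ≠ [] := fun h => h0 (by rw [← Multiset.sort_eq σ (· ≥ ·), h]; rfl)
  obtain ⟨p, u, hu⟩ := List.exists_cons_of_ne_nil hl
  have hp : 3 ≤ p := hσ p ((Multiset.mem_sort (r := (· ≥ ·))).1 (by rw [hu]; simp))
  have := M.adj (2 - p) M.R.v (M.R.wd u M.R.v)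
  rw [M.R.vac _ (by omega), inner_zero_left, sub_sub_cancel] at this
  rw [hu, VRep.wd_cons, Module.End.mul_apply, ← this]

/-- vacuum expectation value of a word -/
noncomputable def ex (u : List ℤ) : ℝ := Inner.inner ℝ M.R.v (M.R.wd u M.R.v)

lemma ex_unique {u : List ℤ} {c : ℝ} (h : M.R.wd u M.R.v - c • M.R.v ∈
    Submodule.span ℝ {x | ∃ σ, Neg σ ∧ σ ≠ 0 ∧ x = M.R.mon σ}) : c = M.ex u := by
  have : Inner.inner ℝ M.R.v (M.R.wd u M.R.v - c • M.R.v) = 0 := by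
    refine Submodule.span_induction ?_ (inner_zero_right _) ?_ ?_ h
    · rintro x ⟨σ, h1, h2, rfl⟩
      exact M.inner_v_mon h1 h2
    · intro x y _ _ hx hy
      rw [inner_add_right, hx, hy, add_zero]
    · intro r x _ hx
      rw [inner_smul_right, hx, mul_zero]
  rw [inner_sub_right, inner_smul_right, M.norm_v, mul_one] at this
  rw [ex]
  linarith

/-- A combination of words orthogonal to all words kills the vacuum. -/
lemma sum_eq_zero_of_ex {ι : Type*} (s : Finset ι) (r : ι → ℝ) (u : ι → List ℤ)
    (h : ∀ g, ∑ i ∈ s, r i * M.ex (g ++ u i) = 0) :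
    ∑ i ∈ s, r i • M.R.wd (u i) M.R.v = 0 := by
  obtain ⟨x, hx⟩ : ∃ x, x = ∑ i ∈ s, r i • M.R.wd (u i) M.R.v := ⟨_, rfl⟩
  rw [← hx]
  have h1 : ∀ g, Inner.inner ℝ M.R.v (M.R.wd g x) = 0 := by
    intro g
    rw [hx, map_sum, inner_sum, ← h g]
    refine Finset.sum_congr rfl fun i _ => ?_
    rw [map_smul, inner_smul_right, ex, VRep.wd_append, Module.End.mul_apply]
  have h2 : ∀ g, Inner.inner ℝ (M.R.wd g M.R.v) x = 0 := fun g => by rw [inner_wd, h1]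
  refine (inner_self_eq_zero (𝕜 := ℝ)).1 ?_
  nth_rewrite 1 [hx]
  rw [sum_inner]
  refine Finset.sum_eq_zero fun i _ => ?_
  rw [inner_smul_left, h2, mul_zero]

lemma sum_ex_eq_zero {ι : Type*} (s : Finset ι) (r : ι → ℝ) (u : ι → List ℤ)
    (h : ∑ i ∈ s, r i • M.R.wd (u i) M.R.v = 0) (g : List ℤ) :
    ∑ i ∈ s, r i * M.ex (g ++ u i) = 0 := by
  have h1 : Inner.inner ℝ M.R.v (M.R.wd g (∑ i ∈ s, r i • M.R.wd (u i) M.R.v)) = 0 := by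
    rw [h, map_zero, inner_zero_right]
  rw [← h1, map_sum, inner_sum]
  refine Finset.sum_congr rfl fun i _ => ?_
  rw [map_smul, inner_smul_right, ex, VRep.wd_append, Module.End.mul_apply]

/-- independence of the admissible monomials in the model -/
lemma indep : LinearIndependent ℝ fun σ : {σ // Adm k σ} => M.R.mon σ.1 := by
  rw [linearIndependent_iff']
  intro s g hg
  by_contra! hc
  obtain ⟨i, hi, hgi⟩ := hc
  obtain ⟨π, hπ, hmax⟩ := (s.filter fun σ => g σ ≠ 0).exists_max_image
    (fun σ => toLex (σ.1.card, - omM σ.1)) ⟨i, by simp [hi, hgi]⟩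
  obtain ⟨hπs, hgπ⟩ := Finset.mem_filter.1 hπ
  obtain ⟨L, hL, hL'⟩ := M.func π.1 π.2
  have h := congrArg L hg
  rw [map_sum, map_zero, Finset.sum_eq_single π, map_smul, smul_eq_mul] at h
  · exact mul_ne_zero hgπ hL h
  · intro τ hτ hne
    rw [map_smul, smul_eq_mul]
    by_contra hz
    have hm := hmax τ (Finset.mem_filter.2 ⟨hτ, left_ne_zero_of_mul hz⟩)
    rcases hL' τ.1 τ.2.1 (right_ne_zero_of_mul hz) with e | e
    · exact hne (Subtype.ext e.symm)
    · rw [Prod.Lex.toLex_le_toLex] at hm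
      unfold Prec at e
      dsimp only at hm
      omega
  · exact fun h => absurd hπs h

lemma mon_mem_span_adm {τ : Multiset ℤ} (hτ : Neg τ) :
    M.R.mon τ ∈ Submodule.span ℝ {x | ∃ σ, Adm k σ ∧ x = M.R.mon σ} := by
  refine Submodule.span_mono ?_ (M.R.mon_mem_span M.rel τ hτ)
  rintro x ⟨σ, h1, -, -, rfl⟩
  exact ⟨σ, h1, rfl⟩

lemma wd_mem_span_adm (u : List ℤ) :
    M.R.wd u M.R.v ∈ Submodule.span ℝ {x | ∃ σ, Adm k σ ∧ x = M.R.mon σ} := by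
  refine Submodule.span_le.2 ?_ (M.R.wd_mem_span u)
  rintro x ⟨σ, h, rfl⟩
  exact M.mon_mem_span_adm h

end VacModel


section
variable {k : ℕ} (S : SL2VacuumModule k)

/-- the operator of a letter on the vacuum module -/
def opC (p : ℤ) : Module.End ℂ S.V :=
  if p % 3 = 0 then S.E (-(p / 3)) else if p % 3 = 1 then S.Hh (-(p / 3)) else S.F (-(p / 3))

lemma opC_comm (p q : ℤ) (x : S.V) : opC S p (opC S q x) - opC S q (opC S p x) =
    ((sc p q : ℝ) : ℂ) • opC S (p + q - 1) x + ((k * sd p q : ℝ) : ℂ) • x := by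
  have hp : p % 3 = 0 ∨ p % 3 = 1 ∨ p % 3 = 2 := by omega
  have hq : q % 3 = 0 ∨ q % 3 = 1 ∨ q % 3 = 2 := by omega
  have em : -(q / 3) + -(p / 3) = -(p / 3) + -(q / 3) := add_comm _ _
  have ez : (-(p / 3) + -(q / 3) = 0) ↔ (p / 3 + q / 3 = 0) := by omega
  rcases hp with hp | hp | hp <;> rcases hq with hq | hq | hq
  · have h := LinearMap.congr_fun (S.EE (-(p / 3)) (-(q / 3))).eq x
    simp only [Module.End.mul_apply] at h
    simp [opC, sc, sd, hp, hq, h]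
  · have h := LinearMap.congr_fun (S.HE (-(q / 3)) (-(p / 3))) x
    have e1 : (p + q - 1) % 3 = 0 := by omega
    have e2 : -((p + q - 1) / 3) = -(p / 3) + -(q / 3) := by omega
    simp only [Module.End.mul_apply, LinearMap.sub_apply, LinearMap.smul_apply, em] at h
    simp [opC, sc, sd, hp, hq, e1, e2, ← h]
  · have h := LinearMap.congr_fun (S.EF (-(p / 3)) (-(q / 3))) x
    have e1 : (p + q - 1) % 3 = 1 := by omega
    have e2 : -((p + q - 1) / 3) = -(p / 3) + -(q / 3) := by omega
    simp only [Module.End.mul_apply, LinearMap.sub_apply, LinearMap.smul_apply,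
      LinearMap.add_apply, Module.End.one_apply, ez] at h
    by_cases hc : p / 3 + q / 3 = 0
    · rw [if_pos hc] at h
      simp [opC, sc, sd, hp, hq, e1, e2, h, hc, mul_comm]
    · rw [if_neg hc] at h
      simp [opC, sc, sd, hp, hq, e1, e2, h, hc]
  · have h := LinearMap.congr_fun (S.HE (-(p / 3)) (-(q / 3))) x
    have e1 : (p + q - 1) % 3 = 0 := by omega
    have e2 : -((p + q - 1) / 3) = -(p / 3) + -(q / 3) := by omega
    simp only [Module.End.mul_apply, LinearMap.sub_apply, LinearMap.smul_apply] at h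
    simp [opC, sc, sd, hp, hq, e1, e2, ← h]
  · have h := LinearMap.congr_fun (S.HH (-(p / 3)) (-(q / 3))) x
    simp only [Module.End.mul_apply, LinearMap.sub_apply, LinearMap.smul_apply,
      Module.End.one_apply, ez] at h
    by_cases hc : p / 3 + q / 3 = 0
    · rw [if_pos hc] at h
      simp [opC, sc, sd, hp, hq, h, hc, mul_comm]
    · rw [if_neg hc] at h
      simp [opC, sc, sd, hp, hq, h, hc]
  · have h := LinearMap.congr_fun (S.HF (-(p / 3)) (-(q / 3))) x
    have e1 : (p + q - 1) % 3 = 2 := by omega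
    have e2 : -((p + q - 1) / 3) = -(p / 3) + -(q / 3) := by omega
    simp only [Module.End.mul_apply, LinearMap.sub_apply, LinearMap.smul_apply] at h
    simp [opC, sc, sd, hp, hq, e1, e2, h]
  · have h := LinearMap.congr_fun (S.EF (-(q / 3)) (-(p / 3))) x
    have e1 : (p + q - 1) % 3 = 1 := by omega
    have e2 : -((p + q - 1) / 3) = -(p / 3) + -(q / 3) := by omega
    simp only [Module.End.mul_apply, LinearMap.sub_apply, LinearMap.smul_apply,
      LinearMap.add_apply, Module.End.one_apply, em, ez] at h
    simp only [opC, sc, sd, hp, hq, e1, e2]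
    rw [← neg_inj, neg_sub]
    simp only [if_true, if_false, OfNat.ofNat_ne_zero, OfNat.ofNat_ne_one, one_ne_zero]
    rw [h]
    by_cases hc : p / 3 + q / 3 = 0
    · have : ((p / 3 : ℤ) : ℂ) = -((q / 3 : ℤ) : ℂ) := by
        rw [eq_neg_iff_add_eq_zero]
        exact_mod_cast hc
      simp [hc, this, mul_comm, add_comm]
    · simp [hc]
  · have h := LinearMap.congr_fun (S.HF (-(q / 3)) (-(p / 3))) x
    have e1 : (p + q - 1) % 3 = 2 := by omega
    have e2 : -((p + q - 1) / 3) = -(p / 3) + -(q / 3) := by omega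
    simp only [Module.End.mul_apply, LinearMap.sub_apply, LinearMap.smul_apply, em] at h
    rw [← neg_inj, neg_sub]
    simp [opC, sc, sd, hp, hq, e1, e2, h]
  · have h := LinearMap.congr_fun (S.FF (-(p / 3)) (-(q / 3))).eq x
    simp only [Module.End.mul_apply] at h
    simp [opC, sc, sd, hp, hq, h]

lemma D_opC (p : ℤ) (x : S.V) :
    S.D (opC S p x) = opC S p (S.D x) + ((-(p / 3) : ℤ) : ℂ) • opC S p x := by
  unfold opC
  rw [← sub_eq_iff_eq_add']
  split_ifs
  · exact LinearMap.congr_fun (S.DE _) x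
  · exact LinearMap.congr_fun (S.DH _) x
  · exact LinearMap.congr_fun (S.DF _) x

/-- the vacuum module as a real vacuum representation -/
def realRep : VRep (k : ℝ) S.V where
  X p := (opC S p).restrictScalars ℝ
  v := S.hwv
  comm p q := by
    refine LinearMap.ext fun x => ?_
    have := opC_comm S p q x
    rw [Complex.coe_smul, Complex.coe_smul] at this
    exact this
  vac p hp := by
    obtain ⟨h1, h2, h3⟩ := S.hwv_hw (-(p / 3)) (by omega)
    change opC S p S.hwv = 0
    unfold opC
    split_ifs <;> assumption

/-- complex-linear operator of a word -/
def wdC (u : List ℤ) : Module.End ℂ S.V := (u.map (opC S)).prod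

lemma wdC_cons (p : ℤ) (u : List ℤ) : wdC S (p :: u) = opC S p * wdC S u := by simp [wdC]

lemma wdC_append (u w : List ℤ) : wdC S (u ++ w) = wdC S u * wdC S w := by simp [wdC]

lemma realRep_wd (u : List ℤ) (x : S.V) : (realRep S).wd u x = wdC S u x := by
  induction u with
  | nil => simp [wdC]
  | cons p u ih =>
    rw [VRep.wd_cons, Module.End.mul_apply, ih, wdC_cons]
    rfl

lemma D_wdC (u : List ℤ) : S.D (wdC S u S.hwv) = ((-degL u : ℤ) : ℂ) • wdC S u S.hwv := by
  induction u with
  | nil => simp [wdC, degL, S.hwv_deg]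
  | cons p u ih =>
    rw [wdC_cons, Module.End.mul_apply, D_opC, ih, map_smul, ← add_smul]
    congr 1
    simp [degL]

/-- sum of the eigenspaces of the degree operator for nonzero eigenvalues -/
def lowerPart : Submodule ℂ S.V := ⨆ (μ : ℂ) (_ : μ ≠ 0), S.D.eigenspace μ

lemma hwv_notMem : S.hwv ∉ lowerPart S := by
  intro h
  have h1 := (Module.End.eigenspaces_iSupIndep S.D) 0
  have h2 : S.hwv ∈ S.D.eigenspace 0 := by
    rw [Module.End.mem_eigenspace_iff, S.hwv_deg, zero_smul]
  exact S.hwv_ne (Submodule.disjoint_def.1 h1 _ h2 h)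

lemma mon_mem_lowerPart {σ : Multiset ℤ} (hσ : Neg σ) (h0 : σ ≠ 0) :
    (realRep S).mon σ ∈ lowerPart S := by
  have hd : degM σ ≠ 0 := by
    obtain ⟨p, hp⟩ := Multiset.exists_mem_of_ne_zero h0
    have h1 : ∀ x ∈ σ.map fun p => p / 3, 0 ≤ x := by
      intro x hx
      obtain ⟨q, hq, rfl⟩ := Multiset.mem_map.1 hx
      have := hσ q hq
      omega
    have h2 := Multiset.single_le_sum h1 _ (Multiset.mem_map_of_mem _ hp)
    have := hσ p hp
    unfold degM
    omega
  refine Submodule.mem_iSup_of_mem ((-degM σ : ℤ) : ℂ) (Submodule.mem_iSup_of_mem ?_ ?_)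
  · exact_mod_cast neg_ne_zero.2 hd
  · rw [Module.End.mem_eigenspace_iff, VRep.mon, realRep_wd]
    have := D_wdC S (σ.sort (· ≥ ·))
    rw [← VRep.degM_coe, Multiset.sort_eq] at this
    exact this

lemma wdC_sub_mem (M : VacModel k) (u : List ℤ) :
    wdC S u S.hwv - ((M.ex u : ℝ) : ℂ) • S.hwv ∈ lowerPart S := by
  obtain ⟨c, h1, h2⟩ := (realRep S).exists_common_vev M.R u
  rw [← M.ex_unique h2, Complex.coe_smul, ← realRep_wd]
  have : Submodule.span ℝ {x | ∃ σ, Neg σ ∧ σ ≠ 0 ∧ x = (realRep S).mon σ} ≤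
      (lowerPart S).restrictScalars ℝ := by
    refine Submodule.span_le.2 ?_
    rintro x ⟨σ, h1, h2, rfl⟩
    exact mon_mem_lowerPart S h1 h2
  exact this h1

lemma sum_wdC_sub_mem (M : VacModel k) {ι : Type*} (s : Finset ι) (z : ι → ℂ)
    (u : ι → List ℤ) :
    ∑ i ∈ s, z i • wdC S (u i) S.hwv - (∑ i ∈ s, z i * M.ex (u i)) • S.hwv ∈ lowerPart S := by
  rw [Finset.sum_smul, ← Finset.sum_sub_distrib]
  refine Submodule.sum_mem _ fun i _ => ?_
  rw [mul_smul, ← smul_sub]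
  exact Submodule.smul_mem _ _ (wdC_sub_mem S M _)

lemma sum_wdC_append {ι : Type*} (s : Finset ι) (z : ι → ℂ) (u : ι → List ℤ) (g : List ℤ) :
    ∑ i ∈ s, z i • wdC S (g ++ u i) S.hwv = wdC S g (∑ i ∈ s, z i • wdC S (u i) S.hwv) := by
  rw [map_sum]
  refine Finset.sum_congr rfl fun i _ => ?_
  rw [map_smul, wdC_append, Module.End.mul_apply]

/-- Relations in the vacuum module hold in the model. -/
lemma model_relation (M : VacModel k) {ι : Type*} (s : Finset ι) (z : ι → ℂ) (u : ι → List ℤ)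
    (h : ∑ i ∈ s, z i • wdC S (u i) S.hwv = 0) :
    ∑ i ∈ s, (z i).re • M.R.wd (u i) M.R.v = 0 ∧
      ∑ i ∈ s, (z i).im • M.R.wd (u i) M.R.v = 0 := by
  have key : ∀ g, ∑ i ∈ s, z i * M.ex (g ++ u i) = 0 := by
    intro g
    by_contra hc
    have h1 := sum_wdC_sub_mem S M s z fun i => g ++ u i
    rw [sum_wdC_append, h, map_zero, zero_sub, Submodule.neg_mem_iff,
      Submodule.smul_mem_iff _ hc] at h1
    exact hwv_notMem S h1
  constructor
  · refine M.sum_eq_zero_of_ex s _ u fun g => ?_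
    simpa using congrArg Complex.re (key g)
  · refine M.sum_eq_zero_of_ex s _ u fun g => ?_
    simpa using congrArg Complex.im (key g)

lemma opC_stable {U : Submodule ℂ S.V} (hU : ∀ p, ∀ x ∈ U, opC S p x ∈ U) : U = ⊥ ∨ U = ⊤ := by
  refine S.irred U fun n x hx => ?_
  have h0 := hU (3 * (-n)) x hx
  have h1 := hU (3 * (-n) + 1) x hx
  have h2 := hU (3 * (-n) + 2) x hx
  have e0 : opC S (3 * (-n)) = S.E n := by
    rw [opC, if_pos (by omega)]
    congr 1
    omega
  have e1 : opC S (3 * (-n) + 1) = S.Hh n := by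
    rw [opC, if_neg (by omega), if_pos (by omega)]
    congr 1
    omega
  have e2 : opC S (3 * (-n) + 2) = S.F n := by
    rw [opC, if_neg (by omega), if_neg (by omega)]
    congr 1
    omega
  rw [e0] at h0
  rw [e1] at h1
  rw [e2] at h2
  exact ⟨h0, h1, h2⟩

lemma span_words_stable (x : S.V) (p : ℤ) :
    ∀ y ∈ Submodule.span ℂ (Set.range fun g => wdC S g x),
      opC S p y ∈ Submodule.span ℂ (Set.range fun g => wdC S g x) := by
  intro y hy
  have : Submodule.span ℂ (Set.range fun g => wdC S g x) ≤
      (Submodule.span ℂ (Set.range fun g => wdC S g x)).comap (opC S p) := by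
    refine Submodule.span_le.2 ?_
    rintro _ ⟨g, rfl⟩
    exact Submodule.subset_span ⟨p :: g, by simp [wdC_cons]⟩
  exact this hy

/-- Real relations in the model hold in the vacuum module. -/
lemma relation_of_model (M : VacModel k) {ι : Type*} (s : Finset ι) (r : ι → ℝ)
    (u : ι → List ℤ) (h : ∑ i ∈ s, r i • M.R.wd (u i) M.R.v = 0) :
    ∑ i ∈ s, (r i : ℂ) • wdC S (u i) S.hwv = 0 := by
  set x := ∑ i ∈ s, (r i : ℂ) • wdC S (u i) S.hwv with hx
  have hle : Submodule.span ℂ (Set.range fun g => wdC S g x) ≤ lowerPart S := by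
    refine Submodule.span_le.2 ?_
    rintro _ ⟨g, rfl⟩
    have h1 := sum_wdC_sub_mem S M s (fun i => (r i : ℂ)) fun i => g ++ u i
    have h2 : ∑ i ∈ s, (r i : ℂ) * M.ex (g ++ u i) = 0 := by
      exact_mod_cast M.sum_ex_eq_zero s r u h g
    rw [h2, zero_smul, sub_zero, sum_wdC_append] at h1
    exact h1
  have hxm : x ∈ Submodule.span ℂ (Set.range fun g => wdC S g x) :=
    Submodule.subset_span ⟨[], by simp [wdC]⟩
  rcases opC_stable S (span_words_stable S x) with hU | hU
  · rwa [hU, Submodule.mem_bot] at hxm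
  · exact absurd (hle (by rw [hU]; trivial)) (hwv_notMem S)

lemma span_words : Submodule.span ℂ (Set.range fun g => wdC S g S.hwv) = ⊤ := by
  refine (opC_stable S (span_words_stable S S.hwv)).resolve_left fun h => S.hwv_ne ?_
  have hm : S.hwv ∈ Submodule.span ℂ (Set.range fun g => wdC S g S.hwv) :=
    Submodule.subset_span ⟨[], by simp [wdC]⟩
  rwa [h, Submodule.mem_bot] at hm

/-- the sorted monomial vector -/
noncomputable def monC (σ : Multiset ℤ) : S.V := wdC S (σ.sort (· ≥ ·)) S.hwv

theorem monC_indep : LinearIndependent ℂ fun σ : {σ // Adm k σ} => monC S σ.1 := by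
  obtain ⟨M⟩ := exists_vacModel k
  rw [linearIndependent_iff']
  intro s z hz σ hσ
  obtain ⟨h1, h2⟩ := model_relation S M s z _ hz
  have hi := linearIndependent_iff'.1 M.indep
  exact Complex.ext (hi s _ h1 σ hσ) (hi s _ h2 σ hσ)

theorem monC_span : Submodule.span ℂ (Set.range fun σ : {σ // Adm k σ} => monC S σ.1) = ⊤ := by
  obtain ⟨M⟩ := exists_vacModel k
  rw [eq_top_iff, ← span_words S, Submodule.span_le]
  rintro _ ⟨u, rfl⟩
  have hm : M.R.wd u M.R.v ∈ Submodule.span ℝ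
      (Set.range fun σ : {σ // Adm k σ} => M.R.mon σ.1) := by
    refine Submodule.span_mono ?_ (M.wd_mem_span_adm u)
    rintro x ⟨σ, h, rfl⟩
    exact ⟨⟨σ, h⟩, rfl⟩
  obtain ⟨c, hc⟩ := Finsupp.mem_span_range_iff_exists_finsupp.1 hm
  have hrel := relation_of_model S M (insert none (c.support.map Function.Embedding.some))
    (fun o => o.elim (-1) c) (fun o => o.elim u fun σ => σ.1.sort (· ≥ ·)) (by
      rw [Finset.sum_insert (by simp), Finset.sum_map]
      simp only [Option.elim, Function.Embedding.some_apply]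
      rw [neg_smul, one_smul, neg_add_eq_zero, ← hc]
      rfl)
  rw [Finset.sum_insert (by simp), Finset.sum_map] at hrel
  simp only [Option.elim, Function.Embedding.some_apply] at hrel
  rw [Complex.ofReal_neg, Complex.ofReal_one, neg_smul, one_smul, neg_add_eq_zero] at hrel
  rw [SetLike.mem_coe]
  beta_reduce
  rw [hrel]
  exact Submodule.sum_mem _ fun σ _ => Submodule.smul_mem _ _ (Submodule.subset_span ⟨σ, rfl⟩)

end


/-- the letters of a colored partition with parts smaller than `n`, in decreasing order -/
def letters (π : SL2CPart) : ℕ → List ℤ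
  | 0 => []
  | n + 1 => List.replicate (π.c n) (3 * (n : ℤ) + 2) ++ (List.replicate (π.b n) (3 * (n : ℤ) + 1) ++
      (List.replicate (π.a n) (3 * (n : ℤ)) ++ letters π n))

variable (π : SL2CPart)

lemma mem_letters {n : ℕ} {p : ℤ} (hp : p ∈ letters π n) : 0 ≤ p ∧ p < 3 * n := by
  induction n with
  | zero => simp [letters] at hp
  | succ n ih =>
    simp only [letters, List.mem_append, List.mem_replicate] at hp
    rcases hp with h | h | h | h
    · omega
    · omega
    · omega
    · have := ih h
      omega

lemma pairwise_replicate_append {c : ℕ} {x : ℤ} {l : List ℤ} (hl : l.Pairwise (· ≥ ·))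
    (h : ∀ y ∈ l, y ≤ x) : (List.replicate c x ++ l).Pairwise (· ≥ ·) := by
  refine List.pairwise_append.2 ⟨List.pairwise_replicate.2 (Or.inr le_rfl), hl, ?_⟩
  intro a ha b hb
  rw [List.eq_of_mem_replicate ha]
  exact h b hb

lemma letters_sorted (n : ℕ) : (letters π n).Pairwise (· ≥ ·) := by
  induction n with
  | zero => simp [letters]
  | succ n ih =>
    refine pairwise_replicate_append (pairwise_replicate_append (pairwise_replicate_append ih ?_)
      ?_) ?_
    · intro y hy
      have := mem_letters π hy
      omega
    · intro y hy
      rcases List.mem_append.1 hy with h | h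
      · have := List.eq_of_mem_replicate h
        omega
      · have := mem_letters π h
        omega
    · intro y hy
      rcases List.mem_append.1 hy with h | h
      · have := List.eq_of_mem_replicate h
        omega
      · rcases List.mem_append.1 h with h | h
        · have := List.eq_of_mem_replicate h
          omega
        · have := mem_letters π h
          omega

lemma count_letters (n j : ℕ) :
    (letters π n).count (3 * (j : ℤ)) = (if j < n then π.a j else 0) ∧
    (letters π n).count (3 * (j : ℤ) + 1) = (if j < n then π.b j else 0) ∧
    (letters π n).count (3 * (j : ℤ) + 2) = (if j < n then π.c j else 0) := by
  induction n with
  | zero => simp [letters]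
  | succ n ih =>
    obtain ⟨h1, h2, h3⟩ := ih
    simp only [letters, List.count_append, List.count_replicate, beq_iff_eq, h1, h2, h3]
    rcases lt_trichotomy j n with h | rfl | h
    · refine ⟨?_, ?_, ?_⟩
      all_goals
        rw [if_neg (by omega), if_neg (by omega), if_neg (by omega), if_pos h, if_pos (by omega)]
        omega
    · refine ⟨?_, ?_, ?_⟩
      · rw [if_neg (by omega), if_neg (by omega), if_pos (by omega), if_neg (by omega),
          if_pos (by omega)]
        omega
      · rw [if_neg (by omega), if_pos (by omega), if_neg (by omega), if_neg (by omega),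
          if_pos (by omega)]
        omega
      · rw [if_pos (by omega), if_neg (by omega), if_neg (by omega), if_neg (by omega),
          if_pos (by omega)]
        omega
    · refine ⟨?_, ?_, ?_⟩
      all_goals
        rw [if_neg (by omega), if_neg (by omega), if_neg (by omega), if_neg (by omega),
          if_neg (by omega)]

lemma eq_zero_of_bound {j : ℕ} (h : π.bound ≤ j) : π.a j = 0 ∧ π.b j = 0 ∧ π.c j = 0 := by
  have key : j ∉ π.a.support ∪ π.b.support ∪ π.c.support := by
    intro hm
    have := Finset.le_sup (f := id) hm
    unfold SL2CPart.bound at h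
    simp only [id] at this h
    omega
  simpa [not_or, and_assoc] using key

/-- the multiset of letters of a colored partition -/
def toMS : Multiset ℤ := (letters π (π.bound + 1) : Multiset ℤ)

lemma count_toMS (j : ℕ) : (toMS π).count (3 * (j : ℤ)) = π.a j ∧
    (toMS π).count (3 * (j : ℤ) + 1) = π.b j ∧ (toMS π).count (3 * (j : ℤ) + 2) = π.c j := by
  simp only [toMS, Multiset.coe_count]
  obtain ⟨h1, h2, h3⟩ := count_letters π (π.bound + 1) j
  rw [h1, h2, h3]
  by_cases h : j < π.bound + 1
  · simp [h]
  · obtain ⟨h1, h2, h3⟩ := eq_zero_of_bound π (j := j) (by omega)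
    simp [h1, h2, h3]

lemma count_toMS_neg {p : ℤ} (hp : p < 0) : (toMS π).count p = 0 := by
  rw [Multiset.count_eq_zero]
  intro h
  have := mem_letters π (Multiset.mem_coe.1 h)
  omega

lemma wdC_letters {k : ℕ} (S : SL2VacuumModule k) (n : ℕ) : wdC S (letters π n) =
    (((List.range n).reverse).map fun (j : ℕ) =>
      (S.F (-(j : ℤ))) ^ (π.c j) * (S.Hh (-(j : ℤ))) ^ (π.b j) *
        (S.E (-(j : ℤ))) ^ (π.a j)).prod := by
  have hr : ∀ (c : ℕ) (p : ℤ), wdC S (List.replicate c p) = opC S p ^ c := by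
    intro c p
    simp [wdC]
  induction n with
  | zero => simp [letters, wdC]
  | succ n ih =>
    have e0 : opC S (3 * (n : ℤ)) = S.E (-n) := by
      rw [opC, if_pos (by omega)]
      congr 2
      omega
    have e1 : opC S (3 * (n : ℤ) + 1) = S.Hh (-n) := by
      rw [opC, if_neg (by omega), if_pos (by omega)]
      congr 2
      omega
    have e2 : opC S (3 * (n : ℤ) + 2) = S.F (-n) := by
      rw [opC, if_neg (by omega), if_neg (by omega)]
      congr 2
      omega
    rw [List.range_succ, List.reverse_append, List.reverse_singleton, List.singleton_append,
      List.map_cons, List.prod_cons, ← ih, letters, wdC_append, wdC_append, wdC_append, hr, hr, hr,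
      e0, e1, e2, mul_assoc, mul_assoc]

lemma toEnd_hwv {k : ℕ} (S : SL2VacuumModule k) : π.toEnd S S.hwv = monC S (toMS π) := by
  have : (toMS π).sort (· ≥ ·) = letters π (π.bound + 1) :=
    (Multiset.coe_eq_coe.1 (Multiset.sort_eq (toMS π) (· ≥ ·))).eq_of_pairwise'
      (Multiset.pairwise_sort _ _) (letters_sorted π _)
  rw [monC, this, wdC_letters, SL2CPart.toEnd]

lemma adm_toMS {k : ℕ} (h1 : π.DC k) (h2 : π.IC k) : Adm k (toMS π) := by
  refine ⟨?_, ?_⟩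
  · intro p hp
    have h0 : 0 ≤ p := by
      by_contra hc
      exact (Multiset.count_pos.2 hp).ne' (count_toMS_neg π (by omega))
    by_contra hc
    have hpos := Multiset.count_pos.2 hp
    obtain ⟨e1, e2, e3⟩ := count_toMS π 0
    rw [π.a_zero] at e1
    rw [π.b_zero] at e2
    rw [h2.2] at e3
    have : p = 3 * ((0 : ℕ) : ℤ) ∨ p = 3 * ((0 : ℕ) : ℤ) + 1 ∨ p = 3 * ((0 : ℕ) : ℤ) + 2 := by
      omega
    rcases this with rfl | rfl | rfl <;> omega
  · intro j
    rcases lt_or_ge j 0 with hj | hj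
    · have z : ∀ p : ℤ, p < 3 → (toMS π).count p = 0 := by
        intro p hp
        rcases lt_or_ge p 0 with h | h
        · exact count_toMS_neg π h
        · obtain ⟨e1, e2, e3⟩ := count_toMS π 0
          have : p = 3 * ((0 : ℕ) : ℤ) ∨ p = 3 * ((0 : ℕ) : ℤ) + 1 ∨
            p = 3 * ((0 : ℕ) : ℤ) + 2 := by omega
          rcases this with rfl | rfl | rfl
          · rw [e1, π.a_zero]
          · rw [e2, π.b_zero]
          · rw [e3, h2.2]
      rw [z (3 * j) (by omega), z (3 * j + 1) (by omega), z (3 * j + 2) (by omega),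
        z (3 * j + 3) (by omega), z (3 * j + 4) (by omega), z (3 * j + 5) (by omega)]
      simp
    · obtain ⟨n, rfl⟩ := Int.eq_ofNat_of_zero_le hj
      obtain ⟨e1, e2, e3⟩ := count_toMS π n
      obtain ⟨f1, f2, f3⟩ := count_toMS π (n + 1)
      have g1 : 3 * ((n + 1 : ℕ) : ℤ) = 3 * n + 3 := by push_cast; ring
      have g2 : 3 * (n : ℤ) + 3 + 1 = 3 * n + 4 := by ring
      have g3 : 3 * (n : ℤ) + 3 + 2 = 3 * n + 5 := by ring
      rw [g1] at f1 f2 f3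
      rw [g2] at f2
      rw [g3] at f3
      have := h1 n
      rw [e1, e2, e3, f1, f2, f3]
      omega

lemma toMS_injective : Function.Injective toMS := by
  intro π π' h
  have key : ∀ j, π.a j = π'.a j ∧ π.b j = π'.b j ∧ π.c j = π'.c j := by
    intro j
    obtain ⟨e1, e2, e3⟩ := count_toMS π j
    obtain ⟨f1, f2, f3⟩ := count_toMS π' j
    rw [← e1, ← e2, ← e3, ← f1, ← f2, ← f3, h]
    exact ⟨rfl, rfl, rfl⟩
  cases π
  cases π'
  congr 1
  · exact Finsupp.ext fun j => (key j).1
  · exact Finsupp.ext fun j => (key j).2.1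
  · exact Finsupp.ext fun j => (key j).2.2

lemma exists_toMS_eq {k : ℕ} {σ : Multiset ℤ} (h : Adm k σ) :
    ∃ π : SL2CPart, (π.DC k ∧ π.IC k) ∧ toMS π = σ := by
  have hfin : ∀ r : ℤ, 0 ≤ r → r < 3 → ∀ j : ℕ, σ.count (3 * (j : ℤ) + r) ≠ 0 →
      j ∈ σ.toFinset.image fun p => (p / 3).toNat := by
    intro r h0 h3 j hj
    refine Finset.mem_image.2 ⟨_, Multiset.mem_toFinset.2
      (Multiset.count_pos.1 (Nat.pos_of_ne_zero hj)), ?_⟩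
    omega
  have hz : ∀ p : ℤ, p < 3 → σ.count p = 0 := fun p hp =>
    Multiset.count_eq_zero.2 fun hm => absurd (h.1 p hm) (by omega)
  refine ⟨⟨Finsupp.onFinset _ (fun j : ℕ => σ.count (3 * (j : ℤ) + 0)) (hfin 0 (by omega) (by omega)),
    Finsupp.onFinset _ (fun j : ℕ => σ.count (3 * (j : ℤ) + 1)) (hfin 1 (by omega) (by omega)),
    Finsupp.onFinset _ (fun j : ℕ => σ.count (3 * (j : ℤ) + 2)) (hfin 2 (by omega) (by omega)),
    hz _ (by simp), hz _ (by simp)⟩, ⟨?_, ?_, ?_⟩, ?_⟩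
  · intro j
    have := h.2 j
    have g1 : 3 * ((j + 1 : ℕ) : ℤ) = 3 * j + 3 := by push_cast; ring
    have g2 : 3 * ((j + 1 : ℕ) : ℤ) + 1 = 3 * j + 4 := by push_cast; ring
    have g3 : 3 * ((j + 1 : ℕ) : ℤ) + 2 = 3 * j + 5 := by push_cast; ring
    simp only [Finsupp.onFinset_apply, add_zero]
    rw [g2, g3, g1]
    omega
  · have := h.2 0
    simp only [Finsupp.onFinset_apply]
    norm_num at this ⊢
    omega
  · exact hz _ (by simp)
  · refine Multiset.ext.2 fun p => ?_
    rcases lt_or_ge p 0 with hp | hp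
    · rw [count_toMS_neg _ hp, hz p (by omega)]
    · obtain ⟨e1, e2, e3⟩ := count_toMS ⟨Finsupp.onFinset _
          (fun j : ℕ => σ.count (3 * (j : ℤ) + 0)) (hfin 0 (by omega) (by omega)),
        Finsupp.onFinset _ (fun j : ℕ => σ.count (3 * (j : ℤ) + 1)) (hfin 1 (by omega) (by omega)),
        Finsupp.onFinset _ (fun j : ℕ => σ.count (3 * (j : ℤ) + 2)) (hfin 2 (by omega) (by omega)),
        hz _ (by simp), hz _ (by simp)⟩ (p / 3).toNat
      simp only [Finsupp.onFinset_apply, add_zero] at e1 e2 e3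
      have : p = 3 * ((p / 3).toNat : ℤ) ∨ p = 3 * ((p / 3).toNat : ℤ) + 1 ∨
        p = 3 * ((p / 3).toNat : ℤ) + 2 := by omega
      simp only [add_zero]
      rcases this with h | h | h <;> rw [h] <;> assumption

end SL2Vac

/-- **Theorem (Meurman–Primc, Feigin–Kedem–Loktev–Miwa–Mukhin; Primc,
Section 9).**  The monomial vectors `x(π)v_{kΛ₀}` satisfying the difference
conditions (for all `j ≥ 0`) and the initial conditions `a₁ ≤ k`, `c₀ = 0`
are linearly independent in `L(kΛ₀)`; hence, combined with spanning, they are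
a basis of `L(kΛ₀)`. -/
theorem monomial_basis_of_vacuum_sl2_module (k : ℕ) (hk : 0 < k)
    (S : SL2VacuumModule k) :
    LinearIndependent ℂ
      (fun π : {π : SL2CPart // π.DC k ∧ π.IC k} => π.1.toEnd S S.hwv) ∧
    ∃ bas : Module.Basis {π : SL2CPart // π.DC k ∧ π.IC k} ℂ S.V,
      ∀ π, bas π = π.1.toEnd S S.hwv := by
  let e : {π : SL2CPart // π.DC k ∧ π.IC k} → {σ // SL2Vac.Adm k σ} := fun π =>
    ⟨SL2Vac.toMS π.1, SL2Vac.adm_toMS π.1 π.2.1 π.2.2⟩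
  have he : Function.Injective e := fun π π' h =>
    Subtype.ext (SL2Vac.toMS_injective (congrArg Subtype.val h))
  have hs : Function.Surjective e := by
    rintro ⟨σ, hσ⟩
    obtain ⟨π, hπ, rfl⟩ := SL2Vac.exists_toMS_eq hσ
    exact ⟨⟨π, hπ⟩, rfl⟩
  have hf : (fun π : {π : SL2CPart // π.DC k ∧ π.IC k} => π.1.toEnd S S.hwv) =
      (fun σ : {σ // SL2Vac.Adm k σ} => SL2Vac.monC S σ.1) ∘ e :=
    funext fun π => SL2Vac.toEnd_hwv π.1 S
  have hli : LinearIndependent ℂ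
      (fun π : {π : SL2CPart // π.DC k ∧ π.IC k} => π.1.toEnd S S.hwv) := by
    rw [hf]
    exact (SL2Vac.monC_indep S).comp e he
  have hsp : ⊤ ≤ Submodule.span ℂ
      (Set.range fun π : {π : SL2CPart // π.DC k ∧ π.IC k} => π.1.toEnd S S.hwv) := by
    rw [hf, hs.range_comp, SL2Vac.monC_span]
  exact ⟨hli, Module.Basis.mk hli hsp, fun π => Module.Basis.mk_apply hli hsp π⟩
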